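/- arXiv:1912.09911 — 2 statements merged into one kernel-verified Lean document; each statement's English description precedes it below -/
import Mathlib

section
/- For every J ⊆ {1,…,n} and every y ∈ W, the orientation φ_{J,y} induced by the (J,y)-chimney is braid-invariant. -/
open scoped RealInnerProductSpace
open scoped Classical

noncomputable section

/-- The ambient Euclidean space `V = ℝⁿ`. -/
abbrev V (n : ℕ) : Type := EuclideanSpace ℝ (Fin n)

/-- The data of an irreducible crystallographic (reduced) root system in `ℝⁿ`,
together with a choice of positive roots, simple roots and highest root. -/
structure RootData (n : ℕ) where
  Φ : Set (V n)
  pos : Set (V n)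
  simple : Fin n → V n
  highest : V n
  finite : Φ.Finite
  nonzero : ∀ α ∈ Φ, α ≠ 0
  neg_mem : ∀ α ∈ Φ, -α ∈ Φ
  span_top : Submodule.span ℝ Φ = ⊤
  reflect_mem : ∀ α ∈ Φ, ∀ β ∈ Φ, β - (2 * ⟪α, β⟫ / ⟪α, α⟫) • α ∈ Φ
  crystallographic : ∀ α ∈ Φ, ∀ β ∈ Φ, ∃ m : ℤ, 2 * ⟪α, β⟫ / ⟪α, α⟫ = (m : ℝ)
  reduced : ∀ α ∈ Φ, ∀ c : ℝ, c • α ∈ Φ → c = 1 ∨ c = -1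
  pos_sub : pos ⊆ Φ
  pos_total : ∀ α ∈ Φ, α ∈ pos ∨ -α ∈ pos
  pos_not_neg : ∀ α ∈ pos, -α ∉ pos
  simple_mem : ∀ i, simple i ∈ pos
  simple_indep : LinearIndependent ℝ simple
  pos_combo : ∀ α ∈ pos, ∃ c : Fin n → ℝ, (∀ i, 0 ≤ c i) ∧ α = ∑ i, c i • simple i
  highest_mem : highest ∈ pos
  highest_dominates : ∀ α ∈ pos, ∃ c : Fin n → ℝ, (∀ i, 0 ≤ c i) ∧
    highest - α = ∑ i, c i • simple i
  irreducible : ∀ A B : Set (Fin n), A ∪ B = Set.univ → A ∩ B = ∅ →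
    (∀ i ∈ A, ∀ j ∈ B, ⟪simple i, simple j⟫ = 0) → A = ∅ ∨ B = ∅

variable {n : ℕ}

/-- The coroot `α^∨ = 2α/⟨α,α⟩`. -/
def coroot (α : V n) : V n := (2 / ⟪α, α⟫) • α

/-- The affine hyperplane `H_{α,k} = {v : ⟨α,v⟩ = k}`. -/
def Hy (α : V n) (k : ℝ) : Set (V n) := {v | ⟪α, v⟫ = k}

/-- The closed half-space `{v : ⟨α,v⟩ ≥ k}`. -/
def Hge (α : V n) (k : ℝ) : Set (V n) := {v | k ≤ ⟪α, v⟫}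

/-- The closed half-space `{v : ⟨α,v⟩ ≤ k}`. -/
def Hle (α : V n) (k : ℝ) : Set (V n) := {v | ⟪α, v⟫ ≤ k}

/-- The affine reflection `s_{α,k}` fixing `H_{α,k}` pointwise. -/
def sRefl (α : V n) (k : ℝ) : V n → V n := fun v => v - (⟪α, v⟫ - k) • coroot α

/-- The coroot lattice `R^∨ = ⊕ᵢ ℤ αᵢ^∨`. -/
def corootLattice (D : RootData n) : Set (V n) :=
  {μ | ∃ c : Fin n → ℤ, μ = ∑ i, (c i : ℝ) • coroot (D.simple i)}

/-- The affine Weyl group `W`, as the group of permutations of `V` generated by all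
affine reflections `s_{α,k}` with `α ∈ Φ`, `k ∈ ℤ`. -/
def AffW (D : RootData n) : Subgroup (Equiv.Perm (V n)) :=
  Subgroup.closure {e : Equiv.Perm (V n) | ∃ α ∈ D.Φ, ∃ k : ℤ, ⇑e = sRefl α (k : ℝ)}

/-- The finite Weyl group `W₀`, generated by the linear reflections `s_{α,0}`. -/
def FinW (D : RootData n) : Subgroup (Equiv.Perm (V n)) :=
  Subgroup.closure {e : Equiv.Perm (V n) | ∃ α ∈ D.Φ, ⇑e = sRefl α 0}

/-- The Coxeter generating set `S = {s₀, s₁, …, sₙ}` of the affine Weyl group. -/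
def SGen (D : RootData n) : Set (AffW D) :=
  {s | ⇑(s : Equiv.Perm (V n)) = sRefl D.highest 1 ∨
       ∃ i : Fin n, ⇑(s : Equiv.Perm (V n)) = sRefl (D.simple i) 0}

/-- The Coxeter length of `y ∈ W` with respect to `S`. -/
def lenW (D : RootData n) (y : AffW D) : ℕ :=
  sInf {m | ∃ l : List (AffW D), (∀ s ∈ l, s ∈ SGen D) ∧ l.length = m ∧ l.prod = y}

/-- The fundamental alcove `𝐚_f`. -/
def fund (D : RootData n) : Set (V n) :=
  {v | (∀ i, 0 ≤ ⟪D.simple i, v⟫) ∧ ⟪D.highest, v⟫ ≤ 1}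

/-- The union of all the hyperplanes `H_{α,k}`. -/
def wallUnion (D : RootData n) : Set (V n) := ⋃ α ∈ D.Φ, ⋃ k : ℤ, Hy α (k : ℝ)

/-- An alcove: the closure of a connected component of the complement of all walls. -/
def IsAlcove (D : RootData n) (c : Set (V n)) : Prop :=
  ∃ v ∈ (wallUnion D)ᶜ, c = closure (connectedComponentIn (wallUnion D)ᶜ v)

/-- A (closed) face of the Coxeter complex: the closure of an equivalence class of points
having the same position relative to every hyperplane of the arrangement. -/
def IsFace (D : RootData n) (F : Set (V n)) : Prop :=
  ∃ v : V n, F = closure {w | ∀ α ∈ D.Φ, ∀ k : ℤ,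
    (⟪α, w⟫ = (k : ℝ) ↔ ⟪α, v⟫ = (k : ℝ)) ∧ (⟪α, w⟫ < (k : ℝ) ↔ ⟪α, v⟫ < (k : ℝ))}

/-- The set of all hyperplanes of the affine arrangement, as subsets of `V`. -/
def hyperplanes (D : RootData n) : Set (Set (V n)) :=
  {H | ∃ α ∈ D.Φ, ∃ k : ℤ, H = Hy α (k : ℝ)}

/-- `p` is a panel (codimension-one face) of the alcove `c`: it is the intersection of `c`
with a wall, and it lies in exactly one hyperplane (its supporting hyperplane). -/
def IsPanelOf (D : RootData n) (p c : Set (V n)) : Prop :=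
  IsAlcove D c ∧ IsFace D p ∧ (∃ H ∈ hyperplanes D, p = c ∩ H) ∧
    ∃! H, H ∈ hyperplanes D ∧ p ⊆ H

/-- The action of an element of the affine Weyl group on subsets of `V`. -/
def actW {D : RootData n} (x : AffW D) (A : Set (V n)) : Set (V n) :=
  ⇑(x : Equiv.Perm (V n)) '' A

/-- The data of a finite combinatorial gallery `(p₀, c₀, p₁, …, p_l, c_l, p_{l+1})`:
`len = l`, alcoves `c 0, …, c len` and faces `p 0, …, p (len+1)`. -/
structure PreGallery (n : ℕ) where
  len : ℕ
  p : ℕ → Set (V n)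
  c : ℕ → Set (V n)

/-- The gallery conditions for the data of a combinatorial gallery. -/
def IsGallery (D : RootData n) (γ : PreGallery n) : Prop :=
  (∀ i ≤ γ.len, IsAlcove D (γ.c i)) ∧
  (IsFace D (γ.p 0) ∧ γ.p 0 ⊆ γ.c 0) ∧
  (IsFace D (γ.p (γ.len + 1)) ∧ γ.p (γ.len + 1) ⊆ γ.c γ.len) ∧
  ∀ i, 1 ≤ i → i ≤ γ.len → IsPanelOf D (γ.p i) (γ.c (i - 1)) ∧ IsPanelOf D (γ.p i) (γ.c i)

/-- A gallery is positively folded with respect to an orientation `φ` if whenever it has a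
fold at `pᵢ` (i.e. `c_{i-1} = c_i`), `φ(cᵢ, pᵢ) = +`. -/
def PositivelyFolded (φ : Set (V n) → Set (V n) → Prop) (γ : PreGallery n) : Prop :=
  ∀ i, 1 ≤ i → i ≤ γ.len → γ.c (i - 1) = γ.c i → φ (γ.c i) (γ.p i)

/-- `X` and `Y` lie in a common closed half-space bounded by `H_{α,k}`. -/
def sameSide (α : V n) (k : ℝ) (X Y : Set (V n)) : Prop :=
  (X ⊆ Hge α k ∧ Y ⊆ Hge α k) ∨ (X ⊆ Hle α k ∧ Y ⊆ Hle α k)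

/-- The hyperplane `H_{α,k}` separates `X` from `Y` (they lie in opposite closed
half-spaces). -/
def Separates (α : V n) (k : ℝ) (X Y : Set (V n)) : Prop :=
  (X ⊆ Hge α k ∧ Y ⊆ Hle α k) ∨ (X ⊆ Hle α k ∧ Y ⊆ Hge α k)

/-- The orientation induced by an alcove `A`: `φ(c,p) = +` iff the closed half-space bounded
by the supporting hyperplane of `p` which contains `c` does not contain `A`. -/
def alcoveOrient (D : RootData n) (A : Set (V n)) : Set (V n) → Set (V n) → Prop :=
  fun c p => ∀ α ∈ D.Φ, ∀ k : ℤ, p ⊆ Hy α (k : ℝ) → ¬ sameSide α (k : ℝ) c A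

/-- Two faces have the same type iff they lie in the same orbit of the affine Weyl group. -/
def SameTypeFace (D : RootData n) (σ σ' : Set (V n)) : Prop :=
  ∃ x : Equiv.Perm (V n), x ∈ AffW D ∧ σ' = ⇑x '' σ

/-- Two galleries have the same type iff they have the same length and corresponding
faces (first face, panels, last face) have the same types. -/
def SameTypeGallery (D : RootData n) (γ γ' : PreGallery n) : Prop :=
  γ.len = γ'.len ∧ ∀ i ≤ γ.len + 1, SameTypeFace D (γ.p i) (γ'.p i)

/-- A gallery is minimal if it has minimal length among all galleries with the same first
and last faces. -/
def IsMinimal (D : RootData n) (γ : PreGallery n) : Prop :=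
  IsGallery D γ ∧ ∀ γ' : PreGallery n, IsGallery D γ' → γ'.p 0 = γ.p 0 →
    γ'.p (γ'.len + 1) = γ.p (γ.len + 1) → γ.len ≤ γ'.len

/-- The shadow with respect to the orientation `φ`, relative to a fixed (minimal) gallery
`γ`: the set of final simplices of all galleries of the same type as `γ`, with the same
first face, which are positively folded with respect to `φ`. -/
def Shadow (D : RootData n) (φ : Set (V n) → Set (V n) → Prop) (γ : PreGallery n) :
    Set (Set (V n)) :=
  {ζ | ∃ γ' : PreGallery n, IsGallery D γ' ∧ SameTypeGallery D γ γ' ∧ γ'.p 0 = γ.p 0 ∧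
    PositivelyFolded φ γ' ∧ ζ = γ'.p (γ'.len + 1)}

/-- The vertex version of the shadow: the set of points `μ` whose corresponding vertex
(the singleton face `{μ}`) is a final simplex of a positively folded gallery of the
appropriate type. -/
def VShadow (D : RootData n) (φ : Set (V n) → Set (V n) → Prop) (γ : PreGallery n) :
    Set (V n) :=
  {μ | ({μ} : Set (V n)) ∈ Shadow D φ γ}

/-- The orbit `W₀ · λ` of a point under the finite Weyl group. -/
def W0orbit (D : RootData n) (lam : V n) : Set (V n) :=
  {v | ∃ w ∈ FinW D, v = w lam}

/-- The closed half-space bounded by `H_{α,k}` which contains the fundamental alcove. -/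
def HalfId (D : RootData n) (α : V n) (k : ℝ) : Set (V n) :=
  if fund D ⊆ Hge α k then Hge α k else Hle α k

/-- `[j,m]` is a (finite) `H_{α,k}`-protrusion of `γ`. -/
def IsProtrusionFin (D : RootData n) (γ : PreGallery n) (α : V n) (k : ℝ) (j m : ℕ) : Prop :=
  j < m ∧ m ≤ γ.len + 1 ∧ γ.p j ⊆ Hy α k ∧ γ.p m ⊆ Hy α k ∧
    ∀ i, j ≤ i → i < m → ¬ γ.c i ⊆ HalfId D α k

/-- `[j,∞)` is an (infinite) `H_{α,k}`-protrusion of `γ`. -/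
def IsProtrusionInf (D : RootData n) (γ : PreGallery n) (α : V n) (k : ℝ) (j : ℕ) : Prop :=
  j ≤ γ.len + 1 ∧ γ.p j ⊆ Hy α k ∧ ∀ i, j ≤ i → i ≤ γ.len → ¬ γ.c i ⊆ HalfId D α k

/-- The set of indices reflected by the maximal `H`-outcrop: the union of (the index sets
of) all `H`-protrusions. -/
def maxOutcrop (D : RootData n) (γ : PreGallery n) (α : V n) (k : ℝ) : Set ℕ :=
  {i | (∃ j m, IsProtrusionFin D γ α k j m ∧ j ≤ i ∧ i < m) ∨
       (∃ j, IsProtrusionInf D γ α k j ∧ j ≤ i)}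

/-- `[j,m]` is a (finite) `H_{α,k}`-indentation of `γ`. -/
def IsIndentationFin (D : RootData n) (γ : PreGallery n) (α : V n) (k : ℝ) (j m : ℕ) : Prop :=
  1 ≤ j ∧ j < m ∧ m ≤ γ.len + 1 ∧ γ.p j ⊆ Hy α k ∧ γ.p m ⊆ Hy α k ∧
    ∀ i, j ≤ i → i < m → γ.c i ⊆ HalfId D α k

/-- `[j,∞)` is an (infinite) `H_{α,k}`-indentation of `γ`. -/
def IsIndentationInf (D : RootData n) (γ : PreGallery n) (α : V n) (k : ℝ) (j : ℕ) : Prop :=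
  1 ≤ j ∧ j ≤ γ.len + 1 ∧ γ.p j ⊆ Hy α k ∧ ∀ i, j ≤ i → i ≤ γ.len → γ.c i ⊆ HalfId D α k

/-- The set of indices reflected by the maximal `H`-ingrowth: the union of (the index sets
of) all `H`-indentations. -/
def maxIngrowth (D : RootData n) (γ : PreGallery n) (α : V n) (k : ℝ) : Set ℕ :=
  {i | (∃ j m, IsIndentationFin D γ α k j m ∧ j ≤ i ∧ i < m) ∨
       (∃ j, IsIndentationInf D γ α k j ∧ j ≤ i)}

/-- The operators `e_H^L` and `f_H^L`: reflect in `H_{α,k}` those alcoves (and the faces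
in between) whose indices belong to `L`.  (Since the bounding faces of a protrusion or
indentation lie in `H`, they are fixed pointwise by the reflection, so this uniform
description agrees with the usual one.) -/
def flipGallery (α : V n) (k : ℝ) (L : Set ℕ) (γ : PreGallery n) : PreGallery n :=
  ⟨γ.len,
   fun i => if i ∈ L then sRefl α k '' γ.p i else γ.p i,
   fun i => if i ∈ L then sRefl α k '' γ.c i else γ.c i⟩

/-- `P` is the index set of a single `H`-protrusion. -/
def IsFlipProtrusion (D : RootData n) (γ : PreGallery n) (α : V n) (k : ℝ) (P : Set ℕ) :
    Prop :=
  (∃ j m, IsProtrusionFin D γ α k j m ∧ P = Set.Ico j m) ∨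
  (∃ j, IsProtrusionInf D γ α k j ∧ P = Set.Ici j)

/-- `P` is the index set of a single `H`-indentation. -/
def IsFlipIndentation (D : RootData n) (γ : PreGallery n) (α : V n) (k : ℝ) (P : Set ℕ) :
    Prop :=
  (∃ j m, IsIndentationFin D γ α k j m ∧ P = Set.Ico j m) ∨
  (∃ j, IsIndentationInf D γ α k j ∧ P = Set.Ici j)

/-- `L` is an `H`-outcrop: a disjoint union of `H`-protrusions. -/
def IsOutcrop (D : RootData n) (γ : PreGallery n) (α : V n) (k : ℝ) (L : Set ℕ) : Prop :=
  ∃ C : Set (Set ℕ), (∀ P ∈ C, IsFlipProtrusion D γ α k P) ∧ C.Pairwise Disjoint ∧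
    L = ⋃₀ C

/-- `L` is an `H`-ingrowth: a disjoint union of `H`-indentations. -/
def IsIngrowth (D : RootData n) (γ : PreGallery n) (α : V n) (k : ℝ) (L : Set ℕ) : Prop :=
  ∃ C : Set (Set ℕ), (∀ P ∈ C, IsFlipIndentation D γ α k P) ∧ C.Pairwise Disjoint ∧
    L = ⋃₀ C

/-- The dominant Weyl chamber `C_f`. -/
def Cf (D : RootData n) : Set (V n) := {v | ∀ α ∈ D.pos, 0 ≤ ⟪α, v⟫}

/-- The closed half-space `α^{k,w}` bounded by `H_{α,k}` which contains a subsector of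
the Weyl chamber `w·C_f`. -/
def halfFor (D : RootData n) (α : V n) (k : ℝ) (w : Equiv.Perm (V n)) : Set (V n) :=
  if ∀ v ∈ Cf D, 0 ≤ ⟪α, w v⟫ then Hge α k else Hle α k

/-- The sub-root system `Φ_J` spanned by the simple roots indexed by `J`. -/
def PhiJ (D : RootData n) (J : Set (Fin n)) : Set (V n) :=
  {α | α ∈ D.Φ ∧ α ∈ Submodule.span ℝ (D.simple '' J)}

/-- The positive roots `Φ_J⁺` of the sub-root system `Φ_J`. -/
def PhiJpos (D : RootData n) (J : Set (Fin n)) : Set (V n) := D.pos ∩ PhiJ D J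

/-- `w0` is the longest element of the finite Weyl group: it maps the dominant Weyl chamber
to the antidominant one. -/
def IsLongest (D : RootData n) (w0 : Equiv.Perm (V n)) : Prop :=
  w0 ∈ FinW D ∧ ⇑w0 '' Cf D = {v | -v ∈ Cf D}

/-- The `J`-chimney `ξ_J`, a collection of closed half-spaces. -/
def chimney (D : RootData n) (J : Set (Fin n)) (w0 : Equiv.Perm (V n)) : Set (Set (V n)) :=
  {h | ∃ α ∈ PhiJpos D J, ∃ k : ℤ, k ≤ 0 ∧ h = halfFor D α (k : ℝ) 1} ∪
  {h | ∃ α ∈ PhiJpos D J, ∃ k : ℤ, 1 ≤ k ∧ h = halfFor D α (k : ℝ) w0} ∪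
  {h | ∃ β ∈ D.pos \ PhiJpos D J, ∃ k : ℤ, h = halfFor D β (k : ℝ) w0}

/-- The `(J,y)`-chimney `ξ_{J,y} = y · ξ_J`. -/
def chimneyY (D : RootData n) (J : Set (Fin n)) (w0 : Equiv.Perm (V n)) (y : AffW D) :
    Set (Set (V n)) :=
  {h | ∃ h' ∈ chimney D J w0, h = actW y h'}

/-- The orientation `φ_{J,y}` induced by the `(J,y)`-chimney: `φ(c,p) = +` iff the closed
half-space bounded by the supporting hyperplane of `p` which contains `c` is not an
element of `ξ_{J,y}`. -/
def chimneyOrient (D : RootData n) (J : Set (Fin n)) (w0 : Equiv.Perm (V n)) (y : AffW D) :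
    Set (V n) → Set (V n) → Prop :=
  fun c p => ∀ α ∈ D.Φ, ∀ k : ℤ, p ⊆ Hy α (k : ℝ) →
    ¬ ((c ⊆ Hge α (k : ℝ) ∧ Hge α (k : ℝ) ∈ chimneyY D J w0 y) ∨
       (c ⊆ Hle α (k : ℝ) ∧ Hle α (k : ℝ) ∈ chimneyY D J w0 y))

/-- The `J`-sector determined by integers `n_β`, `β ∈ Φ⁺ ∖ Φ_J⁺`. -/
def sectorJ (D : RootData n) (J : Set (Fin n)) (w0 : Equiv.Perm (V n)) (nb : V n → ℤ) :
    Set (V n) :=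
  (⋂ α ∈ PhiJpos D J, halfFor D α 0 1 ∩ halfFor D α 1 w0) ∩
  ⋂ β ∈ D.pos \ PhiJpos D J, halfFor D β (nb β : ℝ) w0

/-- The `(J,y)`-sector `y · S_J({n_β})`. -/
def sectorJY (D : RootData n) (J : Set (Fin n)) (w0 : Equiv.Perm (V n)) (y : AffW D)
    (nb : V n → ℤ) : Set (V n) :=
  actW y (sectorJ D J w0 nb)

/-- The data of an infinite combinatorial gallery `(p₀, c₀, p₁, c₁, …)`. -/
structure InfPreGallery (n : ℕ) where
  p : ℕ → Set (V n)
  c : ℕ → Set (V n)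

/-- The gallery conditions for an infinite combinatorial gallery. -/
def IsInfGallery (D : RootData n) (Γ : InfPreGallery n) : Prop :=
  (∀ i, IsAlcove D (Γ.c i)) ∧ IsFace D (Γ.p 0) ∧ Γ.p 0 ⊆ Γ.c 0 ∧
    ∀ i, 1 ≤ i → IsPanelOf D (Γ.p i) (Γ.c (i - 1)) ∧ IsPanelOf D (Γ.p i) (Γ.c i)

/-- The initial finite subgallery `(p₀, c₀, …, p_{m+1})` of an infinite gallery. -/
def truncGallery (Γ : InfPreGallery n) (m : ℕ) : PreGallery n := ⟨m, Γ.p, Γ.c⟩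

/-- An infinite gallery is minimal if every initial finite subgallery is minimal. -/
def InfMinimal (D : RootData n) (Γ : InfPreGallery n) : Prop :=
  ∀ m : ℕ, IsMinimal D (truncGallery Γ m)

/-- Regularity of a (minimal infinite) gallery with respect to the `(J,y)`-sector, where
`y = t^μ u`. -/
def RegularWrt (D : RootData n) (J : Set (Fin n)) (w0 u : Equiv.Perm (V n)) (μ : V n)
    (nb : V n → ℤ) (Γ : InfPreGallery n) : Prop :=
  ∀ β ∈ D.pos \ PhiJpos D J, ∀ k : ℤ,
    halfFor D (u β) (k : ℝ) (u * w0) ⊆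
      halfFor D (u β) ((nb β : ℝ) + ⟪u β, μ⟫) (u * w0) →
    ∃ i, Γ.c i ⊆ halfFor D (u β) (k : ℝ) (u * w0)

/-- The panel of the fundamental alcove fixed by the generator `s ∈ S` (determining the
type of a panel). -/
def fixedPanelType {D : RootData n} (s : AffW D) : Set (V n) :=
  fund D ∩ {v | (s : Equiv.Perm (V n)) v = v}

/-- `γ` has type `(type(σ0), s_{j₁}, …, s_{j_l}, type(τ))` where the `s_{jᵢ}` are the
entries of the word `l`. -/
def HasWordType (D : RootData n) (γ : PreGallery n) (σ0 : Set (V n)) (l : List (AffW D))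
    (τ : Set (V n)) : Prop :=
  γ.len = l.length ∧ SameTypeFace D σ0 (γ.p 0) ∧ SameTypeFace D τ (γ.p (γ.len + 1)) ∧
    ∀ i, ∀ h : i < l.length, SameTypeFace D (fixedPanelType (l.get ⟨i, h⟩)) (γ.p (i + 1))

/-- `l` is a reduced word for `w ∈ W`. -/
def IsReducedWord (D : RootData n) (l : List (AffW D)) (w : AffW D) : Prop :=
  (∀ s ∈ l, s ∈ SGen D) ∧ l.prod = w ∧ l.length = lenW D w

end

open scoped RealInnerProductSpace
open scoped Classical

namespace Chim

variable {n : ℕ}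

/-- affine roots, as functions -/
def IsRt (D : RootData n) (f : V n → ℝ) : Prop :=
  ∃ α ∈ D.Φ, ∃ k : ℤ, f = fun v => ⟪α, v⟫ - (k : ℝ)

/-- `r` is the reflection attached to the affine root `a` -/
def IsRefl (D : RootData n) (a : V n → ℝ) (r : V n → V n) : Prop :=
  ∃ α ∈ D.Φ, ∃ k : ℤ, (a = fun v => ⟪α, v⟫ - (k : ℝ)) ∧ r = fun v => v - a v • coroot α

/-- simple affine roots -/
def IsSim (D : RootData n) (a : V n → ℝ) : Prop :=
  (∃ i, a = fun v => ⟪D.simple i, v⟫) ∨ a = fun v => 1 - ⟪D.highest, v⟫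

theorem aff_ext {α β : V n} {k m : ℝ} (h : (fun v => ⟪α, v⟫ - k) = fun v => ⟪β, v⟫ - m) :
    α = β ∧ k = m := by
  have h0 := congrFun h 0
  simp at h0
  refine ⟨?_, h0⟩
  apply ext_inner_right ℝ
  intro v
  have := congrFun h v
  simp only [h0] at this
  linarith

theorem IsRt.neg {D : RootData n} {f : V n → ℝ} (h : IsRt D f) : IsRt D (-f) := by
  obtain ⟨α, hα, k, rfl⟩ := h
  refine ⟨-α, D.neg_mem α hα, -k, ?_⟩
  ext v
  simp [inner_neg_left]
  ring

theorem IsRefl.isRt {D : RootData n} {a : V n → ℝ} {r} (h : IsRefl D a r) : IsRt D a := by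
  obtain ⟨α, hα, k, h1, h2⟩ := h
  exact ⟨α, hα, k, h1⟩

theorem IsRt.exists_refl {D : RootData n} {a : V n → ℝ} (h : IsRt D a) : ∃ r, IsRefl D a r := by
  obtain ⟨α, hα, k, h1⟩ := h
  exact ⟨_, α, hα, k, h1, rfl⟩

theorem coroot_neg (α : V n) : coroot (-α) = - coroot α := by
  simp [coroot]

theorem IsRefl.neg {D : RootData n} {a : V n → ℝ} {r} (h : IsRefl D a r) : IsRefl D (-a) r := by
  obtain ⟨α, hα, k, h1, h2⟩ := h
  refine ⟨-α, D.neg_mem α hα, -k, ?_, ?_⟩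
  · subst h1
    ext v
    simp [inner_neg_left]
    ring
  · subst h2
    ext v
    simp [coroot_neg]

theorem IsRefl.unique {D : RootData n} {a : V n → ℝ} {r r'} (h : IsRefl D a r)
    (h' : IsRefl D a r') : r = r' := by
  obtain ⟨α, hα, k, h1, h2⟩ := h
  obtain ⟨β, hβ, m, h3, h4⟩ := h'
  have := (aff_ext (h1.symm.trans h3)).1
  subst this
  rw [h2, h4]

theorem inner_coroot_self {D : RootData n} {α : V n} (hα : α ∈ D.Φ) : ⟪α, coroot α⟫ = 2 := by
  have : ⟪α, α⟫ ≠ 0 := by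
    simpa using D.nonzero α hα
  rw [coroot, inner_smul_right]
  field_simp

theorem coroot_ne {D : RootData n} {α : V n} (hα : α ∈ D.Φ) : coroot α ≠ 0 := by
  intro h
  have := inner_coroot_self hα
  rw [h] at this
  simp at this

theorem IsRefl.apply_root {D : RootData n} {a : V n → ℝ} {r} (h : IsRefl D a r) (v : V n) :
    a (r v) = - a v := by
  obtain ⟨α, hα, k, rfl, rfl⟩ := h
  simp only [inner_sub_right, inner_smul_right, inner_coroot_self hα]
  ring

theorem IsRefl.fix {D : RootData n} {a : V n → ℝ} {r} (h : IsRefl D a r) (v : V n) :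
    r v = v ↔ a v = 0 := by
  obtain ⟨α, hα, k, h1, rfl⟩ := h
  simp [coroot_ne hα]

theorem IsRefl.invol {D : RootData n} {a : V n → ℝ} {r} (h : IsRefl D a r) (v : V n) :
    r (r v) = v := by
  have h2 := h.apply_root v
  obtain ⟨α, hα, k, h1, h3⟩ := h
  have : ∀ u, r u = u - a u • coroot α := fun u => by rw [h3]
  rw [this (r v), h2, this v]
  simp

/-- transformation property -/
def Tr (D : RootData n) (g : V n → V n) : Prop :=
  Continuous g ∧ ∀ α ∈ D.Φ, ∀ k : ℤ, ∃ β ∈ D.Φ, ∃ m : ℤ, (∀ v, ⟪α, g v⟫ - (k : ℝ) = ⟪β, v⟫ - (m : ℝ)) ∧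
    ∀ v (t : ℝ), g (v + t • coroot β) = g v + t • coroot α

theorem Tr.comp {D : RootData n} {g h : V n → V n} (hg : Tr D g) (hh : Tr D h) :
    Tr D (g ∘ h) := by
  refine ⟨hg.1.comp hh.1, ?_⟩
  intro α hα k
  obtain ⟨β, hβ, m, h1, h2⟩ := hg.2 α hα k
  obtain ⟨γ, hγ, l, h3, h4⟩ := hh.2 β hβ m
  refine ⟨γ, hγ, l, ?_, ?_⟩
  · intro v
    simp [h1, h3]
  · intro v t
    simp [h4, h2]

theorem Tr.sRefl {D : RootData n} {δ : V n} (hδ : δ ∈ D.Φ) (j : ℤ) :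
    Tr D (sRefl δ (j : ℝ)) := by
  have hne : ⟪δ, δ⟫ ≠ 0 := by simpa using D.nonzero δ hδ
  refine ⟨?_, ?_⟩
  · unfold _root_.sRefl
    fun_prop
  intro α hα k
  obtain ⟨c, hc⟩ := D.crystallographic δ hδ α hα
  have hm := D.reflect_mem δ hδ α hα
  have hc' : 2 * ⟪α, δ⟫ = c * ⟪δ, δ⟫ := by
    rw [← hc, real_inner_comm]
    field_simp
  rw [hc] at hm
  have hdc : ⟪α, coroot δ⟫ = c := by
    rw [coroot, inner_smul_right]
    field_simp
    linarith
  refine ⟨_, hm, k - j * c, ?_, ?_⟩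
  · intro v
    simp only [_root_.sRefl, inner_sub_right, inner_smul_right, hdc, inner_sub_left, inner_smul_left]
    simp
    ring
  · intro v t
    have hnorm : ⟪α - (c : ℝ) • δ, α - (c : ℝ) • δ⟫ = ⟪α, α⟫ := by
      simp only [inner_sub_right, inner_smul_right, inner_sub_left, inner_smul_left]
      simp only [real_inner_comm α δ, conj_trivial]
      linear_combination (-(c : ℝ)) * hc'
    have hco : coroot (α - (c : ℝ) • δ) = (2 / ⟪α, α⟫) • α - (c * (2 / ⟪α, α⟫)) • δ := by
      rw [coroot, hnorm, smul_sub, smul_smul, mul_comm]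
    have h2 : coroot α = (2 / ⟪α, α⟫) • α := rfl
    simp only [_root_.sRefl, hco, inner_add_right, inner_sub_right, inner_smul_right, h2]
    have h3 : coroot δ = (2 / ⟪δ, δ⟫) • δ := rfl
    rw [real_inner_comm α δ] at *
    have e : ⟪δ, α⟫ = c * ⟪δ, δ⟫ / 2 := by rw [real_inner_comm] at hc'; linarith
    set A := 2 / ⟪α, α⟫
    rw [h3]
    simp only [smul_smul, smul_sub]
    have : ((⟪δ, v⟫ + t * (A * ⟪δ, α⟫ - c * A * ⟪δ, δ⟫) - j) * (2 / ⟪δ, δ⟫)) 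
      = (⟪δ, v⟫ - j) * (2 / ⟪δ, δ⟫) - t * (c * A) := by
      rw [e]
      field_simp
      ring
    rw [real_inner_comm δ α] at *
    rw [this]
    module

theorem sRefl_isRefl {D : RootData n} {δ : V n} (hδ : δ ∈ D.Φ) (j : ℤ) :
    IsRefl D (fun v => ⟪δ, v⟫ - (j : ℝ)) (sRefl δ (j : ℝ)) :=
  ⟨δ, hδ, j, rfl, rfl⟩

theorem Tr.mem {D : RootData n} {g : Equiv.Perm (V n)} (hg : g ∈ AffW D) :
    Tr D g ∧ Tr D (g⁻¹ : Equiv.Perm (V n)) := by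
  unfold AffW at hg
  induction hg using Subgroup.closure_induction with
  | mem x hx =>
    obtain ⟨α, hα, k, hk⟩ := hx
    have h1 : Tr D x := by rw [hk]; exact Tr.sRefl hα k
    have h2 : x⁻¹ = x := by
      rw [inv_eq_iff_mul_eq_one]
      ext1 v
      rw [Equiv.Perm.mul_apply, hk]
      exact (sRefl_isRefl hα k).invol v
    rw [h2]
    exact ⟨h1, h1⟩
  | one =>
    have : Tr D (1 : Equiv.Perm (V n)) := ⟨continuous_id, fun α hα k => ⟨α, hα, k, by simp, by simp⟩⟩
    exact ⟨this, by simpa using this⟩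
  | mul x y _ _ hx hy =>
    refine ⟨hx.1.comp hy.1, ?_⟩
    rw [mul_inv_rev]
    exact hy.2.comp hx.2
  | inv x _ hx => exact ⟨hx.2, by simpa using hx.1⟩

/-- apply an element of W -/
def ap {D : RootData n} (g : AffW D) (v : V n) : V n := (g : Equiv.Perm (V n)) v

variable {D : RootData n}

@[simp] theorem ap_mul (g h : AffW D) (v : V n) : ap (g * h) v = ap g (ap h v) := rfl
@[simp] theorem ap_one (v : V n) : ap (1 : AffW D) v = v := rfl
@[simp] theorem ap_inv_ap (g : AffW D) (v : V n) : ap g⁻¹ (ap g v) = v := by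
  rw [← ap_mul]; simp
@[simp] theorem ap_ap_inv (g : AffW D) (v : V n) : ap g (ap g⁻¹ v) = v := by
  rw [← ap_mul]; simp

theorem ap_ext {g h : AffW D} (H : ∀ v, ap g v = ap h v) : g = h :=
  Subtype.ext (Equiv.ext H)

theorem ap_tr (g : AffW D) : Tr D (ap g) := (Tr.mem g.2).1

theorem ap_cont (g : AffW D) : Continuous (ap g) := (ap_tr g).1

theorem actW_eq (g : AffW D) (A : Set (V n)) : actW g A = ap g '' A := rfl

theorem mem_actW (g : AffW D) (A : Set (V n)) (v : V n) : v ∈ actW g A ↔ ap g⁻¹ v ∈ A := by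
  rw [actW_eq]
  constructor
  · rintro ⟨u, hu, rfl⟩
    simpa
  · intro h
    exact ⟨_, h, by simp⟩

theorem IsRt.comp {f : V n → ℝ} (hf : IsRt D f) (g : AffW D) : IsRt D (fun v => f (ap g v)) := by
  obtain ⟨α, hα, k, rfl⟩ := hf
  obtain ⟨β, hβ, m, h, -⟩ := (ap_tr g).2 α hα k
  exact ⟨β, hβ, m, funext h⟩

theorem IsRefl.comp {a : V n → ℝ} {r} (hf : IsRefl D a r) (g : AffW D) :
    IsRefl D (fun v => a (ap g v)) (fun v => ap g⁻¹ (r (ap g v))) := by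
  obtain ⟨α, hα, k, rfl, rfl⟩ := hf
  obtain ⟨β, hβ, m, h, h2⟩ := (ap_tr g).2 α hα k
  refine ⟨β, hβ, m, funext h, ?_⟩
  ext1 v
  have := h2 v (-(⟪α, ap g v⟫ - (k : ℝ)))
  simp only [neg_smul, ← sub_eq_add_neg] at this
  simp only
  rw [← this]
  simp

theorem IsRt.continuous {f : V n → ℝ} (hf : IsRt D f) : Continuous f := by
  obtain ⟨α, hα, k, rfl⟩ := hf
  fun_prop

theorem IsRt.affine {f : V n → ℝ} (hf : IsRt D f) (x y : V n) (t : ℝ) :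
    f ((1 - t) • x + t • y) = (1 - t) * f x + t * f y := by
  obtain ⟨α, hα, k, rfl⟩ := hf
  simp only [inner_add_right, inner_smul_right]
  ring

/-- W element for a root -/
theorem IsRt.exists_W {f : V n → ℝ} (hf : IsRt D f) : ∃ g : AffW D, IsRefl D f (ap g) := by
  obtain ⟨α, hα, k, rfl⟩ := hf
  have hr := sRefl_isRefl hα k
  let e : Equiv.Perm (V n) := ⟨sRefl α k, sRefl α k, hr.invol, hr.invol⟩
  refine ⟨⟨e, Subgroup.subset_closure ⟨α, hα, k, rfl⟩⟩, ?_⟩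
  exact hr

end Chim

open scoped RealInnerProductSpace
open scoped Classical

namespace Chim

variable {n : ℕ} {D : RootData n}

theorem exists_inner (D : RootData n) (c : Fin n → ℝ) : ∃ v : V n, ∀ i, ⟪D.simple i, v⟫ = c i := by
  let F : V n →ₗ[ℝ] (Fin n → ℝ) := LinearMap.pi fun i => (innerₗ (V n) (D.simple i))
  have hF : ∀ v i, F v i = ⟪D.simple i, v⟫ := fun v i => rfl
  have hinj : Function.Injective F := by
    rw [injective_iff_map_eq_zero]
    intro v hv
    have hsp : Submodule.span ℝ (Set.range D.simple) = ⊤ :=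
      D.simple_indep.span_eq_top_of_card_eq_finrank' (by simp)
    have h1 : ∀ u ∈ Submodule.span ℝ (Set.range D.simple), ⟪u, v⟫ = 0 := by
      intro u hu
      induction hu using Submodule.span_induction with
      | mem x hx =>
        obtain ⟨i, rfl⟩ := hx
        rw [← hF, hv]; rfl
      | zero => simp
      | add x y _ _ hx hy => rw [inner_add_left, hx, hy, add_zero]
      | smul a x _ hx => rw [inner_smul_left, hx, mul_zero]
    have := h1 v (by rw [hsp]; trivial)
    simpa using this
  have hsurj : Function.Surjective F :=
    (LinearMap.injective_iff_surjective_of_finrank_eq_finrank (by simp)).1 hinj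
  obtain ⟨v, hv⟩ := hsurj c
  exact ⟨v, fun i => by rw [← hF, hv]⟩

theorem inner_combo (c : Fin n → ℝ) (v : V n) :
    ⟪∑ i, c i • D.simple i, v⟫ = ∑ i, c i * ⟪D.simple i, v⟫ := by
  rw [sum_inner]
  simp [inner_smul_left]

theorem pos_nonneg {β : V n} (hβ : β ∈ D.pos) {v : V n} (hv : ∀ i, 0 ≤ ⟪D.simple i, v⟫) :
    0 ≤ ⟪β, v⟫ := by
  obtain ⟨c, hc, rfl⟩ := D.pos_combo β hβ
  rw [inner_combo]
  exact Finset.sum_nonneg fun i _ => mul_nonneg (hc i) (hv i)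

theorem pos_le {β : V n} (hβ : β ∈ D.pos) {v : V n} (hv : ∀ i, 0 ≤ ⟪D.simple i, v⟫) :
    ⟪β, v⟫ ≤ ⟪D.highest, v⟫ := by
  obtain ⟨c, hc, h⟩ := D.highest_dominates β hβ
  have : 0 ≤ ⟪D.highest - β, v⟫ := by
    rw [h, inner_combo]
    exact Finset.sum_nonneg fun i _ => mul_nonneg (hc i) (hv i)
  rw [inner_sub_left] at this
  linarith

theorem combo_zero {c : Fin n → ℝ} (hc : ∀ i, 0 ≤ c i) {v : V n} (hv : ∀ i, 0 ≤ ⟪D.simple i, v⟫)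
    (h : ⟪∑ i, c i • D.simple i, v⟫ = 0) (i : Fin n) (hi : 0 < ⟪D.simple i, v⟫) : c i = 0 := by
  rw [inner_combo, Finset.sum_eq_zero_iff_of_nonneg (fun i _ => mul_nonneg (hc i) (hv i))] at h
  have := h i (Finset.mem_univ i)
  rcases mul_eq_zero.1 this with h | h
  · exact h
  · exact absurd h hi.ne'

theorem pos_strict {β : V n} (hβ : β ∈ D.pos) {v : V n} (hv : ∀ i, 0 < ⟪D.simple i, v⟫) :
    0 < ⟪β, v⟫ := by
  refine lt_of_le_of_ne (pos_nonneg hβ fun i => (hv i).le) fun h => ?_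
  obtain ⟨c, hc, rfl⟩ := D.pos_combo β hβ
  have := combo_zero hc (fun i => (hv i).le) h.symm
  refine D.nonzero _ (D.pos_sub hβ) ?_
  exact Finset.sum_eq_zero fun i _ => by rw [this i (hv i), zero_smul]

theorem mem_fund {v : V n} : v ∈ fund D ↔ ∀ a, IsSim D a → 0 ≤ a v := by
  constructor
  · rintro ⟨h1, h2⟩ a (⟨i, rfl⟩ | rfl)
    · exact h1 i
    · simpa using h2
  · intro h
    refine ⟨fun i => h _ (Or.inl ⟨i, rfl⟩), ?_⟩
    simpa using h _ (Or.inr rfl)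

theorem IsSim.isRt {a : V n → ℝ} (h : IsSim D a) : IsRt D a := by
  rcases h with ⟨i, rfl⟩ | rfl
  · exact ⟨_, D.pos_sub (D.simple_mem i), 0, by simp⟩
  · refine ⟨_, D.neg_mem _ (D.pos_sub D.highest_mem), -1, ?_⟩
    ext v
    simp
    ring

/-- every affine root is, up to sign, of the form `⟪β, ·⟫ - k` with `β` positive -/
theorem IsRt.pos_form {f : V n → ℝ} (hf : IsRt D f) : ∃ β ∈ D.pos, ∃ k : ℤ,
    (f = fun v => ⟪β, v⟫ - (k : ℝ)) ∨ (f = fun v => -(⟪β, v⟫ - (k : ℝ))) := by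
  obtain ⟨α, hα, k, rfl⟩ := hf
  rcases D.pos_total α hα with h | h
  · exact ⟨α, h, k, Or.inl rfl⟩
  · refine ⟨-α, h, -k, Or.inr ?_⟩
    ext v
    simp
    ring

theorem fund_sign {f : V n → ℝ} (hf : IsRt D f) :
    (∀ v ∈ fund D, 0 ≤ f v) ∨ (∀ v ∈ fund D, f v ≤ 0) := by
  obtain ⟨β, hβ, k, h⟩ := hf.pos_form
  have key : (∀ v ∈ fund D, 0 ≤ ⟪β, v⟫ - (k : ℝ)) ∨ (∀ v ∈ fund D, ⟪β, v⟫ - (k : ℝ) ≤ 0) := by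
    rcases le_or_gt k 0 with hk | hk
    · left
      intro v hv
      have := pos_nonneg hβ hv.1
      have hk' : (k : ℝ) ≤ 0 := by exact_mod_cast hk
      linarith
    · right
      intro v hv
      have := pos_le hβ hv.1
      have h2 := hv.2
      have hk' : (1 : ℝ) ≤ k := by exact_mod_cast hk
      linarith
  rcases h with rfl | rfl
  · exact key
  · rcases key with h | h
    · right; intro v hv; have := h v hv; linarith
    · left; intro v hv; have := h v hv; linarith

theorem fund_zero {f : V n → ℝ} (hf : IsRt D f) {v : V n} (hv : v ∈ fund D) (h0 : f v = 0) :
    ∃ a, IsSim D a ∧ a v = 0 := by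
  obtain ⟨β, hβ, k, h⟩ := hf.pos_form
  have h1 : ⟪β, v⟫ - (k : ℝ) = 0 := by
    rcases h with rfl | rfl
    · exact h0
    · exact neg_eq_zero.1 h0
  by_contra! hcon
  have hs : ∀ i, 0 < ⟪D.simple i, v⟫ := fun i =>
    lt_of_le_of_ne (hv.1 i) (Ne.symm (hcon _ (Or.inl ⟨i, rfl⟩)))
  have hh : ⟪D.highest, v⟫ < 1 := by
    refine lt_of_le_of_ne hv.2 fun h => hcon _ (Or.inr rfl) ?_
    simp [h]
  have a1 := pos_strict hβ hs
  have a2 := pos_le hβ hv.1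
  have a3 : (0 : ℝ) < k := by linarith
  have a4 : (k : ℝ) < 1 := by linarith
  have a5 : 0 < k := by exact_mod_cast a3
  have a6 : k < 1 := by exact_mod_cast a4
  omega

theorem exists_v0 (D : RootData n) : ∃ v : V n, ∀ a, IsSim D a → 0 < a v := by
  obtain ⟨v, hv⟩ := exists_inner D fun _ => 1
  have hv' : ∀ i, 0 < ⟪D.simple i, v⟫ := fun i => by rw [hv]; norm_num
  have hH := pos_strict D.highest_mem hv'
  refine ⟨(1 / (⟪D.highest, v⟫ + 1)) • v, ?_⟩
  rintro a (⟨i, rfl⟩ | rfl)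
  · simp only [inner_smul_right]
    have := hv' i
    positivity
  · simp only [inner_smul_right, sub_pos]
    rw [one_div, inv_mul_lt_iff₀ (by linarith)]
    linarith

/-- base point in the fundamental alcove -/
noncomputable def v0 (D : RootData n) : V n := (exists_v0 D).choose

theorem v0_pos {a : V n → ℝ} (ha : IsSim D a) : 0 < a (v0 D) := (exists_v0 D).choose_spec a ha

theorem v0_mem : v0 D ∈ fund D := mem_fund.2 fun _ ha => (v0_pos ha).le

theorem v0_ne {f : V n → ℝ} (hf : IsRt D f) : f (v0 D) ≠ 0 := fun h => by
  obtain ⟨a, ha, h0⟩ := fund_zero hf v0_mem h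
  exact (v0_pos ha).ne' h0

theorem fund_nonneg {f : V n → ℝ} (hf : IsRt D f) (h : 0 < f (v0 D)) {v : V n} (hv : v ∈ fund D) :
    0 ≤ f v := by
  rcases fund_sign hf with h1 | h1
  · exact h1 v hv
  · exact absurd (h1 _ v0_mem) (not_le.2 h)

theorem fund_nonpos {f : V n → ℝ} (hf : IsRt D f) (h : f (v0 D) < 0) {v : V n} (hv : v ∈ fund D) :
    f v ≤ 0 := by
  rcases fund_sign hf with h1 | h1
  · exact absurd (h1 _ v0_mem) (not_le.2 h)
  · exact h1 v hv

/-- generic point on a panel -/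
theorem exists_panel_pt {a : V n → ℝ} (ha : IsSim D a) : ∃ q ∈ fund D, a q = 0 ∧
    ∀ f, IsRt D f → f q = 0 → f = a ∨ f = -a := by
  rcases ha with ⟨i, rfl⟩ | rfl
  · obtain ⟨v, hv⟩ := exists_inner D fun j => if j = i then 0 else 1
    have hv' : ∀ j, 0 ≤ ⟪D.simple j, v⟫ := fun j => by rw [hv]; split_ifs <;> norm_num
    have hH := pos_nonneg D.highest_mem hv'
    set q := (1 / (⟪D.highest, v⟫ + 1)) • v with hq
    have hqi : ∀ β : V n, ⟪β, q⟫ = (1 / (⟪D.highest, v⟫ + 1)) * ⟪β, v⟫ := fun β => by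
      rw [hq, inner_smul_right]
    have hq0 : ∀ j, 0 ≤ ⟪D.simple j, q⟫ := fun j => by
      rw [hqi]; have := hv' j; positivity
    have hq1 : ⟪D.highest, q⟫ < 1 := by
      rw [hqi, one_div, inv_mul_lt_iff₀ (by linarith)]
      linarith
    refine ⟨q, ⟨hq0, hq1.le⟩, by show ⟪D.simple i, q⟫ = 0; rw [hqi, hv]; simp, ?_⟩
    have hqj : ∀ j, j ≠ i → 0 < ⟪D.simple j, q⟫ := fun j hj => by
      rw [hqi, hv, if_neg hj]; positivity
    intro f hf hf0
    obtain ⟨β, hβ, k, h⟩ := hf.pos_form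
    have h1 : ⟪β, q⟫ - (k : ℝ) = 0 := by
      rcases h with rfl | rfl
      · exact hf0
      · exact neg_eq_zero.1 hf0
    have a1 := pos_nonneg hβ hq0
    have a2 := pos_le hβ hq0
    have a3 : (-1 : ℝ) < k := by linarith
    have a4 : (k : ℝ) < 1 := by linarith
    have a5 : -1 < k := by exact_mod_cast a3
    have a6 : k < 1 := by exact_mod_cast a4
    have hk : k = 0 := by omega
    subst hk
    have hb : β = D.simple i := by
      obtain ⟨c, hc, hcb⟩ := D.pos_combo β hβ
      have hz := combo_zero (D := D) hc hq0 (by rw [← hcb]; simpa using h1)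
      have : β = c i • D.simple i := by
        rw [hcb]
        apply Finset.sum_eq_single i
        · intro j _ hj
          rw [hz j (hqj j hj), zero_smul]
        · simp
      rcases D.reduced _ (D.pos_sub (D.simple_mem i)) (c i) (this ▸ D.pos_sub hβ) with h | h
      · rw [this, h, one_smul]
      · have := hc i
        linarith
    subst hb
    rcases h with rfl | rfl
    · left; simp
    · right; ext; simp
  · obtain ⟨v, hv⟩ := exists_inner D fun _ => 1
    have hv' : ∀ i, 0 < ⟪D.simple i, v⟫ := fun i => by rw [hv]; norm_num
    have hH := pos_strict D.highest_mem hv'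
    set q := (1 / ⟪D.highest, v⟫) • v with hq
    have hqi : ∀ β : V n, ⟪β, q⟫ = (1 / ⟪D.highest, v⟫) * ⟪β, v⟫ := fun β => by
      rw [hq, inner_smul_right]
    have hq0 : ∀ j, 0 < ⟪D.simple j, q⟫ := fun j => by
      rw [hqi]; have := hv' j; positivity
    have hq1 : ⟪D.highest, q⟫ = 1 := by
      rw [hqi]; field_simp
    refine ⟨q, ⟨fun j => (hq0 j).le, hq1.le⟩, by simp [hq1], ?_⟩
    intro f hf hf0
    obtain ⟨β, hβ, k, h⟩ := hf.pos_form
    have h1 : ⟪β, q⟫ - (k : ℝ) = 0 := by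
      rcases h with rfl | rfl
      · exact hf0
      · exact neg_eq_zero.1 hf0
    have a1 := pos_strict hβ hq0
    have a2 := pos_le hβ fun j => (hq0 j).le
    have a3 : (0 : ℝ) < k := by linarith
    have a4 : (k : ℝ) ≤ 1 := by linarith
    have a5 : 0 < k := by exact_mod_cast a3
    have a6 : k ≤ 1 := by exact_mod_cast a4
    have hk : k = 1 := by omega
    subst hk
    have hb : β = D.highest := by
      obtain ⟨c, hc, hcb⟩ := D.highest_dominates β hβ
      have hz := combo_zero (D := D) hc (fun j => (hq0 j).le) (by
        rw [← hcb, inner_sub_left]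
        simp at h1
        linarith)
      have : D.highest - β = 0 := by
        rw [hcb]
        exact Finset.sum_eq_zero fun j _ => by rw [hz j (hq0 j), zero_smul]
      exact (sub_eq_zero.1 this).symm
    subst hb
    rcases h with rfl | rfl
    · right; ext; simp
    · left; ext; simp

/-- a simple reflection only flips its own root -/
theorem flip_only {a : V n → ℝ} {r : V n → V n} (ha : IsSim D a) (hr : IsRefl D a r)
    {s : AffW D} (hs : ap s = r)
    {f : V n → ℝ} (hf : IsRt D f) (h1 : 0 < f (v0 D)) (h2 : f (r (v0 D)) < 0) : f = a := by
  obtain ⟨q, hq, hq0, hu⟩ := exists_panel_pt ha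
  have e1 := fund_nonneg hf h1 hq
  subst hs
  have e2 := fund_nonpos (hf.comp s) h2 hq
  simp only [(hr.fix q).2 hq0] at e2
  rcases hu f hf (le_antisymm e2 e1) with h | h
  · exact h
  · subst h
    have := v0_pos ha
    simp at h1
    linarith

theorem sim_SGen {a : V n → ℝ} (ha : IsSim D a) : ∃ s ∈ SGen D, IsRefl D a (ap s) := by
  obtain ⟨g, hg⟩ := ha.isRt.exists_W
  refine ⟨g, ?_, hg⟩
  rcases ha with ⟨i, rfl⟩ | rfl
  · right
    refine ⟨i, ?_⟩
    refine hg.unique ?_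
    simpa using sRefl_isRefl (D.pos_sub (D.simple_mem i)) 0
  · left
    refine hg.neg.unique ?_
    have := sRefl_isRefl (D.pos_sub D.highest_mem) 1
    convert this using 1
    · ext v; simp
    · simp

theorem SGen_sim {s : AffW D} (hs : s ∈ SGen D) : ∃ a, IsSim D a ∧ IsRefl D a (ap s) := by
  rcases hs with h | ⟨i, h⟩
  · refine ⟨_, Or.inr rfl, ?_⟩
    have := (sRefl_isRefl (D.pos_sub D.highest_mem) 1).neg
    convert this using 1
    · ext v; simp
    · simp only [Int.cast_one]; exact h
  · refine ⟨_, Or.inl ⟨i, rfl⟩, ?_⟩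
    have := (sRefl_isRefl (D.pos_sub (D.simple_mem i)) 0)
    convert this using 1
    · ext v; simp
    · simp only [Int.cast_zero]; exact h

/-- root of a generator -/
noncomputable def ρ (s : AffW D) : V n → ℝ :=
  if h : s ∈ SGen D then (SGen_sim h).choose else 0

theorem ρ_sim {s : AffW D} (hs : s ∈ SGen D) : IsSim D (ρ s) := by
  rw [ρ, dif_pos hs]; exact (SGen_sim hs).choose_spec.1

theorem ρ_refl {s : AffW D} (hs : s ∈ SGen D) : IsRefl D (ρ s) (ap s) := by
  rw [ρ, dif_pos hs]; exact (SGen_sim hs).choose_spec.2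

theorem ρ_rt {s : AffW D} (hs : s ∈ SGen D) : IsRt D (ρ s) := (ρ_sim hs).isRt

theorem ρ_pos {s : AffW D} (hs : s ∈ SGen D) : 0 < ρ s (v0 D) := v0_pos (ρ_sim hs)

theorem ρ_neg {s : AffW D} (hs : s ∈ SGen D) (v : V n) : ρ s (ap s v) = - ρ s v :=
  (ρ_refl hs).apply_root v

theorem s_sq {s : AffW D} (hs : s ∈ SGen D) : s * s = 1 :=
  ap_ext fun v => by simpa using (ρ_refl hs).invol v

theorem s_inv {s : AffW D} (hs : s ∈ SGen D) : s⁻¹ = s := by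
  rw [inv_eq_iff_mul_eq_one]; exact s_sq hs

theorem flip_S {s : AffW D} (hs : s ∈ SGen D) {f : V n → ℝ} (hf : IsRt D f)
    (h1 : 0 < f (v0 D)) (h2 : f (ap s (v0 D)) < 0) : f = ρ s :=
  flip_only (ρ_sim hs) (ρ_refl hs) rfl hf h1 h2

/-- conjugating reflections -/
theorem conj_refl {r t g : AffW D} {a b : V n → ℝ} (hr : IsRefl D a (ap r)) (ht : IsRefl D b (ap t))
    (h : (fun v => a (ap g v)) = b ∨ (fun v => a (ap g v)) = -b) : r * g = g * t := by
  have h1 := hr.comp g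
  have h2 : (fun v => ap g⁻¹ (ap r (ap g v))) = ap t := by
    rcases h with h | h
    · rw [h] at h1; exact h1.unique ht
    · rw [h] at h1; exact h1.unique ht.neg
  apply ap_ext
  intro v
  have := congrFun h2 v
  simp only [ap_mul, ← this, ap_ap_inv]

end Chim

open scoped RealInnerProductSpace
open scoped Classical

namespace Chim

variable {n : ℕ} {D : RootData n}

/-- affine roots separating -/
def sepSet (D : RootData n) (v : V n) : Set (V n → ℝ) := {f | IsRt D f ∧ f (v0 D) < 0 ∧ 0 < f v}

theorem sepSet_finite (v : V n) : (sepSet D v).Finite := by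
  have : (⋃ α ∈ D.Φ, (fun (k : ℤ) => fun (u : V n) => ⟪α, u⟫ - (k : ℝ)) ''
      (Set.Icc ⌊⟪α, v0 D⟫⌋ ⌈⟪α, v⟫⌉)).Finite :=
    D.finite.biUnion fun α _ => (Set.finite_Icc _ _).image _
  refine this.subset ?_
  rintro f ⟨⟨α, hα, k, rfl⟩, h1, h2⟩
  simp only [Set.mem_iUnion]
  refine ⟨α, hα, k, ⟨?_, ?_⟩, rfl⟩
  · have h3 := Int.floor_le ⟪α, v0 D⟫
    have : (⌊⟪α, v0 D⟫⌋ : ℝ) < k := by linarith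
    exact le_of_lt (by exact_mod_cast this)
  · have h3 := Int.le_ceil ⟪α, v⟫
    have : (k : ℝ) < ⌈⟪α, v⟫⌉ := by linarith
    exact le_of_lt (by exact_mod_cast this)

theorem rt_ne (g : AffW D) {f : V n → ℝ} (hf : IsRt D f) : f (ap g (v0 D)) ≠ 0 :=
  v0_ne (hf.comp g)

theorem sep_step {v : V n} (hv : v ∉ fund D) : ∃ s ∈ SGen D,
    (sepSet D (ap s v)).ncard < (sepSet D v).ncard := by
  rw [mem_fund] at hv
  push Not at hv
  obtain ⟨a, ha, hav⟩ := hv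
  obtain ⟨s, hs, hsr⟩ := sim_SGen ha
  refine ⟨s, hs, ?_⟩
  have hinj : Function.Injective fun (f : V n → ℝ) => fun u => f (ap s u) := by
    intro f g h
    ext u
    have := congrFun h (ap s u)
    simpa [hsr.invol] using this
  rw [← Set.ncard_image_of_injective _ hinj]
  apply Set.ncard_lt_ncard _ (sepSet_finite v)
  rw [Set.ssubset_iff_exists]
  refine ⟨?_, -a, ⟨ha.isRt.neg, ?_, ?_⟩, ?_⟩
  · rintro _ ⟨f, ⟨hf, h1, h2⟩, rfl⟩
    refine ⟨hf.comp s, ?_, h2⟩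
    rcases lt_or_gt_of_ne (rt_ne s hf) with h | h
    · exact h
    · have : -f = a := flip_only ha hsr rfl hf.neg (by simpa using h1) (by simpa using h)
      have h3 : f = -a := by rw [← this, neg_neg]
      rw [h3] at h2
      have := hsr.apply_root v
      simp at h2
      linarith
  · simpa using v0_pos ha
  · simpa using hav
  · rintro ⟨f, ⟨hf, h1, h2⟩, h⟩
    have : f = a := by
      ext u
      have h4 := congrFun h (ap s u)
      simp only [hsr.invol, Pi.neg_apply, hsr.apply_root] at h4
      linarith
    rw [this] at h1
    linarith [v0_pos ha]

theorem exists_to_fund (v : V n) : ∃ g : AffW D, g ∈ Subgroup.closure (SGen D) ∧ ap g v ∈ fund D := by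
  induction hN : (sepSet D v).ncard using Nat.strong_induction_on generalizing v with
  | _ N ih =>
    by_cases hv : v ∈ fund D
    · exact ⟨1, one_mem _, by simpa⟩
    · obtain ⟨s, hs, hlt⟩ := sep_step hv
      obtain ⟨g, hg, hgv⟩ := ih _ (hN ▸ hlt) (ap s v) rfl
      exact ⟨g * s, mul_mem hg (Subgroup.subset_closure hs), by simpa using hgv⟩

/-- generic point on a hyperplane -/
theorem exists_generic {f : V n → ℝ} (hf : IsRt D f) : ∃ q, f q = 0 ∧
    ∀ f', IsRt D f' → f' q = 0 → f' = f ∨ f' = -f := by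
  obtain ⟨α, hα, k, rfl⟩ := hf
  have hαα : ⟪α, α⟫ ≠ 0 := by simpa using D.nonzero α hα
  let ι := {β : V n // β ∈ D.Φ ∧ β ≠ α ∧ β ≠ -α}
  have : Finite ι := (D.finite.subset (fun β (h : β ∈ D.Φ ∧ β ≠ α ∧ β ≠ -α) => h.1)).to_subtype
  obtain ⟨d, hd, hd2⟩ := Module.Dual.exists_forall_mem_ne_zero_of_forall_exists
    (LinearMap.ker (innerₗ (V n) α)) (fun b : ι => innerₗ (V n) b.1) (by
    rintro ⟨β, hβ, h1, h2⟩
    by_contra! hcon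
    have key : β = (⟪α, β⟫ / ⟪α, α⟫) • α := by
      set u := β - (⟪α, β⟫ / ⟪α, α⟫) • α with hu
      have hu1 : ⟪α, u⟫ = 0 := by
        rw [hu, inner_sub_right, inner_smul_right]
        field_simp
        simp
      have hu2 : ⟪β, u⟫ = 0 := hcon u (by simpa using hu1)
      have : ⟪u, u⟫ = 0 := by
        nth_rewrite 1 [hu]
        rw [inner_sub_left, inner_smul_left, hu1, hu2]
        simp
      have : u = 0 := by simpa using this
      rw [hu, sub_eq_zero] at this
      exact this
    rcases D.reduced α hα _ (key ▸ hβ) with h | h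
    · rw [h] at key; exact h1 (by simpa using key)
    · rw [h] at key; exact h2 (by simpa using key))
  have hd1 : ⟪α, d⟫ = 0 := hd
  set p := (k / ⟪α, α⟫) • α with hp
  have hp1 : ⟪α, p⟫ = k := by
    rw [hp, inner_smul_right]; field_simp
  have hcount : (⋃ b : ι, Set.range fun m : ℤ => ((m : ℝ) - ⟪b.1, p⟫) / ⟪b.1, d⟫).Countable :=
    Set.countable_iUnion fun b => Set.countable_range _
  obtain ⟨t, ht⟩ : ∃ t : ℝ, t ∉ (⋃ b : ι, Set.range fun m : ℤ => ((m : ℝ) - ⟪b.1, p⟫) / ⟪b.1, d⟫) := by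
    by_contra! h
    exact Set.not_countable_univ (α := ℝ) (hcount.mono fun t _ => h t)
  refine ⟨p + t • d, ?_, ?_⟩
  · simp [inner_add_right, inner_smul_right, hd1, hp1]
  · rintro f' ⟨β, hβ, m, rfl⟩ h0
    simp only [inner_add_right, inner_smul_right] at h0
    by_cases hb : β = α
    · subst hb
      left
      rw [hd1, hp1] at h0
      have : (m : ℝ) = k := by linarith
      rw [this]
    by_cases hb2 : β = -α
    · subst hb2
      right
      rw [inner_neg_left, inner_neg_left, hd1, hp1] at h0
      have : (m : ℝ) = -k := by linarith
      ext v
      simp [this]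
      ring
    · exfalso
      apply ht
      rw [Set.mem_iUnion]
      have h4 : ⟪β, d⟫ ≠ 0 := hd2 ⟨β, hβ, hb, hb2⟩
      refine ⟨⟨β, hβ, hb, hb2⟩, m, ?_⟩
      simp only
      rw [div_eq_iff h4]
      linarith

theorem refl_mem_closure {f : V n → ℝ} {r : AffW D} (hr : IsRefl D f (ap r)) :
    r ∈ Subgroup.closure (SGen D) := by
  obtain ⟨q, hq, hu⟩ := exists_generic hr.isRt
  obtain ⟨g, hg, hgq⟩ := exists_to_fund (D := D) q
  have h1 := hr.isRt.comp g⁻¹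
  obtain ⟨a, ha, ha0⟩ := fund_zero h1 hgq (by simpa using hq)
  obtain ⟨s, hs, hsr⟩ := sim_SGen ha
  have := conj_refl (g := g) hsr hr (hu _ (ha.isRt.comp g) ha0)
  have h2 : r = g⁻¹ * s * g := by rw [mul_assoc, this]; simp
  rw [h2]
  exact mul_mem (mul_mem (inv_mem hg) (Subgroup.subset_closure hs)) hg

theorem closure_top (g : AffW D) : g ∈ Subgroup.closure (SGen D) := by
  obtain ⟨g, hg⟩ := g
  unfold AffW at hg
  induction hg using Subgroup.closure_induction with
  | mem x hx =>
    have hx' := hx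
    obtain ⟨α, hα, k, hk⟩ := hx
    refine refl_mem_closure (f := fun v => ⟪α, v⟫ - (k : ℝ)) ?_
    have := sRefl_isRefl hα k
    rw [← hk] at this
    exact this
  | one => exact one_mem (Subgroup.closure (SGen D))
  | mul x y h1 h2 hx hy =>
    exact mul_mem hx hy
  | inv x h1 hx => exact inv_mem hx

theorem exists_word (g : AffW D) : ∃ l : List (AffW D), (∀ s ∈ l, s ∈ SGen D) ∧ l.prod = g := by
  have := closure_top g
  induction this using Subgroup.closure_induction with
  | mem x hx => exact ⟨[x], by simpa using hx, by simp⟩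
  | one => exact ⟨[], by simp, by simp⟩
  | mul x y _ _ hx hy =>
    obtain ⟨l, h1, rfl⟩ := hx
    obtain ⟨l', h2, rfl⟩ := hy
    refine ⟨l ++ l', ?_, by simp⟩
    intro s hs
    rcases List.mem_append.1 hs with h | h
    · exact h1 s h
    · exact h2 s h
  | inv x _ hx =>
    obtain ⟨l, h1, rfl⟩ := hx
    refine ⟨l.reverse, by simpa using h1, ?_⟩
    rw [List.prod_inv_reverse]
    congr 2
    symm
    calc _ = l.map id := List.map_congr_left fun s hs => by simp [s_inv (h1 s hs)]
      _ = l := by simp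

/-- minimal words -/
def Minl (l : List (AffW D)) : Prop := (∀ s ∈ l, s ∈ SGen D) ∧
  ∀ l' : List (AffW D), (∀ s ∈ l', s ∈ SGen D) → l'.prod = l.prod → l.length ≤ l'.length

theorem exists_min (g : AffW D) : ∃ l : List (AffW D), Minl l ∧ l.prod = g := by
  have hne : ∃ m, ∃ l : List (AffW D), (∀ s ∈ l, s ∈ SGen D) ∧ l.prod = g ∧ l.length = m := by
    obtain ⟨l, h1, h2⟩ := exists_word g
    exact ⟨_, l, h1, h2, rfl⟩
  obtain ⟨l, h1, h2, h3⟩ := Nat.find_spec hne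
  refine ⟨l, ⟨h1, fun l' h4 h5 => ?_⟩, h2⟩
  rw [h3]
  exact Nat.find_min' hne ⟨l', h4, h5.trans h2, rfl⟩

theorem Minl.of_reduced {l : List (AffW D)} {w : AffW D} (h : IsReducedWord D l w) : Minl l := by
  obtain ⟨h1, h2, h3⟩ := h
  refine ⟨h1, fun l' h4 h5 => ?_⟩
  rw [h3]
  exact Nat.sInf_le ⟨l', h4, rfl, h5.trans h2⟩

theorem Minl.tail {s : AffW D} {l : List (AffW D)} (h : Minl (s :: l)) : Minl l := by
  refine ⟨fun t ht => h.1 t (List.mem_cons_of_mem _ ht), fun l' h1 h2 => ?_⟩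
  have := h.2 (s :: l') (by
    intro t ht
    rcases List.mem_cons.1 ht with rfl | ht
    · exact h.1 _ List.mem_cons_self
    · exact h1 t ht) (by simp [h2])
  simpa using this

/-- descents -/
def Rdesc (g s : AffW D) : Prop := ρ s (ap g⁻¹ (v0 D)) < 0
def Ldesc (g s : AffW D) : Prop := ρ s (ap g (v0 D)) < 0

theorem exch_right {s : AffW D} (hs : s ∈ SGen D) (l : List (AffW D)) (hl : ∀ t ∈ l, t ∈ SGen D)
    (hd : Rdesc l.prod s) : ∃ l' : List (AffW D), (∀ t ∈ l', t ∈ SGen D) ∧ l'.prod = l.prod * s ∧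
      l'.length + 1 = l.length := by
  induction l with
  | nil =>
    simp [Rdesc] at hd
    linarith [ρ_pos hs]
  | cons t l ih =>
    have ht := hl t List.mem_cons_self
    have hl2 : ∀ t ∈ l, t ∈ SGen D := fun u hu => hl u (List.mem_cons_of_mem _ hu)
    have hf := (ρ_rt hs).comp l.prod⁻¹
    rcases lt_or_gt_of_ne (v0_ne hf) with h | h
    · obtain ⟨l', h1, h2, h3⟩ := ih hl2 h
      refine ⟨t :: l', ?_, by simp [h2, mul_assoc], by simp [h3]⟩
      intro u hu
      rcases List.mem_cons.1 hu with rfl | hu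
      · exact ht
      · exact h1 u hu
    · have hd' : ρ s (ap l.prod⁻¹ (ap t (v0 D))) < 0 := by
        simpa [Rdesc, s_inv ht] using hd
      have := flip_S ht hf h hd'
      have h5 := conj_refl (ρ_refl hs) (ρ_refl ht) (Or.inl this)
      refine ⟨l, hl2, ?_, by simp⟩
      rw [List.prod_cons]
      have h6 : l.prod * s = t * l.prod := by
        have : s = l.prod⁻¹ * t * l.prod := by rw [← h5]; simp
        rw [this]; group
      rw [mul_assoc, h6, ← mul_assoc, s_sq ht, one_mul]

theorem exch_left {s : AffW D} (hs : s ∈ SGen D) (l : List (AffW D)) (hl : ∀ t ∈ l, t ∈ SGen D)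
    (hd : Ldesc l.prod s) : ∃ l' : List (AffW D), (∀ t ∈ l', t ∈ SGen D) ∧ l'.prod = s * l.prod ∧
      l'.length + 1 = l.length := by
  induction l using List.reverseRecOn with
  | nil =>
    simp [Ldesc] at hd
    linarith [ρ_pos hs]
  | append_singleton l t ih =>
    have ht := hl t (by simp)
    have hl2 : ∀ t ∈ l, t ∈ SGen D := fun u hu => hl u (by simp [hu])
    have hf := (ρ_rt hs).comp l.prod
    rcases lt_or_gt_of_ne (v0_ne hf) with h | h
    · obtain ⟨l', h1, h2, h3⟩ := ih hl2 h
      refine ⟨l' ++ [t], ?_, by simp [h2, mul_assoc], by simp [h3]⟩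
      intro u hu
      rcases List.mem_append.1 hu with hu | hu
      · exact h1 u hu
      · simp at hu; exact hu ▸ ht
    · have hd' : ρ s (ap l.prod (ap t (v0 D))) < 0 := by
        simpa [Ldesc] using hd
      have := flip_S ht hf h hd'
      have h5 := conj_refl (ρ_refl hs) (ρ_refl ht) (Or.inl this)
      refine ⟨l, hl2, ?_, by simp⟩
      simp only [List.prod_append, List.prod_singleton]
      rw [← mul_assoc, h5, mul_assoc, s_sq ht, mul_one]

theorem Minl.not_Rdesc {s : AffW D} {l0 l : List (AffW D)} (h : Minl (l0 ++ s :: l)) :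
    ¬ Rdesc l0.prod s := by
  intro hd
  obtain ⟨l', h1, h2, h3⟩ := exch_right (h.1 s (by simp)) l0 (fun t ht => h.1 t (by simp [ht])) hd
  have := h.2 (l' ++ l) (by
    intro t ht
    rcases List.mem_append.1 ht with ht | ht
    · exact h1 t ht
    · exact h.1 t (by simp [ht])) (by simp [h2, mul_assoc])
  simp at this
  omega

theorem Minl.not_Ldesc {s : AffW D} {l : List (AffW D)} (h : Minl (s :: l)) :
    ¬ Ldesc l.prod s := by
  intro hd
  obtain ⟨l', h1, h2, h3⟩ := exch_left (h.1 s (by simp)) l (fun t ht => h.1 t (by simp [ht])) hd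
  have := h.2 l' h1 (by simp [h2])
  simp at this
  omega

theorem Minl.left_pos {s : AffW D} {l : List (AffW D)} (h : Minl (s :: l)) {v : V n}
    (hv : v ∈ fund D) : 0 ≤ ρ s (ap l.prod v) := by
  have hs := h.1 s (by simp)
  have h1 := (ρ_rt hs).comp l.prod
  have h2 : 0 < ρ s (ap l.prod (v0 D)) :=
    lt_of_le_of_ne (not_lt.1 h.not_Ldesc) (Ne.symm (v0_ne h1))
  exact fund_nonneg h1 h2 hv

theorem Minl.first_fix {s : AffW D} {l : List (AffW D)} (h : Minl (s :: l)) {v : V n}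
    (hv : v ∈ fund D) (hgv : ap (s :: l).prod v ∈ fund D) :
    ρ s (ap (s :: l).prod v) = 0 ∧ ap l.prod v = ap (s :: l).prod v := by
  have hs := h.1 s (by simp)
  have h1 := h.left_pos hv
  have h2 := mem_fund.1 hgv _ (ρ_sim hs)
  simp only [List.prod_cons, ap_mul] at *
  rw [ρ_neg hs] at h2 ⊢
  have h3 : ρ s (ap l.prod v) = 0 := by linarith
  exact ⟨by linarith, (((ρ_refl hs).fix _).2 h3).symm⟩

theorem strict_dom (g : AffW D) {v : V n} (hv : v ∈ fund D) (hgv : ap g v ∈ fund D) :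
    ap g v = v := by
  obtain ⟨l, hl, rfl⟩ := exists_min g
  induction l with
  | nil => simp
  | cons s l ih =>
    have := (hl.first_fix hv hgv).2
    rw [← this] at hgv ⊢
    exact ih hl.tail hgv

theorem eq_one_of_mem {g : AffW D} (h : ap g (v0 D) ∈ fund D) : g = 1 := by
  obtain ⟨l, hl, rfl⟩ := exists_min g
  cases l with
  | nil => simp
  | cons s l =>
    have h1 := (hl.first_fix v0_mem h).1
    rw [strict_dom _ v0_mem h] at h1
    exact absurd h1 (ρ_pos (hl.1 s (by simp))).ne'

theorem stab_panel {s : AffW D} (hs : s ∈ SGen D) {q : V n} (hq : q ∈ fund D)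
    (hu : ∀ f, IsRt D f → f q = 0 → f = ρ s ∨ f = - ρ s) {g : AffW D} (hg : ap g q = q) :
    g = 1 ∨ g = s := by
  obtain ⟨l, hl, rfl⟩ := exists_min g
  have key : ∀ (t : AffW D) (l : List (AffW D)), Minl (t :: l) → ap (t :: l).prod q = q →
      t = s ∧ ap l.prod q = q := by
    intro t l hl h
    have h1 := hl.first_fix hq (by rwa [h])
    rw [h] at h1
    have ht := hl.1 t (by simp)
    refine ⟨?_, h1.2⟩
    have h2 := conj_refl (g := 1) (ρ_refl ht) (ρ_refl hs) (by simpa using hu _ (ρ_rt ht) h1.1)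
    simpa using h2
  match l, hl, hg with
  | [], _, _ => left; simp
  | [t], hl, h => right; simpa using (key t [] hl h).1
  | t :: t' :: l, hl, h =>
    exfalso
    obtain ⟨h1, h2⟩ := key _ _ hl h
    obtain ⟨h3, h4⟩ := key _ _ hl.tail h2
    have h5 := hl.2 l (fun u hu => hl.1 u (by simp [hu])) (by
      simp only [List.prod_cons]
      rw [h1, h3, ← mul_assoc, s_sq hs, one_mul])
    simp at h5

end Chim

open scoped RealInnerProductSpace
open scoped Classical

namespace Chim

variable {n : ℕ} {D : RootData n}

/-- one step of a folded gallery -/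
def stepR (P : AffW D → AffW D → Prop) (s g h : AffW D) : Prop := h = g * s ∨ (h = g ∧ P g s)
def stepL (s g h : AffW D) : Prop := h = s * g ∨ (h = g ∧ Ldesc g s)

theorem sign_same {t g : AffW D} (ht : t ∈ SGen D) {f : V n → ℝ} (hf : IsRt D f)
    (h : ¬ ((fun v => f (ap g v)) = ρ t ∨ (fun v => f (ap g v)) = - ρ t)) :
    f (ap g (ap t (v0 D))) < 0 ↔ f (ap g (v0 D)) < 0 := by
  push Not at h
  have hfg := hf.comp g
  have h1 := v0_ne hfg
  have h2 := v0_ne (hfg.comp t)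
  constructor
  · intro h3
    by_contra h4
    exact h.1 (flip_S ht hfg (lt_of_le_of_ne (not_lt.1 h4) h1.symm) h3)
  · intro h3
    by_contra h4
    have h5 : 0 < f (ap g (ap t (v0 D))) := lt_of_le_of_ne (not_lt.1 h4) h2.symm
    have := flip_S ht hfg.neg (by simpa using h3) (by simpa using h5)
    exact h.2 (by rw [← this, neg_neg])

theorem root_cases {s t g : AffW D}  :
    ((fun v => ρ t (ap g⁻¹ v)) = ρ s ∨ (fun v => ρ t (ap g⁻¹ v)) = - ρ s) →
    ((fun v => ρ s (ap g v)) = ρ t ∨ (fun v => ρ s (ap g v)) = - ρ t) := by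
  rintro (h | h)
  · left
    rw [← h]; simp
  · right
    have : ρ s = - fun v => ρ t (ap g⁻¹ v) := by rw [h, neg_neg]
    rw [this]; ext; simp

theorem step_comm {s t : AffW D} (hs : s ∈ SGen D) (ht : t ∈ SGen D) (g h : AffW D) :
    (∃ m, stepR Rdesc t g m ∧ stepL s m h) ↔ (∃ m, stepL s g m ∧ stepR Rdesc t m h) := by
  by_cases hc : (fun v => ρ s (ap g v)) = ρ t ∨ (fun v => ρ s (ap g v)) = - ρ t
  · have e := conj_refl (ρ_refl hs) (ρ_refl ht) hc
    have key : ∀ u : AffW D, s * u = u * t → (Ldesc u s ↔ Rdesc u t) →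
        ∀ m, stepR Rdesc t u m ↔ stepL s u m := by
      intro u h1 h2 m
      simp only [stepR, stepL, h1, h2]
    have d1 : Ldesc g s ↔ Rdesc g t := by
      unfold Ldesc Rdesc
      have e1 := ρ_pos hs
      have e2 := ρ_pos ht
      rcases hc with h | h
      · have h1 := congrFun h (v0 D)
        have h2 := congrFun h (ap g⁻¹ (v0 D))
        simp only [ap_ap_inv] at h1 h2
        constructor <;> intro <;> linarith
      · have h1 := congrFun h (v0 D)
        have h2 := congrFun h (ap g⁻¹ (v0 D))
        simp only [ap_ap_inv, Pi.neg_apply] at h1 h2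
        constructor <;> intro <;> linarith
    have d2 : Ldesc (g * t) s ↔ Rdesc (g * t) t := by
      unfold Ldesc Rdesc at *
      rw [← e]
      simp only [ap_mul, ρ_neg hs]
      rw [e]
      simp only [mul_inv_rev, s_inv ht, ap_mul, ρ_neg ht]
      have h1 := rt_ne g (ρ_rt hs)
      have h2 := rt_ne g⁻¹ (ρ_rt ht)
      constructor
      · intro h3
        have : ¬ ρ t (ap g⁻¹ (v0 D)) < 0 := by rw [← d1]; linarith
        have := lt_of_le_of_ne (not_lt.1 this) h2.symm
        linarith
      · intro h3
        have : ¬ ρ s (ap g (v0 D)) < 0 := by rw [d1]; linarith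
        have := lt_of_le_of_ne (not_lt.1 this) h1.symm
        linarith
    have k1 := key g e d1
    have k2 := key (g * t) (by rw [← mul_assoc, e]) d2
    constructor
    · rintro ⟨m, h1, h2⟩
      refine ⟨m, (k1 m).1 h1, ?_⟩
      rcases h1 with rfl | ⟨rfl, _⟩
      · exact (k2 h).2 h2
      · exact (k1 h).2 h2
    · rintro ⟨m, h1, h2⟩
      have h1' := (k1 m).2 h1
      refine ⟨m, h1', ?_⟩
      rcases h1' with rfl | ⟨rfl, _⟩
      · exact (k2 h).1 h2
      · exact (k1 h).1 h2
  · have a1 : Ldesc (g * t) s ↔ Ldesc g s := by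
      simpa [Ldesc] using sign_same ht (ρ_rt hs) hc
    have a2 : Rdesc (s * g) t ↔ Rdesc g t := by
      have := sign_same (g := g⁻¹) hs (ρ_rt ht) (fun h => hc (root_cases h))
      simpa [Rdesc, s_inv hs] using this
    constructor
    · rintro ⟨m, rfl | ⟨rfl, h1⟩, rfl | ⟨rfl, h2⟩⟩
      · exact ⟨s * g, Or.inl rfl, Or.inl (by rw [mul_assoc])⟩
      · exact ⟨g, Or.inr ⟨rfl, a1.1 h2⟩, Or.inl rfl⟩
      · exact ⟨s * m, Or.inl rfl, Or.inr ⟨rfl, a2.2 h1⟩⟩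
      · exact ⟨h, Or.inr ⟨rfl, h2⟩, Or.inr ⟨rfl, h1⟩⟩
    · rintro ⟨m, rfl | ⟨rfl, h1⟩, rfl | ⟨rfl, h2⟩⟩
      · exact ⟨g * t, Or.inl rfl, Or.inl (by rw [mul_assoc])⟩
      · exact ⟨g, Or.inr ⟨rfl, a2.1 h2⟩, Or.inl rfl⟩
      · exact ⟨m * t, Or.inl rfl, Or.inr ⟨rfl, a1.2 h1⟩⟩
      · exact ⟨h, Or.inr ⟨rfl, h2⟩, Or.inr ⟨rfl, h1⟩⟩

/-- folded paths of given word type -/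
def PR (P : AffW D → AffW D → Prop) : List (AffW D) → AffW D → AffW D → Prop
  | [], g, h => g = h
  | s :: l, g, h => ∃ m, stepR P s g m ∧ PR P l m h

theorem PR_comm {s : AffW D} (hs : s ∈ SGen D) (l : List (AffW D)) (hl : ∀ t ∈ l, t ∈ SGen D)
    (g h : AffW D) :
    (∃ m, PR Rdesc l g m ∧ stepL s m h) ↔ (∃ m, stepL s g m ∧ PR Rdesc l m h) := by
  induction l generalizing g with
  | nil => simp [PR]
  | cons t l ih =>
    have ih' := ih fun u hu => hl u (List.mem_cons_of_mem _ hu)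
    have hc := step_comm hs (hl t List.mem_cons_self)
    constructor
    · rintro ⟨m, ⟨m1, h1, h2⟩, h3⟩
      obtain ⟨m2, h4, h5⟩ := (ih' m1).1 ⟨m, h2, h3⟩
      obtain ⟨m3, h6, h7⟩ := (hc g m2).1 ⟨m1, h1, h4⟩
      exact ⟨m3, h6, m2, h7, h5⟩
    · rintro ⟨m3, h6, m2, h7, h5⟩
      obtain ⟨m1, h1, h4⟩ := (hc g m2).2 ⟨m3, h6, h7⟩
      obtain ⟨m, h2, h3⟩ := (ih' m1).2 ⟨m2, h4, h5⟩
      exact ⟨m, ⟨m1, h1, h2⟩, h3⟩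

theorem PR_min (l l0 : List (AffW D)) (h : Minl (l0 ++ l)) (x : AffW D) :
    PR Rdesc l l0.prod x ↔ (l0 ++ l).prod = x := by
  induction l generalizing l0 with
  | nil => simp [PR]
  | cons s l ih =>
    have hd := h.not_Rdesc
    have ih' := ih (l0 ++ [s]) (by simpa using h)
    simp only [PR, stepR]
    simp only [List.prod_append, List.append_assoc, List.singleton_append,
      List.prod_cons, List.prod_nil, mul_one] at ih' ⊢
    constructor
    · rintro ⟨m, rfl | ⟨rfl, h1⟩, h2⟩
      · exact ih'.1 h2
      · exact absurd h1 hd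
    · intro h1
      exact ⟨_, Or.inl rfl, ih'.2 h1⟩

/-- Braid invariance for alcove orientations. -/
theorem PR_indep {l l' : List (AffW D)} (h : Minl l) (h' : Minl l') (he : l.prod = l'.prod)
    (g x : AffW D) : PR Rdesc l g x ↔ PR Rdesc l' g x := by
  obtain ⟨m, hm, rfl⟩ := exists_min g
  induction m generalizing x with
  | nil =>
    have h1 := PR_min l [] h x
    have h2 := PR_min l' [] h' x
    rw [h1, h2]
    simp [he]
  | cons s m ih =>
    have ih' := fun x => ih x hm.tail
    have hs := hm.1 s (by simp)
    have hd := hm.not_Ldesc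
    have key : ∀ k : List (AffW D), Minl k → (PR Rdesc k (s :: m).prod x ↔
        ∃ u, PR Rdesc k m.prod u ∧ stepL s u x) := by
      intro k hk
      rw [PR_comm hs k hk.1]
      simp only [List.prod_cons]
      constructor
      · intro h3
        exact ⟨_, Or.inl rfl, h3⟩
      · rintro ⟨u, rfl | ⟨rfl, h3⟩, h4⟩
        · exact h4
        · exact absurd h3 hd
    rw [key l h, key l' h']
    exact exists_congr fun u => and_congr_left fun _ => ih' u

theorem PR_translate {P : AffW D → AffW D → Prop} {y : AffW D}
    (hP : ∀ g s, P g s ↔ Rdesc (y⁻¹ * g) s) (l : List (AffW D)) (g h : AffW D) :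
    PR P l g h ↔ PR Rdesc l (y⁻¹ * g) (y⁻¹ * h) := by
  induction l generalizing g with
  | nil => simp [PR]
  | cons s l ih =>
    simp only [PR, stepR]
    constructor
    · rintro ⟨m, h1, h2⟩
      refine ⟨y⁻¹ * m, ?_, (ih m).1 h2⟩
      rcases h1 with rfl | ⟨rfl, h1⟩
      · left; rw [mul_assoc]
      · right; exact ⟨rfl, (hP _ _).1 h1⟩
    · rintro ⟨m, h1, h2⟩
      refine ⟨y * m, ?_, (ih _).2 (by simpa using h2)⟩
      rcases h1 with rfl | ⟨rfl, h1⟩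
      · left; group
      · right; exact ⟨by group, (hP _ _).2 h1⟩

open Filter in
theorem PR_eventually {P : AffW D → AffW D → Prop} {Q : ℕ → AffW D → AffW D → Prop}
    (l : List (AffW D)) (hPQ : ∀ g, ∀ s ∈ l, ∀ᶠ M in atTop, (P g s ↔ Q M g s)) (g : AffW D) :
    ∀ᶠ M in atTop, ∀ h, PR P l g h ↔ PR (Q M) l g h := by
  induction l generalizing g with
  | nil => simp [PR]
  | cons s l ih =>
    have ih' := ih fun g s hs => hPQ g s (List.mem_cons_of_mem _ hs)
    filter_upwards [ih' g, ih' (g * s), hPQ g s List.mem_cons_self] with M h1 h2 h3 h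
    simp only [PR, stepR]
    constructor
    · rintro ⟨m, rfl | ⟨rfl, h4⟩, h5⟩
      · exact ⟨_, Or.inl rfl, (h2 h).1 h5⟩
      · exact ⟨_, Or.inr ⟨rfl, h3.1 h4⟩, (h1 h).1 h5⟩
    · rintro ⟨m, rfl | ⟨rfl, h4⟩, h5⟩
      · exact ⟨_, Or.inl rfl, (h2 h).2 h5⟩
      · exact ⟨_, Or.inr ⟨rfl, h3.2 h4⟩, (h1 h).2 h5⟩

open Filter in
theorem PR_main {P : AffW D → AffW D → Prop} (b : ℕ → V n)
    (hP : ∀ g, ∀ s ∈ SGen D, ∀ᶠ M in atTop, ρ s (ap g⁻¹ (b M)) ≠ 0 ∧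
      (P g s ↔ ρ s (ap g⁻¹ (b M)) < 0))
    {l l' : List (AffW D)} (h : Minl l) (h' : Minl l') (he : l.prod = l'.prod)
    (g x : AffW D) : PR P l g x ↔ PR P l' g x := by
  have hy : ∀ M, ∃ y : AffW D, ap y⁻¹ (b M) ∈ fund D := fun M => by
    obtain ⟨y, _, hy⟩ := exists_to_fund (D := D) (b M)
    exact ⟨y⁻¹, by simpa using hy⟩
  choose y hy using hy
  have hPQ : ∀ g, ∀ s ∈ SGen D, ∀ᶠ M in atTop, (P g s ↔ Rdesc ((y M)⁻¹ * g) s) := by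
    intro g s hs
    filter_upwards [hP g s hs] with M hM
    rw [hM.2]
    have hf := ((ρ_rt hs).comp g⁻¹).comp (y M)
    have e : ρ s (ap g⁻¹ (ap (y M) (ap (y M)⁻¹ (b M)))) = ρ s (ap g⁻¹ (b M)) := by
      simp
    unfold Rdesc
    simp only [mul_inv_rev, inv_inv, ap_mul]
    constructor
    · intro h1
      by_contra h2
      have := fund_nonneg hf (lt_of_le_of_ne (not_lt.1 h2) (v0_ne hf).symm) (hy M)
      rw [e] at this
      linarith
    · intro h1
      have := fund_nonpos hf h1 (hy M)
      rw [e] at this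
      exact lt_of_le_of_ne this hM.1
  have e1 := PR_eventually l (fun g s hs => hPQ g s (h.1 s hs)) g
  have e2 := PR_eventually l' (fun g s hs => hPQ g s (h'.1 s hs)) g
  obtain ⟨M, h1, h2⟩ := (e1.and e2).exists
  rw [h1, h2, PR_translate (y := y M) (fun _ _ => Iff.rfl), PR_translate (y := y M) (fun _ _ => Iff.rfl)]
  exact PR_indep h h' he _ _

end Chim

open scoped RealInnerProductSpace
open scoped Classical

namespace Chim

variable {n : ℕ} {D : RootData n}

theorem simple_v0 (i : Fin n) : 0 < ⟪D.simple i, v0 D⟫ := v0_pos (Or.inl ⟨i, rfl⟩)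

theorem pos_v0 {β : V n} (hβ : β ∈ D.pos) : 0 < ⟪β, v0 D⟫ := pos_strict hβ simple_v0

theorem pos_v0_lt {β : V n} (hβ : β ∈ D.pos) : ⟪β, v0 D⟫ < 1 := by
  have h1 := pos_le hβ fun i => (simple_v0 (D := D) i).le
  have h2 : 0 < 1 - ⟪D.highest, v0 D⟫ := v0_pos (D := D) (Or.inr rfl)
  linarith

theorem halfFor_one {β : V n} (hβ : β ∈ D.pos) (k : ℝ) : halfFor D β k 1 = Hge β k := by
  rw [halfFor, if_pos]
  intro v hv
  exact hv β hβ

theorem halfFor_w0 {β : V n} (hβ : β ∈ D.pos) (k : ℝ) {w0 : Equiv.Perm (V n)}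
    (hw0 : IsLongest D w0) : halfFor D β k w0 = Hle β k := by
  rw [halfFor, if_neg]
  intro h
  have : - v0 D ∈ ⇑w0 '' Cf D := by
    rw [hw0.2]
    simp only [Set.mem_ofPred_eq, neg_neg]
    exact fun α hα => (pos_v0 hα).le
  obtain ⟨u, hu, he⟩ := this
  have h1 := h u hu
  rw [he, inner_neg_right] at h1
  linarith [pos_v0 hβ]

/-- coweight in direction of the chimney -/
noncomputable def om (D : RootData n) (J : Set (Fin n)) : V n :=
  (exists_inner D fun j => if j ∈ J then 0 else 1).choose

theorem om_spec (J : Set (Fin n)) (j : Fin n) : ⟪D.simple j, om D J⟫ = if j ∈ J then 0 else 1 :=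
  (exists_inner D fun j => if j ∈ J then 0 else 1).choose_spec j

theorem om_nonneg (J : Set (Fin n)) (j : Fin n) : 0 ≤ ⟪D.simple j, om D J⟫ := by
  rw [om_spec]; split_ifs <;> norm_num

theorem om_J {J : Set (Fin n)} {β : V n} (hβ : β ∈ PhiJpos D J) : ⟪β, om D J⟫ = 0 := by
  have := hβ.2.2
  clear hβ
  induction this using Submodule.span_induction with
  | mem x hx =>
    obtain ⟨i, hi, rfl⟩ := hx
    rw [om_spec, if_pos hi]
  | zero => simp
  | add x y _ _ hx hy => rw [inner_add_left, hx, hy, add_zero]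
  | smul a x _ hx => rw [inner_smul_left, hx, mul_zero]

theorem om_notJ {J : Set (Fin n)} {β : V n} (hβ : β ∈ D.pos) (hJ : β ∉ PhiJpos D J) :
    0 < ⟪β, om D J⟫ := by
  refine lt_of_le_of_ne (pos_nonneg hβ (om_nonneg J)) fun h => hJ ⟨hβ, D.pos_sub hβ, ?_⟩
  obtain ⟨c, hc, hcb⟩ := D.pos_combo β hβ
  have hz := combo_zero (D := D) hc (om_nonneg J) (by rw [← hcb]; exact h.symm)
  rw [hcb]
  refine Submodule.sum_mem _ fun i _ => ?_
  by_cases hi : i ∈ J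
  · exact Submodule.smul_mem _ _ (Submodule.subset_span ⟨i, hi, rfl⟩)
  · rw [hz i (by rw [om_spec, if_neg hi]; norm_num), zero_smul]
    exact Submodule.zero_mem _

/-- points going deep into the chimney -/
noncomputable def b0 (D : RootData n) (J : Set (Fin n)) (M : ℕ) : V n := v0 D - (M : ℝ) • om D J

theorem b0_inner (J : Set (Fin n)) (M : ℕ) (β : V n) :
    ⟪β, b0 D J M⟫ = ⟪β, v0 D⟫ - M * ⟪β, om D J⟫ := by
  rw [b0, inner_sub_right, inner_smul_right]

open Filter

theorem b0_J {J : Set (Fin n)} {β : V n} (hβ : β ∈ PhiJpos D J) (M : ℕ) :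
    0 < ⟪β, b0 D J M⟫ ∧ ⟪β, b0 D J M⟫ < 1 := by
  rw [b0_inner, om_J hβ, mul_zero, sub_zero]
  exact ⟨pos_v0 hβ.1, pos_v0_lt hβ.1⟩

theorem b0_notJ {J : Set (Fin n)} {β : V n} (hβ : β ∈ D.pos) (hJ : β ∉ PhiJpos D J) (k : ℝ) :
    ∀ᶠ M in atTop, ⟪β, b0 D J M⟫ < k := by
  have h1 := om_notJ hβ hJ
  have h2 : Tendsto (fun M : ℕ => (M : ℝ) * ⟪β, om D J⟫) atTop atTop :=
    tendsto_natCast_atTop_atTop.atTop_mul_const h1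
  filter_upwards [h2.eventually_gt_atTop (⟪β, v0 D⟫ - k)] with M hM
  rw [b0_inner]
  linarith

theorem chim_mem {J : Set (Fin n)} {w0 : Equiv.Perm (V n)} (hw0 : IsLongest D w0)
    {h : Set (V n)} (hh : h ∈ chimney D J w0) : ∀ᶠ M in atTop, b0 D J M ∈ h := by
  rcases hh with (⟨β, hβ, k, hk, rfl⟩ | ⟨β, hβ, k, hk, rfl⟩) | ⟨β, hβ, k, rfl⟩
  · rw [halfFor_one hβ.1]
    refine Eventually.of_forall fun M => ?_
    have := (b0_J hβ M).1
    have hk' : (k : ℝ) ≤ 0 := by exact_mod_cast hk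
    show (k : ℝ) ≤ _
    linarith
  · rw [halfFor_w0 hβ.1 _ hw0]
    refine Eventually.of_forall fun M => ?_
    have := (b0_J hβ M).2
    have hk' : (1 : ℝ) ≤ k := by exact_mod_cast hk
    show _ ≤ (k : ℝ)
    linarith
  · rw [halfFor_w0 hβ.1 _ hw0]
    filter_upwards [b0_notJ hβ.1 hβ.2 k] with M hM
    exact hM.le

theorem chim_form {J : Set (Fin n)} {w0 : Equiv.Perm (V n)} (hw0 : IsLongest D w0)
    {f : V n → ℝ} (hf : IsRt D f) :
    ({v | 0 ≤ f v} ∈ chimney D J w0 ∧ ∀ᶠ M in atTop, 0 < f (b0 D J M)) ∨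
    ({v | f v ≤ 0} ∈ chimney D J w0 ∧ ∀ᶠ M in atTop, f (b0 D J M) < 0) := by
  obtain ⟨β, hβ, k, h⟩ := hf.pos_form
  have key : (Hge β k ∈ chimney D J w0 ∧ ∀ᶠ M in atTop, 0 < ⟪β, b0 D J M⟫ - k) ∨
      (Hle β k ∈ chimney D J w0 ∧ ∀ᶠ M in atTop, ⟪β, b0 D J M⟫ - k < 0) := by
    by_cases hJ : β ∈ PhiJpos D J
    · rcases le_or_gt k 0 with hk | hk
      · left
        refine ⟨Or.inl (Or.inl ⟨β, hJ, k, hk, (halfFor_one hβ _).symm⟩), Eventually.of_forall fun M => ?_⟩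
        have := (b0_J hJ M).1
        have hk' : (k : ℝ) ≤ 0 := by exact_mod_cast hk
        linarith
      · right
        refine ⟨Or.inl (Or.inr ⟨β, hJ, k, hk, (halfFor_w0 hβ _ hw0).symm⟩), Eventually.of_forall fun M => ?_⟩
        have := (b0_J hJ M).2
        have hk' : (1 : ℝ) ≤ k := by exact_mod_cast hk
        linarith
    · right
      refine ⟨Or.inr ⟨β, ⟨hβ, hJ⟩, k, (halfFor_w0 hβ _ hw0).symm⟩, ?_⟩
      filter_upwards [b0_notJ hβ hJ k] with M hM
      linarith
  rcases h with rfl | rfl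
  · have e1 : {v | 0 ≤ ⟪β, v⟫ - (k : ℝ)} = Hge β k := by ext v; simp [Hge]
    have e2 : {v | ⟪β, v⟫ - (k : ℝ) ≤ 0} = Hle β k := by ext v; simp [Hle]
    rw [e1, e2]
    exact key
  · have e1 : {v | 0 ≤ -(⟪β, v⟫ - (k : ℝ))} = Hle β k := by ext v; simp [Hle]
    have e2 : {v | -(⟪β, v⟫ - (k : ℝ)) ≤ 0} = Hge β k := by ext v; simp [Hge]
    rw [e1, e2]
    rcases key with ⟨h1, h2⟩ | ⟨h1, h2⟩
    · right
      refine ⟨h1, ?_⟩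
      filter_upwards [h2] with M hM
      linarith
    · left
      refine ⟨h1, ?_⟩
      filter_upwards [h2] with M hM
      linarith

theorem chimneyY_iff {J : Set (Fin n)} {w0 : Equiv.Perm (V n)} {y : AffW D} {f : V n → ℝ} :
    {v | 0 ≤ f v} ∈ chimneyY D J w0 y ↔ {v | 0 ≤ f (ap y v)} ∈ chimney D J w0 := by
  constructor
  · rintro ⟨h', hh, he⟩
    convert hh using 1
    ext v
    have : ap y v ∈ {v | 0 ≤ f v} ↔ ap y v ∈ actW y h' := by rw [he]
    rw [mem_actW] at this
    simpa using this
  · intro h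
    refine ⟨_, h, ?_⟩
    ext v
    rw [mem_actW]
    simp

theorem mem_fixedPanel {s : AffW D} (hs : s ∈ SGen D) {v : V n} :
    v ∈ fixedPanelType s ↔ v ∈ fund D ∧ ρ s v = 0 := by
  unfold fixedPanelType
  exact and_congr_right fun _ => (ρ_refl hs).fix v

theorem panel_pt {s : AffW D} (hs : s ∈ SGen D) : ∃ q ∈ fixedPanelType s,
    ∀ f, IsRt D f → f q = 0 → f = ρ s ∨ f = - ρ s := by
  obtain ⟨q, h1, h2, h3⟩ := exists_panel_pt (ρ_sim hs)
  exact ⟨q, (mem_fixedPanel hs).2 ⟨h1, h2⟩, h3⟩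

theorem orient_iff {J : Set (Fin n)} {w0 : Equiv.Perm (V n)} {y z s : AffW D} (hs : s ∈ SGen D) :
    chimneyOrient D J w0 y (actW z (fund D)) (actW z (fixedPanelType s)) ↔
      {v | 0 ≤ ρ s (ap z⁻¹ v)} ∉ chimneyY D J w0 y := by
  obtain ⟨q, hq, hu⟩ := panel_pt hs
  have hq' := (mem_fixedPanel hs).1 hq
  have hf := (ρ_rt hs).comp z⁻¹
  constructor
  · intro h hmem
    obtain ⟨α, hα, k, he⟩ := hf
    have e : ∀ v, ρ s (ap z⁻¹ v) = ⟪α, v⟫ - k := fun v => congrFun he v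
    refine h α hα k ?_ (Or.inl ⟨?_, ?_⟩)
    · intro v hv
      rw [mem_actW, mem_fixedPanel hs] at hv
      have := e v
      rw [hv.2] at this
      show ⟪α, v⟫ = k
      linarith
    · intro v hv
      rw [mem_actW] at hv
      have := mem_fund.1 hv _ (ρ_sim hs)
      rw [e] at this
      show (k : ℝ) ≤ ⟪α, v⟫
      linarith
    · convert hmem using 1
      ext v
      simp [Hge, e]
  · intro h α hα k hp hcon
    have hrt : IsRt D (fun v => ⟪α, v⟫ - (k : ℝ)) := ⟨α, hα, k, rfl⟩
    have hzq : ap z q ∈ actW z (fixedPanelType s) := by rw [mem_actW]; simpa using hq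
    have h1 : ⟪α, ap z q⟫ = (k : ℝ) := hp hzq
    have h2 := hu _ (hrt.comp z) (by simp [h1])
    have hv0 : ap z (v0 D) ∈ actW z (fund D) := by rw [mem_actW]; simpa using v0_mem
    have hpos := ρ_pos hs
    rcases h2 with h2 | h2
    · have e : ∀ v, ρ s (ap z⁻¹ v) = ⟪α, v⟫ - k := fun v => by
        rw [← h2]; simp
      rcases hcon with ⟨_, h4⟩ | ⟨h3, _⟩
      · apply h
        convert h4 using 1
        ext v
        simp [Hge, e]
      · have h5 : ⟪α, ap z (v0 D)⟫ ≤ k := h3 hv0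
        have := e (ap z (v0 D))
        simp only [ap_inv_ap] at this
        linarith
    · have e : ∀ v, ρ s (ap z⁻¹ v) = -(⟪α, v⟫ - k) := fun v => by
        have := congrFun h2 (ap z⁻¹ v)
        simp only [ap_ap_inv, Pi.neg_apply] at this
        linarith
      rcases hcon with ⟨h3, _⟩ | ⟨_, h4⟩
      · have h5 : (k : ℝ) ≤ ⟪α, ap z (v0 D)⟫ := h3 hv0
        have := e (ap z (v0 D))
        simp only [ap_inv_ap] at this
        linarith
      · apply h
        convert h4 using 1
        ext v
        simp [Hle, e]

theorem orient_eventually {J : Set (Fin n)} {w0 : Equiv.Perm (V n)} (hw0 : IsLongest D w0)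
    (y g s : AffW D) (hs : s ∈ SGen D) :
    ∀ᶠ M in atTop, ρ s (ap g⁻¹ (ap y (b0 D J M))) ≠ 0 ∧
      (chimneyOrient D J w0 y (actW g (fund D)) (actW g (fixedPanelType s)) ↔
        ρ s (ap g⁻¹ (ap y (b0 D J M))) < 0) := by
  rw [orient_iff hs, chimneyY_iff (f := fun v => ρ s (ap g⁻¹ v))]
  have hf := ((ρ_rt hs).comp g⁻¹).comp y
  rcases chim_form (J := J) hw0 hf with ⟨h1, h2⟩ | ⟨h1, h2⟩
  · filter_upwards [h2] with M hM
    refine ⟨hM.ne', ?_⟩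
    constructor
    · intro h; exact absurd h1 h
    · intro h; exact absurd h (not_lt.2 hM.le)
  · filter_upwards [h2] with M hM
    refine ⟨hM.ne, ?_⟩
    constructor
    · intro _; exact hM
    · intro _ h3
      obtain ⟨M', h4, h5⟩ := ((chim_mem hw0 h3).and h2).exists
      simp only [Set.mem_ofPred_eq] at h4
      linarith

end Chim

open scoped RealInnerProductSpace
open scoped Classical

namespace Chim

variable {n : ℕ} {D : RootData n}

open Filter Topology

theorem seg_closure {C : Set (V n)} {w u : V n}
    (h : ∀ t : ℝ, 0 < t → t ≤ 1 → (1 - t) • w + t • u ∈ C) : w ∈ closure C := by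
  have hc : Continuous fun t : ℝ => (1 - t) • w + t • u := by fun_prop
  have h1 : Tendsto (fun t : ℝ => (1 - t) • w + t • u) (𝓝[>] 0) (𝓝 w) := by
    have := hc.tendsto 0
    simp only [sub_zero, one_smul, zero_smul, add_zero] at this
    exact this.mono_left nhdsWithin_le_nhds
  refine mem_closure_of_tendsto h1 ?_
  filter_upwards [Ioc_mem_nhdsGT (show (0 : ℝ) < 1 by norm_num)] with t ht
  exact h t ht.1 ht.2

theorem mem_wall {v : V n} : v ∈ wallUnion D ↔ ∃ f, IsRt D f ∧ f v = 0 := by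
  unfold wallUnion
  simp only [Set.mem_iUnion]
  constructor
  · rintro ⟨α, hα, k, h⟩
    have h : ⟪α, v⟫ = (k : ℝ) := h
    exact ⟨_, ⟨α, hα, k, rfl⟩, by simp [h]⟩
  · rintro ⟨f, ⟨α, hα, k, rfl⟩, h⟩
    exact ⟨α, hα, k, show ⟪α, v⟫ = (k : ℝ) by linarith⟩

theorem fund_closed : IsClosed (fund D) := by
  have : fund D = ⋂ a : {a : V n → ℝ // IsSim D a}, {v | 0 ≤ a.1 v} := by
    ext v
    rw [mem_fund]
    simp [Set.mem_iInter]
  rw [this]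
  exact isClosed_iInter fun a => isClosed_le continuous_const a.2.isRt.continuous

/-- elements of the affine Weyl group as homeomorphisms -/
noncomputable def apH (z : AffW D) : V n ≃ₜ V n where
  toFun := ap z
  invFun := ap z⁻¹
  left_inv := fun v => by simp
  right_inv := fun v => by simp
  continuous_toFun := ap_cont z
  continuous_invFun := ap_cont z⁻¹

theorem actW_closure (z : AffW D) (A : Set (V n)) : actW z (closure A) = closure (actW z A) :=
  (apH z).image_closure A

theorem actW_closed (z : AffW D) {A : Set (V n)} (h : IsClosed A) : IsClosed (actW z A) :=
  (apH z).isClosed_image.2 h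

theorem comp_closure {v : V n} (hv : v ∉ wallUnion D) {g : AffW D} (hg : ap g v ∈ fund D) :
    closure (connectedComponentIn (wallUnion D)ᶜ v) = actW g⁻¹ (fund D) := by
  set C : Set (V n) := {u | ∀ a, IsSim D a → 0 < a (ap g u)} with hC
  have hvC : v ∈ C := fun a ha =>
    lt_of_le_of_ne (mem_fund.1 hg a ha) fun h => hv (mem_wall.2 ⟨_, ha.isRt.comp g, h.symm⟩)
  have hCw : C ⊆ (wallUnion D)ᶜ := by
    intro u hu hw
    obtain ⟨f, hf, h0⟩ := mem_wall.1 hw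
    obtain ⟨a, ha, h⟩ := fund_zero (hf.comp g⁻¹) (v := ap g u)
      (mem_fund.2 fun a ha => (hu a ha).le) (by simpa using h0)
    exact (hu a ha).ne' h
  have hconv : Convex ℝ C := by
    intro x hx y hy s t hs ht hst a ha
    have hs' : s = 1 - t := by linarith
    have := (ha.isRt.comp g).affine x y t
    rw [hs', this]
    have h1 := hx a ha
    have h2 := hy a ha
    rcases ht.eq_or_lt with rfl | ht
    · simpa using h1
    · have : 0 < t * a (ap g y) := mul_pos ht h2
      have : 0 ≤ (1 - t) * a (ap g x) := mul_nonneg (by linarith) h1.le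
      linarith
  have hcomp : connectedComponentIn (wallUnion D)ᶜ v = C := by
    apply Set.Subset.antisymm
    · intro w hw a ha
      by_contra hneg
      have hf := ha.isRt.comp g
      have := isPreconnected_connectedComponentIn.intermediate_value hw
        (mem_connectedComponentIn (show v ∈ (wallUnion D)ᶜ from hv)) hf.continuous.continuousOn
      obtain ⟨u, hu, h0⟩ := this ⟨not_lt.1 hneg, (hvC a ha).le⟩
      exact connectedComponentIn_subset _ _ hu (mem_wall.2 ⟨_, hf, h0⟩)
    · exact hconv.isPreconnected.subset_connectedComponentIn hvC hCw
  rw [hcomp]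
  apply Set.Subset.antisymm
  · refine closure_minimal (fun u hu => ?_) (actW_closed _ fund_closed)
    rw [mem_actW, inv_inv, mem_fund]
    exact fun a ha => (hu a ha).le
  · intro w hw
    rw [mem_actW, inv_inv] at hw
    refine seg_closure (u := v) fun t h0 h1 a ha => ?_
    have := (ha.isRt.comp g).affine w v t
    rw [this]
    have h2 := mul_pos h0 (hvC a ha)
    have h3 := mul_nonneg (sub_nonneg.2 h1) (mem_fund.1 hw a ha)
    linarith

theorem alcove_iff {c : Set (V n)} : IsAlcove D c ↔ ∃ z : AffW D, c = actW z (fund D) := by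
  constructor
  · rintro ⟨v, hv, rfl⟩
    obtain ⟨g, _, hg⟩ := exists_to_fund (D := D) v
    exact ⟨g⁻¹, comp_closure hv hg⟩
  · rintro ⟨z, rfl⟩
    have h : ap z (v0 D) ∉ wallUnion D := fun h => by
      obtain ⟨f, hf, h0⟩ := mem_wall.1 h
      exact rt_ne z hf h0
    refine ⟨ap z (v0 D), h, ?_⟩
    rw [comp_closure h (g := z⁻¹) (by simpa using v0_mem), inv_inv]

theorem face_iff {F : Set (V n)} : IsFace D F ↔ ∃ v, F = closure {w | ∀ f, IsRt D f →
    (f w = 0 ↔ f v = 0) ∧ (f w < 0 ↔ f v < 0)} := by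
  unfold IsFace
  refine exists_congr fun v => ?_
  have : {w | ∀ α ∈ D.Φ, ∀ k : ℤ, (⟪α, w⟫ = (k : ℝ) ↔ ⟪α, v⟫ = (k : ℝ)) ∧
      (⟪α, w⟫ < (k : ℝ) ↔ ⟪α, v⟫ < (k : ℝ))} = {w | ∀ f, IsRt D f →
    (f w = 0 ↔ f v = 0) ∧ (f w < 0 ↔ f v < 0)} := by
    ext w
    constructor
    · rintro h f ⟨α, hα, k, rfl⟩
      have := h α hα k
      simpa only [sub_eq_zero, sub_neg] using this
    · intro h α hα k
      have := h _ ⟨α, hα, k, rfl⟩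
      simpa only [sub_eq_zero, sub_neg] using this
  rw [this]

theorem face_act {F : Set (V n)} (h : IsFace D F) (z : AffW D) : IsFace D (actW z F) := by
  rw [face_iff] at *
  obtain ⟨v, rfl⟩ := h
  refine ⟨ap z v, ?_⟩
  rw [actW_closure]
  congr 1
  ext w
  rw [mem_actW]
  constructor
  · intro h f hf
    have := h _ (hf.comp z)
    simpa using this
  · intro h f hf
    have := h _ (hf.comp z⁻¹)
    simpa using this

theorem face_panel {s : AffW D} (hs : s ∈ SGen D) : IsFace D (fixedPanelType s) := by
  rw [face_iff]
  obtain ⟨q, hq, hu⟩ := panel_pt hs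
  have hq' := (mem_fixedPanel hs).1 hq
  refine ⟨q, Set.Subset.antisymm ?_ ?_⟩
  · intro w hw
    have hw' := (mem_fixedPanel hs).1 hw
    refine seg_closure (u := q) fun t h0 h1 f hf => ?_
    have e := hf.affine w q t
    rw [e]
    rcases lt_trichotomy (f q) 0 with h | h | h
    · have h2 : f w ≤ 0 := by
        rcases fund_sign hf with h' | h'
        · exact absurd (h' q hq'.1) (not_le.2 h)
        · exact h' w hw'.1
      have h3 := mul_pos_of_neg_of_neg h (neg_lt_zero.2 h0)
      have h4 := mul_nonneg (sub_nonneg.2 h1) (neg_nonneg.2 h2)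
      have : (1 - t) * f w + t * f q < 0 := by nlinarith
      exact ⟨⟨fun h => absurd h this.ne, fun h' => absurd h' h.ne⟩, ⟨fun _ => h, fun _ => this⟩⟩
    · have h2 : f w = 0 := by
        rcases hu f hf h with rfl | rfl
        · exact hw'.2
        · simp [hw'.2]
      simp [h, h2]
    · have h2 : 0 ≤ f w := by
        rcases fund_sign hf with h' | h'
        · exact h' w hw'.1
        · exact absurd (h' q hq'.1) (not_le.2 h)
      have h3 := mul_pos h0 h
      have h4 := mul_nonneg (sub_nonneg.2 h1) h2
      have : 0 < (1 - t) * f w + t * f q := by linarith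
      exact ⟨⟨fun h => absurd h this.ne', fun h' => absurd h' h.ne'⟩,
        ⟨fun h' => absurd h' (not_lt.2 this.le), fun h' => absurd h' (not_lt.2 h.le)⟩⟩
  · have hcl : IsClosed (fixedPanelType s) := by
      have : fixedPanelType s = fund D ∩ {v | ρ s v = 0} := by
        ext v; exact mem_fixedPanel hs
      rw [this]
      exact fund_closed.inter (isClosed_eq (ρ_rt hs).continuous continuous_const)
    refine closure_minimal (fun w hw => ?_) hcl
    rw [mem_fixedPanel hs, mem_fund]
    refine ⟨fun a ha => ?_, (hw _ (ρ_rt hs)).1.2 hq'.2⟩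
    by_contra hneg
    exact absurd ((hw a ha.isRt).2.1 (not_le.1 hneg)) (not_lt.2 (mem_fund.1 hq'.1 a ha))

theorem mem_hyp {H : Set (V n)} : H ∈ hyperplanes D ↔ ∃ f, IsRt D f ∧ H = {v | f v = 0} := by
  have e : ∀ (α : V n) (k : ℤ), Hy α (k : ℝ) = {v | ⟪α, v⟫ - (k : ℝ) = 0} := by
    intro α k
    ext v
    simp [Hy, sub_eq_zero]
  constructor
  · rintro ⟨α, hα, k, rfl⟩
    exact ⟨_, ⟨α, hα, k, rfl⟩, e α k⟩
  · rintro ⟨f, ⟨α, hα, k, rfl⟩, rfl⟩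
    exact ⟨α, hα, k, (e α k).symm⟩

theorem panel_act {s : AffW D} (hs : s ∈ SGen D) (z : AffW D) :
    IsPanelOf D (actW z (fixedPanelType s)) (actW z (fund D)) := by
  obtain ⟨q, hq, hu⟩ := panel_pt hs
  have hH : {v | ρ s (ap z⁻¹ v) = 0} ∈ hyperplanes D := mem_hyp.2 ⟨_, (ρ_rt hs).comp z⁻¹, rfl⟩
  have he : actW z (fixedPanelType s) = actW z (fund D) ∩ {v | ρ s (ap z⁻¹ v) = 0} := by
    ext v
    rw [mem_actW, mem_fixedPanel hs, Set.mem_inter_iff, mem_actW]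
    rfl
  refine ⟨alcove_iff.2 ⟨z, rfl⟩, face_act (face_panel hs) z, ⟨_, hH, he⟩,
    ⟨_, ⟨hH, he.subset.trans Set.inter_subset_right⟩, ?_⟩⟩
  rintro H ⟨hH', hsub⟩
  obtain ⟨f, hf, rfl⟩ := mem_hyp.1 hH'
  have h1 : f (ap z q) = 0 := hsub ⟨q, hq, rfl⟩
  ext v
  rcases hu _ (hf.comp z) h1 with h | h
  · have := congrFun h (ap z⁻¹ v)
    simp only [ap_ap_inv] at this
    show f v = 0 ↔ ρ s (ap z⁻¹ v) = 0
    rw [this]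
  · have := congrFun h (ap z⁻¹ v)
    simp only [ap_ap_inv, Pi.neg_apply] at this
    show f v = 0 ↔ ρ s (ap z⁻¹ v) = 0
    rw [this, neg_eq_zero]

theorem actW_mul (g h : AffW D) (A : Set (V n)) : actW (g * h) A = actW g (actW h A) := by
  simp only [actW_eq, Set.image_image]
  rfl

theorem panel_mul {s : AffW D} (z : AffW D) :
    actW (z * s) (fixedPanelType s) = actW z (fixedPanelType s) := by
  rw [actW_mul]
  congr 1
  have : ∀ v ∈ fixedPanelType s, ap s v = v := fun v hv => hv.2
  rw [actW_eq, Set.image_congr this, Set.image_id']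

theorem act_rigid {F : Set (V n)} (hF : F ⊆ fund D) {x z : AffW D}
    (h : actW x F ⊆ actW z (fund D)) : actW x F = actW z F := by
  refine Set.image_congr fun v hv => ?_
  have h1 : ap x v ∈ actW z (fund D) := h ⟨v, hv, rfl⟩
  rw [mem_actW, ← ap_mul] at h1
  have h2 := congrArg (ap z) (strict_dom _ (hF hv) h1)
  rw [ap_mul, ap_ap_inv] at h2
  exact h2

theorem panel_stab {s z z' : AffW D} (hs : s ∈ SGen D)
    (h : actW z (fixedPanelType s) ⊆ actW z' (fund D)) : z' = z ∨ z' = z * s := by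
  obtain ⟨q, hq, hu⟩ := panel_pt hs
  have h1 : ap z q ∈ actW z' (fund D) := h ⟨q, hq, rfl⟩
  rw [mem_actW, ← ap_mul] at h1
  have h2 := strict_dom _ hq.1 h1
  rcases stab_panel hs hq.1 hu h2 with h3 | h3
  · left
    exact inv_mul_eq_one.1 h3
  · right
    have : z = z' * s := by rw [← h3]; simp
    rw [this, mul_assoc, s_sq hs, mul_one]

theorem act_inj {z z' : AffW D} (h : actW z (fund D) = actW z' (fund D)) : z = z' := by
  have h1 : ap z (v0 D) ∈ actW z' (fund D) := h ▸ ⟨_, v0_mem, rfl⟩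
  rw [mem_actW, ← ap_mul] at h1
  exact (inv_mul_eq_one.1 (eq_one_of_mem h1)).symm

theorem s_ne {s : AffW D} (hs : s ∈ SGen D) : s ≠ 1 := by
  rintro rfl
  have h1 := ρ_pos hs
  have h2 := ρ_neg hs (v0 D)
  simp only [ap_one] at h2
  linarith

theorem PR_path {P : AffW D → AffW D → Prop} (l : List (AffW D)) (z x : AffW D) :
    PR P l z x ↔ ∃ Z : ℕ → AffW D, Z 0 = z ∧ Z l.length = x ∧
      ∀ i (h : i < l.length), stepR P (l.get ⟨i, h⟩) (Z i) (Z (i + 1)) := by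
  induction l generalizing z with
  | nil =>
    constructor
    · intro h
      exact ⟨fun _ => z, rfl, h, fun i h => absurd h (by simp)⟩
    · rintro ⟨Z, rfl, h, _⟩
      exact h
  | cons s l ih =>
    constructor
    · rintro ⟨m, h1, h2⟩
      obtain ⟨Z, rfl, h3, h4⟩ := (ih m).1 h2
      refine ⟨fun i => Nat.casesOn i z Z, rfl, h3, ?_⟩
      intro i h
      cases i with
      | zero => exact h1
      | succ i => exact h4 i (by simpa using h)
    · rintro ⟨Z, rfl, h3, h4⟩
      refine ⟨Z 1, h4 0 (by simp), (ih _).2 ⟨fun i => Z (i + 1), rfl, h3, fun i h => ?_⟩⟩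
      exact h4 (i + 1) (by simpa using h)

theorem gallery_iff {φ : Set (V n) → Set (V n) → Prop} {l : List (AffW D)}
    (hl : ∀ s ∈ l, s ∈ SGen D) {σ0 τ : Set (V n)} (hσ0 : IsFace D σ0)
    (hτ : IsFace D τ) (hτf : τ ⊆ fund D) (x : AffW D) :
    (∃ γ : PreGallery n, IsGallery D γ ∧ γ.p 0 = σ0 ∧ γ.c γ.len = actW x (fund D) ∧
      HasWordType D γ σ0 l τ ∧ PositivelyFolded φ γ) ↔
    ∃ z : AffW D, σ0 ⊆ actW z (fund D) ∧
      PR (fun g s => φ (actW g (fund D)) (actW g (fixedPanelType s))) l z x := by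
  constructor
  · rintro ⟨⟨L, p, c⟩, ⟨h1, h2, h3, h4⟩, h5, h6, ⟨h7, h8, h9, h10⟩, h11⟩
    simp only at *
    subst h7
    have hz : ∀ i, ∃ z : AffW D, i ≤ l.length → c i = actW z (fund D) := by
      intro i
      by_cases hi : i ≤ l.length
      · obtain ⟨z, hz⟩ := alcove_iff.1 (h1 i hi)
        exact ⟨z, fun _ => hz⟩
      · exact ⟨1, fun h => absurd h hi⟩
    choose Z hZ using hz
    refine ⟨Z 0, ?_, (PR_path _ _ _).2 ⟨Z, rfl, act_inj ?_, fun i hi => ?_⟩⟩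
    · rw [← hZ 0 (Nat.zero_le _), ← h5]; exact h2.2
    · rw [← hZ _ le_rfl, h6]
    · have hs := hl _ (List.get_mem l ⟨i, hi⟩)
      obtain ⟨g, hg, hp⟩ := h10 i hi
      generalize l.get ⟨i, hi⟩ = s at *
      obtain ⟨ha, hb⟩ := h4 (i + 1) (by omega) hi
      simp only [Nat.add_sub_cancel] at ha
      have hc := h11 (i + 1) (by omega) hi
      simp only [Nat.add_sub_cancel] at hc
      rw [hZ i hi.le] at ha hc
      rw [hZ (i + 1) hi] at hb hc
      have hsub : ∀ {u}, IsPanelOf D (p (i + 1)) u → p (i + 1) ⊆ u := by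
        rintro u ⟨_, _, ⟨H, _, h⟩, _⟩
        rw [h]; exact Set.inter_subset_left
      have ha' := hsub ha
      have hb' := hsub hb
      have hp' : p (i + 1) = actW (⟨g, hg⟩ : AffW D) (fixedPanelType s) := hp
      have hfs : fixedPanelType s ⊆ fund D := Set.inter_subset_left
      rw [hp', act_rigid hfs (hp' ▸ ha')] at hb' hc
      rcases panel_stab hs hb' with h | h
      · right
        rw [h] at hc
        exact ⟨h, hc rfl⟩
      · left; exact h
  · rintro ⟨z, hz, hPR⟩
    obtain ⟨Z, rfl, hx, hstep⟩ := (PR_path _ _ _).1 hPR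
    let p : ℕ → Set (V n) := fun j => Nat.casesOn j σ0 fun i =>
      if h : i < l.length then actW (Z i) (fixedPanelType (l.get ⟨i, h⟩)) else actW x τ
    have hp : ∀ i (h : i < l.length), p (i + 1) = actW (Z i) (fixedPanelType (l.get ⟨i, h⟩)) :=
      fun i h => dif_pos h
    have hpl : p (l.length + 1) = actW x τ := dif_neg (lt_irrefl _)
    refine ⟨⟨l.length, p, fun i => actW (Z i) (fund D)⟩,
      ⟨fun i _ => alcove_iff.2 ⟨_, rfl⟩, ⟨hσ0, hz⟩, ⟨?_, ?_⟩, ?_⟩, rfl, ?_,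
      ⟨rfl, ⟨1, one_mem _, ?_⟩, ⟨x, x.2, hpl⟩, fun i h => ⟨Z i, (Z i).2, hp i h⟩⟩, ?_⟩
    · show IsFace D (p (l.length + 1))
      rw [hpl]; exact face_act hτ x
    · show p (l.length + 1) ⊆ actW (Z l.length) (fund D)
      rw [hpl, hx]
      exact Set.image_mono hτf
    · intro i hi1 hi
      obtain ⟨i, rfl⟩ : ∃ j, i = j + 1 := ⟨i - 1, by omega⟩
      have hi : i < l.length := hi
      show IsPanelOf D (p (i + 1)) (actW (Z i) (fund D)) ∧
        IsPanelOf D (p (i + 1)) (actW (Z (i + 1)) (fund D))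
      have hs := hl _ (List.get_mem l ⟨i, hi⟩)
      have hst := hstep i hi
      rw [hp i hi]
      refine ⟨panel_act hs _, ?_⟩
      rcases hst with h | ⟨h, _⟩
      · rw [h, ← panel_mul]
        exact panel_act hs _
      · rw [h]; exact panel_act hs _
    · show actW (Z l.length) (fund D) = _
      rw [hx]
    · show σ0 = _
      simp
    · intro i hi1 hi hfold
      obtain ⟨i, rfl⟩ : ∃ j, i = j + 1 := ⟨i - 1, by omega⟩
      have hi : i < l.length := hi
      have hfold := act_inj (show actW (Z i) (fund D) = actW (Z (i + 1)) (fund D) from hfold)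
      show φ (actW (Z (i + 1)) (fund D)) (p (i + 1))
      have hs := hl _ (List.get_mem l ⟨i, hi⟩)
      rw [hp i hi, ← hfold]
      rcases hstep i hi with h | ⟨_, h⟩
      · rw [← hfold] at h
        exact absurd (left_eq_mul.1 h) (s_ne hs)
      · exact h

end Chim

/-- Proposition: chimney-induced orientations are braid-invariant. -/
theorem chimneyOrient_braidInvariant {n : ℕ} (D : RootData n)
    (J : Set (Fin n)) (y : AffW D) (w0 : Equiv.Perm (V n)) (hw0 : IsLongest D w0)
    (w : AffW D) (l l' : List (AffW D))
    (hl : IsReducedWord D l w) (hl' : IsReducedWord D l' w)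
    (σ0 τ : Set (V n)) (hσ0 : IsFace D σ0) (hσ0f : σ0 ⊆ fund D)
    (hτ : IsFace D τ) (hτf : τ ⊆ fund D)
    (x : AffW D) :
    (∃ γ : PreGallery n, IsGallery D γ ∧ γ.p 0 = σ0 ∧ γ.c γ.len = actW x (fund D) ∧
      HasWordType D γ σ0 l τ ∧ PositivelyFolded (chimneyOrient D J w0 y) γ) ↔
    (∃ γ : PreGallery n, IsGallery D γ ∧ γ.p 0 = σ0 ∧ γ.c γ.len = actW x (fund D) ∧
      HasWordType D γ σ0 l' τ ∧ PositivelyFolded (chimneyOrient D J w0 y) γ) := by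
  rw [Chim.gallery_iff hl.1 hσ0 hτ hτf, Chim.gallery_iff hl'.1 hσ0 hτ hτf]
  refine exists_congr fun z => and_congr_right fun _ => ?_
  exact Chim.PR_main (fun M => Chim.ap y (Chim.b0 D J M))
    (fun g s hs => Chim.orient_eventually hw0 y g s hs)
    (Chim.Minl.of_reduced hl) (Chim.Minl.of_reduced hl') (hl.2.1.trans hl'.2.1.symm) z x
end

section
/- For every λ ∈ R^∨, the shadow of λ with respect to the orientation φ_{id} induced by the fundamental alcove 𝐚_f equals the W₀-orbit of λ: Sh_{𝐚_f}(λ) = W₀·λ. -/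
open scoped RealInnerProductSpace
open scoped Classical

namespace ShadowProof

variable {n : ℕ}

lemma inner_coroot (α β : V n) : ⟪β, coroot α⟫ = 2 * ⟪α, β⟫ / ⟪α, α⟫ := by
  unfold coroot
  rw [real_inner_smul_right, real_inner_comm α β]; ring

lemma inner_self_pos (D : RootData n) {α : V n} (h : α ∈ D.Φ) : 0 < ⟪α, α⟫ :=
  real_inner_self_pos.2 (D.nonzero α h)

lemma inner_sRefl (α β v : V n) (k : ℝ) :
    ⟪β, sRefl α k v⟫ = ⟪β, v⟫ - (⟪α, v⟫ - k) * (2 * ⟪α, β⟫ / ⟪α, α⟫) := by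
  unfold sRefl
  rw [inner_sub_right, real_inner_smul_right, inner_coroot]

lemma inner_sRefl_self (D : RootData n) {α : V n} (h : α ∈ D.Φ) (v : V n) (k : ℝ) :
    ⟪α, sRefl α k v⟫ - k = -(⟪α, v⟫ - k) := by
  rw [inner_sRefl]
  have := (inner_self_pos D h).ne'
  field_simp; ring

lemma sRefl_fix {α v : V n} {k : ℝ} (h : ⟪α, v⟫ = k) : sRefl α k v = v := by
  simp [sRefl, h]

lemma sRefl_invol (D : RootData n) {α : V n} (h : α ∈ D.Φ) (k : ℝ) :
    Function.Involutive (sRefl α k) := by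
  intro v
  have h1 := inner_sRefl_self D h v k
  conv_lhs => unfold sRefl
  change sRefl α k v - (⟪α, sRefl α k v⟫ - k) • coroot α = v
  rw [h1]; unfold sRefl; module

lemma sRefl_neg (α : V n) (k : ℝ) : sRefl (-α) (-k) = sRefl α k := by
  funext v
  simp only [sRefl, coroot, inner_neg_left, inner_neg_right, neg_neg]
  module

/-- The reflection as a permutation. -/
noncomputable def sP (D : RootData n) {α : V n} (h : α ∈ D.Φ) (k : ℝ) : Equiv.Perm (V n) :=
  (sRefl_invol D h k).toPerm

lemma sP_coe (D : RootData n) {α : V n} (h : α ∈ D.Φ) (k : ℝ) : ⇑(sP D h k) = sRefl α k := rfl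

lemma sP_mem (D : RootData n) {α : V n} (h : α ∈ D.Φ) (k : ℤ) : sP D h k ∈ AffW D :=
  Subgroup.subset_closure ⟨α, h, k, rfl⟩

lemma sRefl_cont (α : V n) (k : ℝ) : Continuous (sRefl α k) := by
  unfold sRefl; fun_prop

/-- Half of goodness. -/
def Good (D : RootData n) (e : Equiv.Perm (V n)) : Prop :=
  Continuous e ∧ ∀ α ∈ D.Φ, ∀ k : ℤ, ∃ β ∈ D.Φ, ∃ m : ℤ,
    (∀ w, ⟪α, e w⟫ - (k : ℝ) = ⟪β, w⟫ - (m : ℝ)) ∧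
    (∀ w, e (sRefl β m w) = sRefl α k (e w))

lemma good_refl (D : RootData n) (e : Equiv.Perm (V n)) {γ : V n} (hγ : γ ∈ D.Φ) (j : ℤ)
    (he : ⇑e = sRefl γ j) : Good D e := by
  refine ⟨he ▸ sRefl_cont _ _, fun α hα k => ?_⟩
  obtain ⟨z, hz⟩ := D.crystallographic γ hγ α hα
  have hg := (inner_self_pos D hγ).ne'
  have hr := D.reflect_mem γ hγ α hα
  have hz' : 2 * ⟪γ, α⟫ = z * ⟪γ, γ⟫ := by field_simp at hz; linarith
  rw [hz] at hr
  have hgb : ⟪γ, α - (z : ℝ) • γ⟫ = -⟪γ, α⟫ := by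
    rw [inner_sub_right, real_inner_smul_right]; linarith
  have hbb : ⟪α - (z : ℝ) • γ, α - (z : ℝ) • γ⟫ = ⟪α, α⟫ := by
    rw [inner_sub_left, real_inner_smul_left, hgb, inner_sub_right, real_inner_smul_right,
      real_inner_comm γ α]; ring
  have key : ∀ w, ⟪α, e w⟫ - (k : ℝ) = ⟪α - (z : ℝ) • γ, w⟫ - ((k - j * z : ℤ) : ℝ) := by
    intro w
    rw [he, inner_sRefl, hz, inner_sub_left, real_inner_smul_left]; push_cast; ring
  refine ⟨α - (z : ℝ) • γ, hr, k - j * z, key, fun w => ?_⟩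
  have h1 : sRefl α k (e w) = e w - (⟪α - (z : ℝ) • γ, w⟫ - ((k - j * z : ℤ) : ℝ)) • coroot α := by
    rw [← key]; rfl
  rw [h1]
  generalize hm : ((k - j * z : ℤ) : ℝ) = m
  have h2 : sRefl (α - (z : ℝ) • γ) m w =
    w - (⟪α - (z : ℝ) • γ, w⟫ - m) • coroot (α - (z : ℝ) • γ) := rfl
  rw [h2]
  generalize ⟪α - (z : ℝ) • γ, w⟫ - m = t
  rw [he]
  have hc : coroot (α - (z : ℝ) • γ) = coroot α - (2 / ⟪α, α⟫ * z) • γ := by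
    unfold coroot; rw [hbb]; module
  have hd : ⟪γ, coroot (α - (z : ℝ) • γ)⟫ = - (2 / ⟪α, α⟫ * ⟪γ, α⟫) := by
    unfold coroot; rw [hbb, real_inner_smul_right, hgb]; ring
  unfold sRefl
  rw [inner_sub_right, real_inner_smul_right, hd, hc]
  have h3 : coroot γ = (2 / ⟪γ, γ⟫) • γ := rfl
  have h4 : (2 / ⟪α, α⟫ * ⟪γ, α⟫) • coroot γ = (2 / ⟪α, α⟫ * z) • γ := by
    rw [h3, smul_smul]; congr 1
    rw [← hz]; ring
  have h5 : w - t • (coroot α - (2 / ⟪α, α⟫ * z) • γ) -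
      (⟪γ, w⟫ - t * -(2 / ⟪α, α⟫ * ⟪γ, α⟫) - j) • coroot γ =
      w - t • (coroot α - (2 / ⟪α, α⟫ * z) • γ) - (⟪γ, w⟫ - j) • coroot γ
       - t • ((2 / ⟪α, α⟫ * ⟪γ, α⟫) • coroot γ) := by module
  rw [h5, h4]; module

lemma good_mul {D : RootData n} {a b : Equiv.Perm (V n)} (ha : Good D a) (hb : Good D b) :
    Good D (a * b) := by
  refine ⟨ha.1.comp hb.1, fun α hα k => ?_⟩
  obtain ⟨β, hβ, m, h1, h2⟩ := ha.2 α hα k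
  obtain ⟨δ, hδ, l, h3, h4⟩ := hb.2 β hβ m
  refine ⟨δ, hδ, l, fun w => ?_, fun w => ?_⟩
  · rw [Equiv.Perm.mul_apply, h1, h3]
  · rw [Equiv.Perm.mul_apply, Equiv.Perm.mul_apply, h4, h2]

lemma good_both (D : RootData n) {e : Equiv.Perm (V n)} (he : e ∈ AffW D) :
    Good D e ∧ Good D e⁻¹ := by
  unfold AffW at he
  induction he using Subgroup.closure_induction with
  | mem x hx =>
    obtain ⟨α, hα, k, h⟩ := hx
    have h2 : x⁻¹ = x := by
      have : x = sP D hα k := by ext1 v; rw [h]; rfl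
      rw [this]; rfl
    rw [h2]
    exact ⟨good_refl D x hα k h, good_refl D x hα k h⟩
  | one =>
    rw [inv_one]
    have : Good D (1 : Equiv.Perm (V n)) :=
      ⟨continuous_id, fun α hα k => ⟨α, hα, k, fun _ => rfl, fun _ => rfl⟩⟩
    exact ⟨this, this⟩
  | mul x y _ _ hx hy => rw [mul_inv_rev]; exact ⟨good_mul hx.1 hy.1, good_mul hy.2 hx.2⟩
  | inv x _ hx => rw [inv_inv]; exact ⟨hx.2, hx.1⟩

lemma good (D : RootData n) {e : Equiv.Perm (V n)} (he : e ∈ AffW D) : Good D e :=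
  (good_both D he).1

lemma finW_le (D : RootData n) : FinW D ≤ AffW D := by
  refine Subgroup.closure_mono ?_
  rintro e ⟨α, hα, h⟩
  exact ⟨α, hα, 0, by simpa using h⟩

lemma finW_zero (D : RootData n) {e : Equiv.Perm (V n)} (he : e ∈ FinW D) : e 0 = 0 := by
  unfold FinW at he
  induction he using Subgroup.closure_induction with
  | mem x hx =>
    obtain ⟨α, hα, h⟩ := hx
    rw [h]; simp [sRefl]
  | one => rfl
  | mul x y _ _ hx hy => rw [Equiv.Perm.mul_apply, hy, hx]
  | inv x _ hx => rw [Equiv.Perm.inv_eq_iff_eq, hx]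

/-- Regular points. -/
def Reg (D : RootData n) (u : V n) : Prop := ∀ α ∈ D.Φ, ∀ k : ℤ, ⟪α, u⟫ ≠ (k : ℝ)

/-- Closed cell. -/
def cell (D : RootData n) (u : V n) : Set (V n) :=
  {w | ∀ α ∈ D.Φ, ∀ k : ℤ, ⟪α, u⟫ < k → ⟪α, w⟫ ≤ k}

/-- Open cell. -/
def ocell (D : RootData n) (u : V n) : Set (V n) :=
  {w | ∀ α ∈ D.Φ, ∀ k : ℤ, ⟪α, u⟫ < k → ⟪α, w⟫ < k}

lemma cell_ge {D : RootData n} {u w : V n} (hw : w ∈ cell D u) {α : V n} (hα : α ∈ D.Φ) {k : ℤ}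
    (h : (k : ℝ) < ⟪α, u⟫) : (k : ℝ) ≤ ⟪α, w⟫ := by
  have := hw (-α) (D.neg_mem α hα) (-k) (by rw [inner_neg_left]; push_cast; linarith)
  rw [inner_neg_left] at this; push_cast at this; linarith

lemma ocell_gt {D : RootData n} {u w : V n} (hw : w ∈ ocell D u) {α : V n} (hα : α ∈ D.Φ) {k : ℤ}
    (h : (k : ℝ) < ⟪α, u⟫) : (k : ℝ) < ⟪α, w⟫ := by
  have := hw (-α) (D.neg_mem α hα) (-k) (by rw [inner_neg_left]; push_cast; linarith)
  rw [inner_neg_left] at this; push_cast at this; linarith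

lemma self_mem_cell (D : RootData n) (u : V n) : u ∈ cell D u := fun _ _ _ h => h.le

lemma cell_eq {D : RootData n} {u u' : V n} (hu : Reg D u) (h : u' ∈ ocell D u) :
    cell D u = cell D u' := by
  ext w
  constructor
  · intro hw α hα k hk
    rcases lt_or_gt_of_ne (hu α hα k) with h1 | h1
    · exact hw α hα k h1
    · exact absurd (ocell_gt h hα h1) (not_lt.2 hk.le)
  · intro hw α hα k hk
    exact hw α hα k (h α hα k hk)

lemma closure_ocell (D : RootData n) (u : V n) : closure (ocell D u) = cell D u := by
  apply Set.Subset.antisymm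
  · apply closure_minimal
    · intro w hw α hα k hk; exact (hw α hα k hk).le
    · have : cell D u = ⋂ α ∈ D.Φ, ⋂ k : ℤ, ⋂ (_ : ⟪α, u⟫ < k), {w | ⟪α, w⟫ ≤ (k : ℝ)} := by
        ext w; simp [cell]
      rw [this]
      refine isClosed_biInter fun α _ => isClosed_iInter fun k => isClosed_iInter fun _ => ?_
      exact isClosed_le (by fun_prop) continuous_const
  · intro w hw
    have hlim : Filter.Tendsto (fun t : ℝ => w + t • (u - w)) (nhdsWithin 0 (Set.Ioi 0))
        (nhds w) := by
      have : Continuous (fun t : ℝ => w + t • (u - w)) := by fun_prop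
      have h2 := this.tendsto 0
      simp only [zero_smul, add_zero] at h2
      exact h2.mono_left nhdsWithin_le_nhds
    refine mem_closure_of_tendsto hlim ?_
    filter_upwards [Ioo_mem_nhdsGT (show (0 : ℝ) < 1 by norm_num)] with t ht α hα k hk
    have h1 := hw α hα k hk
    rw [inner_add_right, real_inner_smul_right, inner_sub_right]
    nlinarith [ht.1, ht.2, mul_pos ht.1 (sub_pos.2 hk),
      mul_nonneg (sub_nonneg.2 ht.2.le) (sub_nonneg.2 h1)]

lemma component_eq (D : RootData n) {u : V n} (hu : Reg D u) :
    connectedComponentIn (wallUnion D)ᶜ u = ocell D u := by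
  have hmem : ∀ w, w ∈ (wallUnion D)ᶜ ↔ Reg D w := by
    intro w; simp [wallUnion, Hy, Reg]
  apply Set.Subset.antisymm
  · intro w hw α hα k hk
    by_contra hcon
    have hpc : IsPreconnected (connectedComponentIn (wallUnion D)ᶜ u) :=
      isPreconnected_connectedComponentIn
    have himg := hpc.image (fun v => ⟪α, v⟫) (by fun_prop)
    have huc : u ∈ connectedComponentIn (wallUnion D)ᶜ u :=
      mem_connectedComponentIn ((hmem u).2 hu)
    have := himg.ordConnected.out ⟨u, huc, rfl⟩ ⟨w, hw, rfl⟩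
      (show (k : ℝ) ∈ Set.Icc ⟪α, u⟫ ⟪α, w⟫ from ⟨hk.le, not_lt.1 hcon⟩)
    obtain ⟨v, hv, hvk⟩ := this
    exact (hmem v).1 (connectedComponentIn_subset _ _ hv) α hα k hvk
  · apply IsPreconnected.subset_connectedComponentIn
    · have : ocell D u = ⋂ α ∈ D.Φ, ⋂ k : ℤ, ⋂ (_ : ⟪α, u⟫ < k), {w | ⟪α, w⟫ < (k : ℝ)} := by
        ext w; simp [ocell]
      rw [this]
      apply Convex.isPreconnected
      refine convex_iInter₂ fun α _ => convex_iInter fun k => convex_iInter fun _ => ?_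
      exact convex_halfSpace_lt (innerₛₗ ℝ α).isLinear _
    · intro α hα k hk; exact hk
    · intro w hw
      rw [hmem]
      intro α hα k
      rcases lt_or_gt_of_ne (hu α hα k) with h1 | h1
      · exact (hw α hα k h1).ne
      · exact (ocell_gt hw hα h1).ne'

lemma alcove_iff (D : RootData n) (c : Set (V n)) :
    IsAlcove D c ↔ ∃ u, Reg D u ∧ c = cell D u := by
  have hmem : ∀ w, w ∈ (wallUnion D)ᶜ ↔ Reg D w := by
    intro w; simp [wallUnion, Hy, Reg]
  unfold IsAlcove
  constructor
  · rintro ⟨u, hu, rfl⟩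
    rw [hmem] at hu
    exact ⟨u, hu, by rw [component_eq D hu, closure_ocell]⟩
  · rintro ⟨u, hu, rfl⟩
    exact ⟨u, (hmem u).2 hu, by rw [component_eq D hu, closure_ocell]⟩

lemma reg_map {D : RootData n} {e : Equiv.Perm (V n)} (he : e ∈ AffW D) {u : V n}
    (hu : Reg D u) : Reg D (e u) := by
  intro α hα k h
  obtain ⟨β, hβ, m, h1, -⟩ := (good D he).2 α hα k
  have := h1 u
  exact hu β hβ m (by linarith)

lemma mem_cell_map {D : RootData n} {e : Equiv.Perm (V n)} (he : e ∈ AffW D) {u w : V n}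
    (hw : w ∈ cell D u) : e w ∈ cell D (e u) := by
  intro α hα k h
  obtain ⟨β, hβ, m, h1, -⟩ := (good D he).2 α hα k
  have h2 := h1 u
  have h3 := h1 w
  have := hw β hβ m (by linarith)
  linarith

lemma image_cell {D : RootData n} {e : Equiv.Perm (V n)} (he : e ∈ AffW D) (u : V n) :
    e '' cell D u = cell D (e u) := by
  apply Set.Subset.antisymm
  · rintro _ ⟨w, hw, rfl⟩; exact mem_cell_map he hw
  · intro w hw
    refine ⟨e⁻¹ w, ?_, by simp⟩
    have := mem_cell_map ((AffW D).inv_mem he) hw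
    simpa using this

lemma alcove_map {D : RootData n} {e : Equiv.Perm (V n)} (he : e ∈ AffW D) {c : Set (V n)}
    (hc : IsAlcove D c) : IsAlcove D (e '' c) := by
  rw [alcove_iff] at hc ⊢
  obtain ⟨u, hu, rfl⟩ := hc
  exact ⟨e u, reg_map he hu, image_cell he u⟩

lemma hyp_map {D : RootData n} {e : Equiv.Perm (V n)} (he : e ∈ AffW D) {H : Set (V n)}
    (hH : H ∈ hyperplanes D) : e '' H ∈ hyperplanes D := by
  obtain ⟨α, hα, k, rfl⟩ := hH
  obtain ⟨β, hβ, m, h1, -⟩ := (good D ((AffW D).inv_mem he)).2 α hα k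
  refine ⟨β, hβ, m, ?_⟩
  ext w
  rw [Set.mem_image_equiv]
  change ⟪α, e⁻¹ w⟫ = _ ↔ ⟪β, w⟫ = _
  rw [← sub_eq_zero, h1, sub_eq_zero]

lemma image_inv_image (e : Equiv.Perm (V n)) (A : Set (V n)) : ⇑e⁻¹ '' (e '' A) = A := by
  rw [← Set.image_comp]; simp

lemma image_image_inv (e : Equiv.Perm (V n)) (A : Set (V n)) : e '' (⇑e⁻¹ '' A) = A := by
  rw [← Set.image_comp]; simp

lemma image_mul (a b : Equiv.Perm (V n)) (A : Set (V n)) :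
    ⇑(a * b) '' A = a '' (b '' A) := by
  rw [← Set.image_comp]; rfl

/-- Permutation as homeomorphism. -/
noncomputable def homeo {D : RootData n} {e : Equiv.Perm (V n)} (he : e ∈ AffW D) : V n ≃ₜ V n where
  toEquiv := e
  continuous_toFun := (good D he).1
  continuous_invFun := (good D ((AffW D).inv_mem he)).1

lemma face_map {D : RootData n} {e : Equiv.Perm (V n)} (he : e ∈ AffW D) {F : Set (V n)}
    (hF : IsFace D F) : IsFace D (e '' F) := by
  obtain ⟨v, rfl⟩ := hF
  refine ⟨e v, ?_⟩
  have h0 := (homeo he).image_closure {w | ∀ α ∈ D.Φ, ∀ k : ℤ,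
    (⟪α, w⟫ = (k : ℝ) ↔ ⟪α, v⟫ = (k : ℝ)) ∧ (⟪α, w⟫ < (k : ℝ) ↔ ⟪α, v⟫ < (k : ℝ))}
  refine h0.trans ?_
  congr 1
  change e '' _ = _
  ext w
  rw [Set.mem_image_equiv]
  change (∀ α ∈ D.Φ, ∀ k : ℤ, (⟪α, e⁻¹ w⟫ = _ ↔ _) ∧ (⟪α, e⁻¹ w⟫ < _ ↔ _)) ↔ _
  constructor
  · intro h α hα k
    obtain ⟨β, hβ, m, h1, -⟩ := (good D he).2 α hα k
    have h2 := h1 v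
    have h3 := h1 (e⁻¹ w)
    rw [show e (e⁻¹ w) = w by simp] at h3
    obtain ⟨h4, h5⟩ := h β hβ m
    rw [← sub_eq_zero, ← sub_eq_zero (b := (m : ℝ)), ← h2, ← h3] at h4
    rw [← sub_neg, ← sub_neg (b := (m : ℝ)), ← h2, ← h3] at h5
    exact ⟨by rw [← sub_eq_zero, h4, sub_eq_zero], by rw [← sub_neg, h5, sub_neg]⟩
  · intro h α hα k
    obtain ⟨β, hβ, m, h1, -⟩ := (good D ((AffW D).inv_mem he)).2 α hα k
    have h2 := h1 w
    have h3 := h1 (e v)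
    rw [show e⁻¹ (e v) = v by simp] at h3
    obtain ⟨h4, h5⟩ := h β hβ m
    rw [← sub_eq_zero, ← sub_eq_zero (b := (m : ℝ)), ← h2, ← h3] at h4
    rw [← sub_neg, ← sub_neg (b := (m : ℝ)), ← h2, ← h3] at h5
    exact ⟨by rw [← sub_eq_zero, h4, sub_eq_zero], by rw [← sub_neg, h5, sub_neg]⟩

lemma panel_map {D : RootData n} {e : Equiv.Perm (V n)} (he : e ∈ AffW D) {p c : Set (V n)}
    (h : IsPanelOf D p c) : IsPanelOf D (e '' p) (e '' c) := by
  obtain ⟨h1, h2, ⟨H, hH, h3⟩, K, ⟨hK, hpK⟩, hu⟩ := h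
  refine ⟨alcove_map he h1, face_map he h2, ⟨e '' H, hyp_map he hH, ?_⟩, e '' K,
    ⟨hyp_map he hK, Set.image_mono hpK⟩, ?_⟩
  · rw [h3, Set.image_inter e.injective]
  · rintro K' ⟨hK', hp'⟩
    have h4 := hu (⇑e⁻¹ '' K') ⟨hyp_map ((AffW D).inv_mem he) hK', by
      rw [← image_inv_image e p]; exact Set.image_mono hp'⟩
    rw [← h4, image_image_inv]

/-- Equal hyperplanes have equal data up to sign. -/
lemma hy_eq (D : RootData n) {α β : V n} (hα : α ∈ D.Φ) (hβ : β ∈ D.Φ) {k m : ℝ}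
    (h : Hy β m = Hy α k) : (β = α ∧ m = k) ∨ (β = -α ∧ m = -k) := by
  have ha := (inner_self_pos D hα).ne'
  have hw : ∀ w, ⟪α, w⟫ = k → ⟪β, w⟫ = m := fun w hw => by
    have : w ∈ Hy β m := by rw [h]; exact hw
    exact this
  set w0 : V n := (k / ⟪α, α⟫) • α with hw0
  set c : ℝ := ⟪α, β⟫ / ⟪α, α⟫ with hc
  set z : V n := β - c • α with hz
  have hk : ⟪α, w0⟫ = k := by rw [hw0, real_inner_smul_right]; field_simp
  have haz : ⟪α, z⟫ = 0 := by
    rw [hz, inner_sub_right, real_inner_smul_right, hc]; field_simp; ring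
  have h1 := hw w0 hk
  have h2 := hw (w0 + z) (by rw [inner_add_right, hk, haz, add_zero])
  rw [inner_add_right, h1] at h2
  have h3 : ⟪z, z⟫ = 0 := by
    have : ⟪z, z⟫ = ⟪β, z⟫ - c * ⟪α, z⟫ := by
      conv_lhs => rw [hz]
      rw [inner_sub_left, real_inner_smul_left]
    rw [this, haz]; linarith
  have h4 : β = c • α := by
    have := inner_self_eq_zero.1 h3
    rw [hz, sub_eq_zero] at this; exact this
  have hm : m = c * k := by rw [← h1, h4, real_inner_smul_left, hk]
  rcases D.reduced α hα c (h4 ▸ hβ) with h5 | h5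
  · left; rw [h4, hm, h5]; simp
  · right; rw [h4, hm, h5]; simp

/-- The generic point of a panel. -/
lemma panel_point {D : RootData n} {p c : Set (V n)} (h : IsPanelOf D p c) {α : V n}
    (hα : α ∈ D.Φ) {k : ℤ} (hp : p ⊆ Hy α k) :
    ∃ v ∈ p, ⟪α, v⟫ = k ∧ ∀ β ∈ D.Φ, ∀ m : ℤ, ⟪β, v⟫ = m →
      (β = α ∧ (m : ℝ) = k) ∨ (β = -α ∧ (m : ℝ) = -k) := by
  obtain ⟨h1, ⟨v, hv⟩, -, K, -, hK⟩ := h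
  have hvp : v ∈ p := by
    rw [hv]; apply subset_closure; intro α _ k; exact ⟨Iff.rfl, Iff.rfl⟩
  refine ⟨v, hvp, hp hvp, fun β hβ m hm => hy_eq D hα hβ ?_⟩
  rw [hK (Hy α k) ⟨⟨α, hα, k, rfl⟩, hp⟩]
  refine hK (Hy β m) ⟨⟨β, hβ, m, rfl⟩, ?_⟩
  rw [hv]
  apply closure_minimal
  · intro w hw; exact (hw β hβ m).1.2 hm
  · exact isClosed_eq (by fun_prop) continuous_const

/-- Regular points whose cells share a generic panel point and are on the same side. -/
lemma cell_eq_of_point {D : RootData n} {u u' v α : V n} {k : ℤ} (hu : Reg D u) (hu' : Reg D u')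
    (hv : v ∈ cell D u) (hv' : v ∈ cell D u')
    (hgen : ∀ β ∈ D.Φ, ∀ m : ℤ, ⟪β, v⟫ = m →
      (β = α ∧ (m : ℝ) = k) ∨ (β = -α ∧ (m : ℝ) = -k))
    (hside : 0 < (⟪α, u⟫ - k) * (⟪α, u'⟫ - k)) : cell D u = cell D u' := by
  apply cell_eq hu
  intro β hβ m hm
  by_contra hcon
  have h1 : (m : ℝ) < ⟪β, u'⟫ := lt_of_le_of_ne (not_lt.1 hcon) (hu' β hβ m).symm
  have h2 := hv β hβ m hm
  have h3 := cell_ge hv' hβ h1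
  rcases hgen β hβ m (le_antisymm h2 h3) with ⟨rfl, hk⟩ | ⟨rfl, hk⟩
  · rw [hk] at hm h1
    nlinarith [mul_pos (sub_pos.2 hm) (sub_pos.2 h1)]
  · rw [hk, inner_neg_left] at hm h1
    nlinarith [mul_pos (sub_pos.2 hm) (sub_pos.2 h1)]

lemma panel_two {D : RootData n} {p c c' : Set (V n)} (h : IsPanelOf D p c)
    (h' : IsPanelOf D p c') (hsub : p ⊆ c) (hsub' : p ⊆ c') (hne : c ≠ c') {α : V n}
    (hα : α ∈ D.Φ) {k : ℤ} (hp : p ⊆ Hy α k) : c' = sRefl α k '' c := by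
  obtain ⟨v, hv, hvk, hgen⟩ := panel_point h hα hp
  obtain ⟨u, hu, rfl⟩ := (alcove_iff D c).1 h.1
  obtain ⟨u', hu', rfl⟩ := (alcove_iff D c').1 h'.1
  have hs := sP_mem D hα k
  rw [← sP_coe D hα, image_cell hs]
  have hsv : v ∈ cell D (sP D hα k u) := by
    have := mem_cell_map hs (hsub hv)
    rwa [sP_coe, sRefl_fix hvk] at this
  have hnot : ¬ 0 < (⟪α, u⟫ - k) * (⟪α, u'⟫ - k) := fun hc =>
    hne (cell_eq_of_point hu hu' (hsub hv) (hsub' hv) hgen hc)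
  refine cell_eq_of_point hu' (reg_map hs hu) (hsub' hv) hsv hgen ?_
  rw [sP_coe, inner_sRefl_self D hα]
  have h1 : (⟪α, u⟫ - k) * (⟪α, u'⟫ - k) ≠ 0 :=
    mul_ne_zero (sub_ne_zero.2 (hu α hα k)) (sub_ne_zero.2 (hu' α hα k))
  have := lt_of_le_of_ne (not_lt.1 hnot) h1
  linarith

lemma panel_sub {D : RootData n} {p c : Set (V n)} (h : IsPanelOf D p c) : p ⊆ c := by
  obtain ⟨-, -, ⟨H, -, h⟩, -⟩ := h
  rw [h]; exact Set.inter_subset_left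

lemma panel_hyp {D : RootData n} {p c : Set (V n)} (h : IsPanelOf D p c) :
    ∃ α ∈ D.Φ, ∃ k : ℤ, p ⊆ Hy α k := by
  obtain ⟨-, -, ⟨H, ⟨α, hα, k, rfl⟩, h⟩, -⟩ := h
  exact ⟨α, hα, k, by rw [h]; exact Set.inter_subset_right⟩

lemma alcove_side {D : RootData n} {c : Set (V n)} (h : IsAlcove D c) {α : V n}
    (hα : α ∈ D.Φ) (k : ℤ) : c ⊆ Hle α k ∨ c ⊆ Hge α k := by
  obtain ⟨u, hu, rfl⟩ := (alcove_iff D c).1 h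
  rcases lt_or_gt_of_ne (hu α hα k) with h1 | h1
  · left; intro w hw; exact hw α hα k h1
  · right; intro w hw; exact cell_ge hw hα h1

/-! ### Strict fundamental domain -/

/-- Wall reflections of the cell of `u`. -/
def SU (D : RootData n) (u : V n) : Set (Equiv.Perm (V n)) :=
  {e | ∃ α ∈ D.Φ, ∃ k : ℤ, ⇑e = sRefl α k ∧ ⟪α, u⟫ < k ∧
    ∀ β ∈ D.Φ, ∀ m : ℤ, ⟪β, u⟫ < m → (m : ℝ) < ⟪β, e u⟫ → β = α ∧ m = k}

/-- Scaled distance to a hyperplane. -/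
noncomputable def dd (u α : V n) (k : ℤ) : ℝ := |(k : ℝ) - ⟪α, u⟫| / ‖α‖

lemma finite_close (D : RootData n) (u : V n) (r : ℝ) :
    {x : V n × ℤ | x.1 ∈ D.Φ ∧ dd u x.1 x.2 < r}.Finite := by
  have : {x : V n × ℤ | x.1 ∈ D.Φ ∧ dd u x.1 x.2 < r} ⊆
      ⋃ α ∈ D.Φ, (fun k : ℤ => (α, k)) '' {k : ℤ | |(k : ℝ) - ⟪α, u⟫| < r * ‖α‖} := by
    rintro ⟨α, k⟩ ⟨h1, h2⟩
    simp only [Set.mem_iUnion]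
    refine ⟨α, h1, k, ?_, rfl⟩
    exact (div_lt_iff₀ (norm_pos_iff.2 (D.nonzero α h1))).1 h2
  refine (D.finite.biUnion fun α _ => Set.Finite.image _ ?_).subset this
  refine (Set.finite_Icc ⌊⟪α, u⟫ - r * ‖α‖⌋ ⌈⟪α, u⟫ + r * ‖α‖⌉).subset ?_
  intro k hk
  have hk' := abs_lt.1 (show |(k : ℝ) - ⟪α, u⟫| < r * ‖α‖ from hk)
  constructor
  · have : (⌊⟪α, u⟫ - r * ‖α‖⌋ : ℝ) ≤ k := (Int.floor_le _).trans (by linarith)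
    exact_mod_cast this
  · have : (k : ℝ) ≤ ⌈⟪α, u⟫ + r * ‖α‖⌉ := le_trans (by linarith) (Int.le_ceil _)
    exact_mod_cast this

lemma dd_induction (D : RootData n) (u : V n) (P : V n → ℤ → Prop)
    (h : ∀ α ∈ D.Φ, ∀ k : ℤ, (∀ β ∈ D.Φ, ∀ m : ℤ, dd u β m < dd u α k → P β m) → P α k) :
    ∀ α ∈ D.Φ, ∀ k : ℤ, P α k := by
  have key : ∀ N : ℕ, ∀ α ∈ D.Φ, ∀ k : ℤ,
      {x : V n × ℤ | x.1 ∈ D.Φ ∧ dd u x.1 x.2 < dd u α k}.ncard = N → P α k := by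
    intro N
    induction N using Nat.strong_induction_on with
    | _ N ih =>
      intro α hα k hN
      refine h α hα k fun β hβ m hlt => ih _ ?_ β hβ m rfl
      rw [← hN]
      refine Set.ncard_lt_ncard ⟨fun x hx => ⟨hx.1, hx.2.trans hlt⟩, fun hsub => ?_⟩
        (finite_close D u _)
      have : ((β, m) : V n × ℤ) ∈ {x : V n × ℤ | x.1 ∈ D.Φ ∧ dd u x.1 x.2 < dd u β m} :=
        hsub ⟨hβ, hlt⟩
      exact lt_irrefl _ this.2
  intro α hα k
  exact key _ α hα k rfl

/-- Choosing the nearer of two hyperplanes. -/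
lemma nearer {D : RootData n} {u α β : V n} {k m : ℤ} (hα : α ∈ D.Φ) (hβ : β ∈ D.Φ)
    (ha : ⟪α, u⟫ < k) (hb : ⟪β, u⟫ < m) (hpos : 0 < ⟪α, β⟫)
    (hle : ((m : ℝ) - ⟪β, u⟫) * ⟪α, α⟫ ≤ ((k : ℝ) - ⟪α, u⟫) * ⟪α, β⟫)
    (hne : ¬ (β = α ∧ m = k)) : dd u β m < dd u α k := by
  have hna : 0 < ‖α‖ := norm_pos_iff.2 (D.nonzero α hα)
  have hnb : 0 < ‖β‖ := norm_pos_iff.2 (D.nonzero β hβ)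
  unfold dd
  rw [abs_of_pos (sub_pos.2 ha), abs_of_pos (sub_pos.2 hb), div_lt_div_iff₀ hnb hna]
  rw [real_inner_self_eq_norm_sq] at hle
  have hcs := real_inner_le_norm α β
  rcases hcs.lt_or_eq with h | h
  · have h1 : ((k : ℝ) - ⟪α, u⟫) * ⟪α, β⟫ < ((k : ℝ) - ⟪α, u⟫) * (‖α‖ * ‖β‖) :=
      mul_lt_mul_of_pos_left h (sub_pos.2 ha)
    have h2 : (((m : ℝ) - ⟪β, u⟫) * ‖α‖) * ‖α‖ < (((k : ℝ) - ⟪α, u⟫) * ‖β‖) * ‖α‖ := by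
      nlinarith
    exact lt_of_mul_lt_mul_right h2 hna.le
  · have h1 := (inner_eq_norm_mul_iff_real).1 h
    have h2 : β = (‖β‖ / ‖α‖) • α := by
      rw [div_eq_inv_mul, ← smul_smul, h1, smul_smul, inv_mul_cancel₀ hna.ne', one_smul]
    have h3 : β = α := by
      rcases D.reduced α hα _ (h2 ▸ hβ) with h4 | h4
      · rw [h4, one_smul] at h2; exact h2
      · have : 0 < ‖β‖ / ‖α‖ := by positivity
        linarith
    subst h3
    have h5 : m ≠ k := fun h => hne ⟨rfl, h⟩
    rw [real_inner_self_eq_norm_sq] at hle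
    have h6 : (m : ℝ) - ⟪β, u⟫ ≤ k - ⟪β, u⟫ := le_of_mul_le_mul_right hle (by positivity)
    have h7 : (m : ℝ) ≠ k := by exact_mod_cast h5
    have h8 : (m : ℝ) < k := lt_of_le_of_ne (by linarith) h7
    exact mul_lt_mul_of_pos_right (by linarith) hna

lemma gen_pos (D : RootData n) {u : V n} (hu : Reg D u) {α : V n} (hα : α ∈ D.Φ) {k : ℤ}
    (hlt : ⟪α, u⟫ < k)
    (ih : ∀ β ∈ D.Φ, ∀ m : ℤ, dd u β m < dd u α k →
      ∀ e : Equiv.Perm (V n), ⇑e = sRefl β m → e ∈ Subgroup.closure (SU D u))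
    (e : Equiv.Perm (V n)) (he : ⇑e = sRefl α k) : e ∈ Subgroup.closure (SU D u) := by
  by_cases hS : e ∈ SU D u
  · exact Subgroup.subset_closure hS
  have hex : ∃ β ∈ D.Φ, ∃ m : ℤ, ⟪β, u⟫ < m ∧ (m : ℝ) < ⟪β, e u⟫ ∧ ¬ (β = α ∧ m = k) := by
    by_contra hcon
    push Not at hcon
    exact hS ⟨α, hα, k, he, hlt, fun β hβ m h1 h2 =>
      by_contra fun h3 => h3 ⟨(hcon β hβ m h1 h2).1, (hcon β hβ m h1 h2).2⟩⟩
  have haa := inner_self_pos D hα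
  have hex2 : ∃ β ∈ D.Φ, ∃ m : ℤ, ⟪β, u⟫ < m ∧ 0 < ⟪α, β⟫ ∧
      ((m : ℝ) - ⟪β, u⟫) * ⟪α, α⟫ ≤ ((k : ℝ) - ⟪α, u⟫) * ⟪α, β⟫ ∧ ¬ (β = α ∧ m = k) := by
    obtain ⟨β, hβ, m, h1, h2, h3⟩ := hex
    have h4 := h2
    rw [he, inner_sRefl] at h4
    have h5 : ((m : ℝ) - ⟪β, u⟫) * ⟪α, α⟫ < ((k : ℝ) - ⟪α, u⟫) * (2 * ⟪α, β⟫) := by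
      have h6 : (m : ℝ) - ⟪β, u⟫ < ((k : ℝ) - ⟪α, u⟫) * (2 * ⟪α, β⟫) / ⟪α, α⟫ := by
        rw [mul_div_assoc]; linarith
      exact (lt_div_iff₀ haa).1 h6
    have hpos : 0 < ⟪α, β⟫ := by
      have h7 : 0 < ((m : ℝ) - ⟪β, u⟫) * ⟪α, α⟫ := mul_pos (sub_pos.2 h1) haa
      have h8 := pos_of_mul_pos_right (h7.trans h5) (sub_pos.2 hlt).le
      linarith
    by_cases h6 : ((m : ℝ) - ⟪β, u⟫) * ⟪α, α⟫ ≤ ((k : ℝ) - ⟪α, u⟫) * ⟪α, β⟫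
    · exact ⟨β, hβ, m, h1, hpos, h6, h3⟩
    · -- use the reflected hyperplane
      obtain ⟨z, hz⟩ := D.crystallographic α hα β hβ
      have hr := D.reflect_mem α hα β hβ
      rw [hz] at hr h4
      have hz' : 2 * ⟪α, β⟫ = z * ⟪α, α⟫ := by field_simp at hz; linarith
      have hin : ⟪α, -(β - (z : ℝ) • α)⟫ = ⟪α, β⟫ := by
        rw [inner_neg_right, inner_sub_right, real_inner_smul_right]; linarith
      have hin2 : ⟪-(β - (z : ℝ) • α), u⟫ = z * ⟪α, u⟫ - ⟪β, u⟫ := by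
        rw [inner_neg_left, inner_sub_left, real_inner_smul_left]; ring
      refine ⟨-(β - (z : ℝ) • α), D.neg_mem _ hr, k * z - m, ?_, ?_, ?_, ?_⟩
      · rw [hin2]; push_cast; linarith
      · rw [hin]; exact hpos
      · rw [hin, hin2]; push_cast
        have : ((k : ℝ) * z - m - (z * ⟪α, u⟫ - ⟪β, u⟫)) * ⟪α, α⟫ =
          (k - ⟪α, u⟫) * (z * ⟪α, α⟫) - ((m : ℝ) - ⟪β, u⟫) * ⟪α, α⟫ := by ring
        rw [this, ← hz']; linarith
      · rintro ⟨h7, h8⟩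
        have h9 : β = ((z : ℝ) - 1) • α := by
          have h7' : (z : ℝ) • α - β = α := (by module : _ = -(β - (z : ℝ) • α)).trans h7
          calc β = (z : ℝ) • α - ((z : ℝ) • α - β) := by module
            _ = (z : ℝ) • α - α := by rw [h7']
            _ = _ := by module
        rcases D.reduced α hα _ (h9 ▸ hβ) with h10 | h10
        · rw [h10, one_smul] at h9
          have : z = 2 := by
            have : (z : ℝ) = 2 := by linarith
            exact_mod_cast this
          subst this
          exact h3 ⟨h9, by linarith⟩
        · have : (z : ℝ) = 0 := by linarith
          rw [this] at hz'; linarith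
  obtain ⟨β, hβ, m, h1, hpos, hle, hne⟩ := hex2
  have hd := nearer hα hβ hlt h1 hpos hle hne
  have hbb := inner_self_pos D hβ
  have hsb := ih β hβ m hd (sP D hβ m) rfl
  obtain ⟨δ, hδ, l, h2, h3⟩ := (good D (sP_mem D hβ m)).2 α hα k
  have hdel : dd u δ l < dd u α k := by
    have hn : ‖δ‖ = ‖α‖ := by
      -- δ equals the reflection of α
      have hdel : ∀ w, ⟪δ, w⟫ - ⟪α, w⟫ + ⟪β, w⟫ * (2 * ⟪β, α⟫ / ⟪β, β⟫) =
          l - k + m * (2 * ⟪β, α⟫ / ⟪β, β⟫) := by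
        intro w
        have := h2 w
        rw [sP_coe, inner_sRefl] at this
        linarith
      have h0 := hdel 0
      simp only [inner_zero_right] at h0
      have hd2 : ∀ w, ⟪δ, w⟫ = ⟪α, w⟫ - ⟪β, w⟫ * (2 * ⟪β, α⟫ / ⟪β, β⟫) := by
        intro w; have := hdel w; linarith
      have e1 := hd2 δ
      have e2 := hd2 α
      have e3 := hd2 β
      rw [real_inner_comm δ α, real_inner_comm δ β] at e1
      rw [real_inner_comm α β] at e3
      have e4 : ⟪δ, δ⟫ = ⟪α, α⟫ := by
        rw [e1, e2, e3, real_inner_comm β α]; field_simp; ring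
      rw [real_inner_self_eq_norm_sq, real_inner_self_eq_norm_sq] at e4
      exact (pow_left_inj₀ (norm_nonneg _) (norm_nonneg _) two_ne_zero).1 e4
    have h4 : (l : ℝ) - ⟪δ, u⟫ = (k - ⟪α, u⟫) - (m - ⟪β, u⟫) * (2 * ⟪β, α⟫ / ⟪β, β⟫) := by
      have := h2 u
      rw [sP_coe, inner_sRefl] at this
      linarith
    have hna : 0 < ‖α‖ := norm_pos_iff.2 (D.nonzero α hα)
    have hnb : 0 < ‖β‖ := norm_pos_iff.2 (D.nonzero β hβ)
    unfold dd at hd ⊢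
    rw [hn]
    refine div_lt_div_of_pos_right ?_ hna
    rw [abs_of_pos (sub_pos.2 hlt), abs_of_pos (sub_pos.2 h1), div_lt_div_iff₀ hnb hna] at hd
    rw [abs_of_pos (sub_pos.2 hlt), h4, real_inner_comm α β, real_inner_self_eq_norm_sq]
    have hA : 0 < (m - ⟪β, u⟫) * (2 * ⟪α, β⟫ / ‖β‖ ^ 2) := by
      have := sub_pos.2 h1
      positivity
    have hB : (m - ⟪β, u⟫) * (2 * ⟪α, β⟫ / ‖β‖ ^ 2) < 2 * (k - ⟪α, u⟫) := by
      rw [← mul_div_assoc, div_lt_iff₀ (by positivity)]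
      have hcs := real_inner_le_norm α β
      have i1 : ((m : ℝ) - ⟪β, u⟫) * ⟪α, β⟫ ≤ (m - ⟪β, u⟫) * (‖α‖ * ‖β‖) :=
        mul_le_mul_of_nonneg_left hcs (sub_pos.2 h1).le
      have i2 := mul_lt_mul_of_pos_right hd hnb
      nlinarith
    rw [abs_lt]
    constructor <;> linarith
  have hsd := ih δ hδ l hdel (sP D hδ l) rfl
  have hconj : e = sP D hβ m * sP D hδ l * (sP D hβ m)⁻¹ := by
    rw [eq_mul_inv_iff_mul_eq]
    ext1 w
    rw [Equiv.Perm.mul_apply, Equiv.Perm.mul_apply, he, sP_coe D hδ, h3]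
  rw [hconj]
  exact Subgroup.mul_mem _ (Subgroup.mul_mem _ hsb hsd) (Subgroup.inv_mem _ hsb)

lemma gen_all (D : RootData n) {u : V n} (hu : Reg D u) :
    AffW D ≤ Subgroup.closure (SU D u) := by
  unfold AffW
  rw [Subgroup.closure_le]
  rintro e ⟨α, hα, k, he⟩
  revert e
  refine dd_induction D u (fun α k => ∀ e : Equiv.Perm (V n), ⇑e = sRefl α k →
    e ∈ Subgroup.closure (SU D u)) ?_ α hα k
  intro α hα k ih e he
  rcases lt_or_gt_of_ne (hu α hα k) with h | h
  · exact gen_pos D hu hα h ih e he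
  · have hd : dd u (-α) (-k) = dd u α k := by
      unfold dd; rw [norm_neg, inner_neg_left, ← abs_neg]; push_cast; congr 2; ring
    refine gen_pos D hu (D.neg_mem α hα) (k := -k) (by rw [inner_neg_left]; push_cast; linarith)
      (by rw [hd]; exact ih) e ?_
    rw [he]; push_cast; rw [sRefl_neg]

lemma SU_mem {D : RootData n} {u : V n} {e : Equiv.Perm (V n)} (h : e ∈ SU D u) : e ∈ AffW D := by
  obtain ⟨α, hα, k, he, -⟩ := h
  exact Subgroup.subset_closure ⟨α, hα, k, he⟩

lemma SU_inv {D : RootData n} {u : V n} {e : Equiv.Perm (V n)} (h : e ∈ SU D u) : e⁻¹ = e := by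
  obtain ⟨α, hα, k, he, -⟩ := h
  have : e = sP D hα k := by ext1 v; rw [he]; rfl
  rw [this]; rfl

lemma prod_mem {D : RootData n} {u : V n} {l : List (Equiv.Perm (V n))}
    (h : ∀ s ∈ l, s ∈ SU D u) : l.prod ∈ AffW D :=
  Subgroup.list_prod_mem _ fun s hs => SU_mem (h s hs)

lemma deletion {D : RootData n} {u : V n} (hu : Reg D u) {α : V n} (hα : α ∈ D.Φ) {k : ℤ}
    (hlt : ⟪α, u⟫ < k) {s : Equiv.Perm (V n)} (hs : ⇑s = sRefl α k) (hs2 : s * s = 1)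
    (l : List (Equiv.Perm (V n))) :
    (∀ t ∈ l, t ∈ SU D u) → (k : ℝ) < ⟪α, l.prod u⟫ →
    ∃ l' : List (Equiv.Perm (V n)), (∀ t ∈ l', t ∈ SU D u) ∧ l'.length < l.length ∧
      s * l.prod = l'.prod := by
  induction l using List.reverseRecOn with
  | nil => intro _ h; simp at h; linarith
  | append_singleton a t ih =>
    intro hl hk
    have hla : ∀ t ∈ a, t ∈ SU D u := fun t ht => hl t (by simp [ht])
    have hga := prod_mem hla
    rcases lt_or_gt_of_ne (reg_map hga hu α hα k) with h | h
    · refine ⟨a, hla, by simp, ?_⟩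
      obtain ⟨β, hβ, m, h1, h2⟩ := (good D hga).2 α hα k
      obtain ⟨δ, hδ, j, h3, h4, h5⟩ := hl t (by simp)
      have h6 := h1 u
      have h7 := h1 (t u)
      simp only [List.prod_append, List.prod_cons, List.prod_nil, mul_one,
        Equiv.Perm.mul_apply] at hk
      obtain ⟨rfl, rfl⟩ := h5 β hβ m (by linarith) (by linarith)
      have h8 : a.prod * t = s * a.prod := by
        ext1 w
        rw [Equiv.Perm.mul_apply, Equiv.Perm.mul_apply, h3, h2, hs]
      simp only [List.prod_append, List.prod_cons, List.prod_nil, mul_one]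
      rw [h8, ← mul_assoc, hs2, one_mul]
    · obtain ⟨l', h1, h2, h3⟩ := ih hla h
      refine ⟨l' ++ [t], ?_, by simpa using h2, ?_⟩
      · intro x hx
        simp only [List.mem_append, List.mem_singleton] at hx
        rcases hx with hx | rfl
        · exact h1 x hx
        · exact hl x (by simp)
      · simp only [List.prod_append, List.prod_cons, List.prod_nil, mul_one]
        rw [← mul_assoc, h3]

lemma strict_list {D : RootData n} {u : V n} (hu : Reg D u) (N : ℕ) :
    ∀ l : List (Equiv.Perm (V n)), l.length = N → (∀ t ∈ l, t ∈ SU D u) →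
    ∀ v ∈ cell D u, l.prod v ∈ cell D u → l.prod v = v := by
  induction N using Nat.strong_induction_on with
  | _ N ih =>
    intro l hN hl v hv hxv
    cases l with
    | nil => rfl
    | cons s l =>
      have hsS := hl s (by simp)
      have hl' : ∀ t ∈ l, t ∈ SU D u := fun t ht => hl t (by simp [ht])
      have hss : s * s = 1 := by
        have := SU_inv hsS
        nth_rewrite 1 [← this]; simp
      have hx := prod_mem hl
      obtain ⟨α, hα, k, hs, hlt, -⟩ := hsS
      simp only [List.length_cons] at hN
      rcases lt_or_gt_of_ne (reg_map hx hu α hα k) with h | h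
      · have h2 : (k : ℝ) < ⟪α, l.prod u⟫ := by
          rw [List.prod_cons, Equiv.Perm.mul_apply, hs] at h
          have := inner_sRefl_self D hα (l.prod u) k
          linarith
        obtain ⟨l', h3, h4, h5⟩ := deletion hu hα hlt hs hss l hl' h2
        rw [List.prod_cons, h5] at hxv ⊢
        exact ih _ (by omega) l' rfl h3 v hv hxv
      · have h1 := cell_ge (mem_cell_map hx hv) hα h
        have h2 := hxv α hα k hlt
        have h3 : s ((s :: l).prod v) = (s :: l).prod v := by
          rw [hs]; exact sRefl_fix (le_antisymm h2 h1)
        have h4 : s ((s :: l).prod v) = l.prod v := by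
          rw [← Equiv.Perm.mul_apply, List.prod_cons, ← mul_assoc, hss, one_mul]
        rw [← h3, h4] at hxv ⊢
        exact ih _ (by omega) l rfl hl' v hv hxv

lemma strict {D : RootData n} {c : Set (V n)} (hc : IsAlcove D c) {e : Equiv.Perm (V n)}
    (he : e ∈ AffW D) {v : V n} (hv : v ∈ c) (hev : e v ∈ c) : e v = v := by
  obtain ⟨u, hu, rfl⟩ := (alcove_iff D c).1 hc
  have h1 := gen_all D hu he
  rw [← Subgroup.mem_toSubmonoid, Subgroup.closure_toSubmonoid] at h1
  obtain ⟨l, hl, rfl⟩ := Submonoid.exists_list_of_mem_closure h1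
  refine strict_list hu _ l rfl (fun t ht => ?_) v hv hev
  rcases hl t ht with h | h
  · exact h
  · have := SU_inv (Set.mem_inv.1 h)
    rw [inv_inv] at this
    rw [this]; exact h

lemma strict_set {D : RootData n} {c : Set (V n)} (hc : IsAlcove D c) {e : Equiv.Perm (V n)}
    (he : e ∈ AffW D) {p : Set (V n)} (hp : p ⊆ c) (hep : e '' p ⊆ c) : e '' p = p := by
  have : ∀ v ∈ p, e v = v := fun v hv => strict hc he (hp hv) (hep ⟨v, hv, rfl⟩)
  ext w
  constructor
  · rintro ⟨v, hv, rfl⟩; rw [this v hv]; exact hv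
  · intro hw; exact ⟨w, hw, this w hw⟩

/-- Deleting an alcove from a gallery after moving the initial part. -/
lemma delete {D : RootData n} {γ : PreGallery n} (hγ : IsGallery D γ) {a b : ℕ}
    (hlen : γ.len = b + 1) (hab : a ≤ b) {e : Equiv.Perm (V n)} (he : e ∈ AffW D)
    (h : e '' γ.c a = γ.c (a + 1)) :
    ∃ γ' : PreGallery n, IsGallery D γ' ∧ γ'.len = b ∧ γ'.p 0 = e '' γ.p 0 ∧
      γ'.p (γ'.len + 1) = γ.p (γ.len + 1) ∧ ∀ j ≤ a, γ'.c j = e '' γ.c j := by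
  obtain ⟨h1, ⟨h2, h2'⟩, ⟨h3, h3'⟩, h4⟩ := hγ
  rw [hlen] at h1 h3 h3' h4
  have hc1 : ∀ j ≤ a, (if j ≤ a then e '' γ.c j else γ.c (j + 1)) = e '' γ.c j :=
    fun j hj => if_pos hj
  have hc2 : ∀ j, a ≤ j → (if j ≤ a then e '' γ.c j else γ.c (j + 1)) = γ.c (j + 1) := by
    intro j hj
    split_ifs with hja
    · have : j = a := le_antisymm hja hj
      rw [this, h]
    · rfl
  refine ⟨⟨b, fun j => if j ≤ a then e '' γ.p j else γ.p (j + 1),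
    fun j => if j ≤ a then e '' γ.c j else γ.c (j + 1)⟩, ⟨?_, ⟨?_, ?_⟩, ⟨?_, ?_⟩, ?_⟩,
    rfl, ?_, ?_, hc1⟩
  · intro j hj
    dsimp only at hj ⊢
    split_ifs
    · exact alcove_map he (h1 j (by omega))
    · exact h1 (j + 1) (by omega)
  · simpa using face_map he h2
  · simpa using h2'
  · dsimp only
    rw [if_neg (by omega)]; exact h3
  · dsimp only
    rw [if_neg (by omega), hc2 b hab]; exact h3'
  · intro j hj1 hj2
    dsimp only at hj2 ⊢
    by_cases hja : j ≤ a
    · rw [if_pos hja, hc1 j hja, hc1 (j - 1) (by omega)]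
      exact ⟨panel_map he (h4 j hj1 (by omega)).1, panel_map he (h4 j hj1 (by omega)).2⟩
    · rw [if_neg hja, hc2 j (by omega), hc2 (j - 1) (by omega)]
      have := h4 (j + 1) (by omega) (by omega)
      rw [show j - 1 + 1 = j by omega]
      simpa using this
  · simp
  · dsimp only
    rw [if_neg (by omega), hlen]

lemma min_ne {D : RootData n} {γ : PreGallery n} (hmin : IsMinimal D γ) {a : ℕ}
    (ha : a < γ.len) : γ.c a ≠ γ.c (a + 1) := by
  intro h
  obtain ⟨γ', h1, h2, h3, h4, -⟩ := delete hmin.1 (a := a) (b := γ.len - 1) (by omega) (by omega)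
    (AffW D).one_mem (by simpa using h)
  have := hmin.2 γ' h1 (by simpa using h3) h4
  omega

lemma gal_panel {D : RootData n} {γ : PreGallery n} (h : IsGallery D γ) {a : ℕ}
    (ha : a < γ.len) : IsPanelOf D (γ.p (a + 1)) (γ.c a) ∧
      IsPanelOf D (γ.p (a + 1)) (γ.c (a + 1)) := by
  have := h.2.2.2 (a + 1) (by omega) (by omega)
  simpa using this

lemma min_refl {D : RootData n} {γ : PreGallery n} (hmin : IsMinimal D γ) {a : ℕ}
    (ha : a < γ.len) {α : V n} (hα : α ∈ D.Φ) {k : ℤ} (hp : γ.p (a + 1) ⊆ Hy α k) :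
    sRefl α k '' γ.c a = γ.c (a + 1) := by
  obtain ⟨h1, h2⟩ := gal_panel hmin.1 ha
  exact (panel_two h1 h2 (panel_sub h1) (panel_sub h2) (min_ne hmin ha) hα hp).symm

lemma min_pos {D : RootData n} {γ : PreGallery n} (hmin : IsMinimal D γ)
    (hfirst : γ.p 0 = {(0 : V n)}) {a : ℕ}
    (ha : a < γ.len) {α : V n} (hα : α ∈ D.Φ) {k : ℤ} (hp : γ.p (a + 1) ⊆ Hy α k) (hk : 0 < k) :
    γ.c a ⊆ Hle α k := by
  by_contra hcon
  have h0 : γ.c 0 ⊆ Hle α k := by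
    rcases alcove_side (hmin.1.1 0 (by omega)) hα k with h | h
    · exact h
    · have h1 : (0 : V n) ∈ γ.c 0 := hmin.1.2.1.2 (by rw [hfirst]; rfl)
      have h2 := h h1
      change (k : ℝ) ≤ ⟪α, 0⟫ at h2
      rw [inner_zero_right] at h2
      have : (0 : ℝ) < k := by exact_mod_cast hk
      linarith
  have hj : ∃ j, j < a ∧ γ.c j ⊆ Hle α k ∧ ¬ γ.c (j + 1) ⊆ Hle α k := by
    by_contra hno
    push Not at hno
    have : ∀ j ≤ a, γ.c j ⊆ Hle α k := by
      intro j
      induction j with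
      | zero => intro _; exact h0
      | succ j ih => intro hj; exact hno j (by omega) (ih (by omega))
    exact hcon (this a le_rfl)
  obtain ⟨j, hja, hj1, hj2⟩ := hj
  have hj3 : γ.c (j + 1) ⊆ Hge α k :=
    (alcove_side (hmin.1.1 (j + 1) (by omega)) hα k).resolve_left hj2
  obtain ⟨p1, p2⟩ := gal_panel hmin.1 (show j < γ.len by omega)
  have hpj : γ.p (j + 1) ⊆ Hy α k := fun w hw =>
    le_antisymm (hj1 (panel_sub p1 hw)) (hj3 (panel_sub p2 hw))
  have e1 := min_refl hmin ha hα hp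
  have e2 := min_refl hmin (show j < γ.len by omega) hα hpj
  have hs := sP_mem D hα k
  obtain ⟨γ', g1, g2, g3, g4, g5⟩ := delete hmin.1 (a := a) (b := γ.len - 1) (by omega)
    (by omega) hs e1
  obtain ⟨γ'', f1, f2, f3, f4, -⟩ := delete g1 (a := j) (b := γ.len - 2) (by omega)
    (by omega) hs (by rw [g5 j (by omega), g5 (j + 1) (by omega)]; rw [← e2]; rfl)
  have := hmin.2 γ'' f1 (by
    rw [f3, g3, sP_coe, (sRefl_invol D hα k).image_eq_preimage_symm, ← Set.preimage_comp,
      (sRefl_invol D hα k).comp_self, Set.preimage_id]) (f4.trans g4)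
  omega

lemma min_nonzero {D : RootData n} {γ : PreGallery n} (hmin : IsMinimal D γ)
    (hfirst : γ.p 0 = {(0 : V n)}) {a : ℕ}
    (ha : a < γ.len) {α : V n} (hα : α ∈ D.Φ) {k : ℤ} (hp : γ.p (a + 1) ⊆ Hy α k) : k ≠ 0 := by
  rintro rfl
  obtain ⟨γ', g1, g2, g3, g4, -⟩ := delete hmin.1 (a := a) (b := γ.len - 1) (by omega)
    (by omega) (sP_mem D hα 0) (min_refl hmin ha hα hp)
  have := hmin.2 γ' g1 (by rw [g3, hfirst, sP_coe]; simp [sRefl]) g4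
  omega

lemma fund_le (D : RootData n) {α : V n} (hα : α ∈ D.Φ) {k : ℤ} (hk : 0 < k) :
    fund D ⊆ Hle α k := by
  have hk1 : (1 : ℝ) ≤ k := by exact_mod_cast hk
  rintro v ⟨h1, h2⟩
  have hcombo : ∀ β : V n, (∃ c : Fin n → ℝ, (∀ i, 0 ≤ c i) ∧ β = ∑ i, c i • D.simple i) →
      0 ≤ ⟪β, v⟫ := by
    rintro β ⟨c, hc, rfl⟩
    rw [sum_inner]
    refine Finset.sum_nonneg fun i _ => ?_
    rw [real_inner_smul_left]
    exact mul_nonneg (hc i) (h1 i)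
  change ⟪α, v⟫ ≤ k
  rcases D.pos_total α hα with h | h
  · have := hcombo _ (D.highest_dominates α h)
    rw [inner_sub_left] at this
    linarith
  · have := hcombo _ (D.pos_combo _ h)
    rw [inner_neg_left] at this
    linarith

lemma sameSide_neg {α : V n} {k : ℝ} {X Y : Set (V n)} (h : sameSide (-α) (-k) X Y) :
    sameSide α k X Y := by
  have e1 : Hge (-α) (-k) = Hle α k := by ext w; simp [Hge, Hle]
  have e2 : Hle (-α) (-k) = Hge α k := by ext w; simp [Hge, Hle]
  unfold sameSide at h ⊢
  rw [e1, e2] at h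
  exact h.symm

lemma hy_neg (α : V n) (k : ℝ) : Hy (-α) (-k) = Hy α k := by ext w; simp [Hy]

lemma no_fold {D : RootData n} {γ : PreGallery n} (hmin : IsMinimal D γ)
    (hfirst : γ.p 0 = {(0 : V n)}) {a : ℕ} (ha : a < γ.len) {x : Equiv.Perm (V n)}
    (hx : x ∈ FinW D) : ¬ alcoveOrient D (fund D) (x '' γ.c a) (x '' γ.p (a + 1)) := by
  intro ho
  have hxA := finW_le D hx
  have key : ∀ α ∈ D.Φ, ∀ k : ℤ, 0 < k → x '' γ.p (a + 1) ⊆ Hy α k →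
      sameSide α k (x '' γ.c a) (fund D) := by
    intro α hα k hk hp
    right
    refine ⟨?_, fund_le D hα hk⟩
    obtain ⟨β, hβ, m, h1, -⟩ := (good D hxA).2 α hα k
    have h2 := h1 0
    rw [finW_zero D hx, inner_zero_right, inner_zero_right] at h2
    have hmk : m = k := by
      have : (m : ℝ) = k := by linarith
      exact_mod_cast this
    have hp' : γ.p (a + 1) ⊆ Hy β m := by
      intro w hw
      have h3 : ⟪α, x w⟫ = k := hp ⟨w, hw, rfl⟩
      have := h1 w
      change ⟪β, w⟫ = m
      linarith
    have h4 := min_pos hmin hfirst ha hβ hp' (hmk ▸ hk)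
    rintro _ ⟨w, hw, rfl⟩
    have h5 : ⟪β, w⟫ ≤ m := h4 hw
    have := h1 w
    change ⟪α, x w⟫ ≤ k
    linarith
  obtain ⟨p1, -⟩ := gal_panel hmin.1 ha
  obtain ⟨α, hα, k, hp⟩ := panel_hyp (panel_map hxA p1)
  rcases lt_trichotomy k 0 with hk | hk | hk
  · have h1 := key (-α) (D.neg_mem α hα) (-k) (by omega) (by push_cast; rw [hy_neg]; exact hp)
    push_cast at h1
    exact ho α hα k hp (sameSide_neg h1)
  · subst hk
    have hx' := hxA
    obtain ⟨β, hβ, m, h1, -⟩ := (good D hxA).2 α hα 0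
    have h2 := h1 0
    rw [finW_zero D hx, inner_zero_right, inner_zero_right] at h2
    have hm : m = 0 := by
      have : (m : ℝ) = 0 := by push_cast at h2; linarith
      exact_mod_cast this
    refine min_nonzero hmin hfirst ha hβ (k := m) ?_ hm
    intro w hw
    have h3 : ⟪α, x w⟫ = ((0 : ℤ) : ℝ) := hp ⟨w, hw, rfl⟩
    have := h1 w
    change ⟪β, w⟫ = m
    linarith
  · exact ho α hα k hp (key α hα k hk hp)

lemma finW_orbit_finite (D : RootData n) (u : V n) :
    {v : V n | ∃ x ∈ FinW D, v = x u}.Finite := by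
  have hF : ((fun β => ⟪β, u⟫) '' D.Φ).Finite := D.finite.image _
  have : Finite D.Φ := D.finite
  have hpi : (Set.pi (Set.univ : Set D.Φ) (fun _ => (fun β => ⟪β, u⟫) '' D.Φ)).Finite :=
    Set.Finite.pi fun _ => hF
  let f : V n → (D.Φ → ℝ) := fun v α => ⟪(α : V n), v⟫
  have hinj : Function.Injective f := by
    intro v w h
    have h1 : ∀ α ∈ D.Φ, ⟪α, v - w⟫ = 0 := by
      intro α hα
      have := congrFun h ⟨α, hα⟩
      rw [inner_sub_right]; exact sub_eq_zero.2 this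
    have h2 : ∀ y ∈ Submodule.span ℝ D.Φ, ⟪y, v - w⟫ = 0 := by
      intro y hy
      induction hy using Submodule.span_induction with
      | mem y hy => exact h1 y hy
      | zero => simp
      | add y z _ _ hy hz => rw [inner_add_left, hy, hz, add_zero]
      | smul r y _ hy => rw [real_inner_smul_left, hy, mul_zero]
    have h3 := h2 (v - w) (by rw [D.span_top]; trivial)
    exact sub_eq_zero.1 (inner_self_eq_zero.1 h3)
  refine (hpi.preimage hinj.injOn).subset ?_
  rintro _ ⟨x, hx, rfl⟩ ⟨α, hα⟩ -
  obtain ⟨β, hβ, m, h1, -⟩ := (good D (finW_le D hx)).2 α hα 0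
  refine ⟨β, hβ, ?_⟩
  have h2 := h1 0
  rw [finW_zero D hx, inner_zero_right, inner_zero_right] at h2
  have h3 := h1 u
  change ⟪β, u⟫ = ⟪α, x u⟫
  linarith

lemma transitive {D : RootData n} {c c' : Set (V n)} (hc : IsAlcove D c) (hc' : IsAlcove D c')
    (h0 : (0 : V n) ∈ c) (h0' : (0 : V n) ∈ c') : ∃ x ∈ FinW D, c' = x '' c := by
  obtain ⟨u, hu, rfl⟩ := (alcove_iff D c).1 hc
  obtain ⟨u', hu', rfl⟩ := (alcove_iff D c').1 hc'
  obtain ⟨_, ⟨x, hx, rfl⟩, hmax⟩ := Set.exists_max_image _ (fun v => ⟪v, u'⟫)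
    (finW_orbit_finite D u) ⟨u, 1, Subgroup.one_mem _, rfl⟩
  have hxA := finW_le D hx
  refine ⟨x, hx, ?_⟩
  rw [image_cell hxA]
  have hxu := reg_map hxA hu
  have h0x : (0 : V n) ∈ cell D (x u) := by
    have := mem_cell_map hxA h0
    rwa [finW_zero D hx] at this
  apply cell_eq hu'
  intro α hα k hk
  by_contra hcon
  have h1 : (k : ℝ) < ⟪α, x u⟫ := lt_of_le_of_ne (not_lt.1 hcon) (hxu α hα k).symm
  have h2 := h0' α hα k hk
  have h3 := cell_ge h0x hα h1
  have hk0 : (k : ℝ) = 0 := by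
    rw [inner_zero_right] at h2 h3; linarith
  rw [hk0] at hk h1
  have hs : sP D hα 0 ∈ FinW D := Subgroup.subset_closure ⟨α, hα, rfl⟩
  have h4 := hmax (sP D hα 0 (x u)) ⟨sP D hα 0 * x, Subgroup.mul_mem _ hs hx, rfl⟩
  rw [sP_coe, real_inner_comm, inner_sRefl, real_inner_comm (x u) u', sub_zero] at h4
  have h5 : ⟪α, x u⟫ * (2 * ⟪α, u'⟫ / ⟪α, α⟫) < 0 := by
    refine mul_neg_of_pos_of_neg h1 (div_neg_of_neg_of_pos (by linarith) (inner_self_pos D hα))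
  rw [real_inner_comm u' (x u)] at h4
  linarith

lemma other_unique {D : RootData n} {p c c₁ c₂ : Set (V n)} (h : IsPanelOf D p c)
    (h₁ : IsPanelOf D p c₁) (h₂ : IsPanelOf D p c₂) (n₁ : c ≠ c₁) (n₂ : c ≠ c₂) : c₁ = c₂ := by
  obtain ⟨α, hα, k, hp⟩ := panel_hyp h
  rw [panel_two h h₁ (panel_sub h) (panel_sub h₁) n₁ hα hp,
    panel_two h h₂ (panel_sub h) (panel_sub h₂) n₂ hα hp]

/-- Faces of the same type in a common alcove, up to a translate. -/
lemma same_type_eq {D : RootData n} {c p p' : Set (V n)} {x : Equiv.Perm (V n)} (hx : x ∈ AffW D)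
    (hc : IsAlcove D c) (hp : x '' p ⊆ c) (hp' : p' ⊆ c) (ht : SameTypeFace D p p') :
    p' = x '' p := by
  obtain ⟨y, hy, rfl⟩ := ht
  have h1 : y '' p = ⇑(y * x⁻¹) '' (x '' p) := by rw [image_mul, image_inv_image]
  rw [h1] at hp' ⊢
  exact strict_set hc ((AffW D).mul_mem hy ((AffW D).inv_mem hx)) hp hp'

lemma main_sub {D : RootData n} {lam : V n} {γ : PreGallery n} (hmin : IsMinimal D γ)
    (hfirst : γ.p 0 = {(0 : V n)}) (hlast : γ.p (γ.len + 1) = {lam}) :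
    VShadow D (alcoveOrient D (fund D)) γ ⊆ W0orbit D lam := by
  rintro μ ⟨γ', hg, ⟨hlen, htype⟩, hp0, hpf, hend⟩
  have hG := hmin.1
  obtain ⟨x, hx, hx0⟩ := transitive (hG.1 0 (by omega)) (hg.1 0 (by omega))
    (hG.2.1.2 (by rw [hfirst]; rfl)) (hg.2.1.2 (by rw [hp0, hfirst]; rfl))
  have hxA := finW_le D hx
  have hall : ∀ j ≤ γ.len, γ'.c j = x '' γ.c j := by
    intro j
    induction j with
    | zero => intro _; exact hx0
    | succ j ih =>
      intro hj
      have hjl : j < γ.len := by omega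
      have hjl' : j < γ'.len := by omega
      have hcj := ih (by omega)
      obtain ⟨p1, p2⟩ := gal_panel hG hjl
      obtain ⟨q1, q2⟩ := gal_panel hg hjl'
      have hpe : γ'.p (j + 1) = x '' γ.p (j + 1) :=
        same_type_eq hxA q1.1 (by rw [hcj]; exact Set.image_mono (panel_sub p1)) (panel_sub q1)
          (htype (j + 1) (by omega))
      have hne : γ'.c j ≠ γ'.c (j + 1) := by
        intro he
        have := hpf (j + 1) (by omega) (by omega) (by simpa using he)
        rw [← he, hcj, hpe] at this
        exact no_fold hmin hfirst hjl hx this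
      refine other_unique q1 q2 ?_ hne ?_
      · rw [hpe]; exact panel_map hxA p2
      · rw [hcj]
        intro he
        exact min_ne hmin hjl (Set.image_injective.2 x.injective he)
  have hc := hall γ.len le_rfl
  have hl := same_type_eq hxA (hg.1 γ.len (by omega)) (p := γ.p (γ.len + 1))
    (p' := γ'.p (γ.len + 1)) (by rw [hc]; exact Set.image_mono hG.2.2.1.2)
    (by have := hg.2.2.1.2; rwa [← hlen] at this) (htype _ le_rfl)
  rw [← hlen, hl, hlast, Set.image_singleton] at hend
  exact ⟨x, hx, Set.singleton_injective hend⟩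

lemma main_sup {D : RootData n} {lam : V n} {γ : PreGallery n} (hmin : IsMinimal D γ)
    (hfirst : γ.p 0 = {(0 : V n)}) (hlast : γ.p (γ.len + 1) = {lam}) :
    W0orbit D lam ⊆ VShadow D (alcoveOrient D (fund D)) γ := by
  rintro _ ⟨x, hx, rfl⟩
  have hxA := finW_le D hx
  obtain ⟨h1, ⟨h2, h2'⟩, ⟨h3, h3'⟩, h4⟩ := hmin.1
  refine ⟨⟨γ.len, fun i => x '' γ.p i, fun i => x '' γ.c i⟩,
    ⟨fun i hi => alcove_map hxA (h1 i hi), ⟨face_map hxA h2, Set.image_mono h2'⟩,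
      ⟨face_map hxA h3, Set.image_mono h3'⟩,
      fun i hi hi' => ⟨panel_map hxA (h4 i hi hi').1, panel_map hxA (h4 i hi hi').2⟩⟩,
    ⟨rfl, fun i _ => ⟨x, hxA, rfl⟩⟩, ?_, ?_, ?_⟩
  · change x '' γ.p 0 = γ.p 0
    rw [hfirst, Set.image_singleton, finW_zero D hx]
  · intro i hi hi' he
    exfalso
    have h5 := Set.image_injective.2 x.injective he
    have h6 := min_ne hmin (a := i - 1) (by change i ≤ γ.len at hi'; omega)
    rw [show i - 1 + 1 = i by omega] at h6
    exact h6 h5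
  · change _ = x '' γ.p (γ.len + 1)
    rw [hlast, Set.image_singleton]

end ShadowProof

/-- Base case of the shadow recursion: the shadow of `λ` with respect to the
orientation induced by the fundamental alcove is the `W₀`-orbit of `λ`. -/
theorem shadow_fund_eq_orbit {n : ℕ} (D : RootData n)
    (lam : V n) (hlam : lam ∈ corootLattice D)
    (γ : PreGallery n) (hmin : IsMinimal D γ)
    (hfirst : γ.p 0 = {(0 : V n)}) (hlast : γ.p (γ.len + 1) = {lam}) :
    VShadow D (alcoveOrient D (fund D)) γ = W0orbit D lam := by
  exact Set.Subset.antisymm (ShadowProof.main_sub hmin hfirst hlast)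
    (ShadowProof.main_sup hmin hfirst hlast)
end
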